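/- Assume [H1] and [H2], and let ψ be the maximal L^p-solution of the nonlocal Fokker–Planck equation with maximal interval of existence (0, T_max). Then for every δ > 0 and every ρ ∈ [σ, 2), sup_{t ≥ δ} ‖ψ(t)‖_{W^{ρ,p}(𝕋ⁿ)} < ∞, and the orbit set γ⁺(ψ₀) := {ψ(t,·) : 0 ≤ t < T_max} is relatively compact in C¹(𝕋ⁿ). -/

import Mathlib

open MeasureTheory ENNReal Set Filter

noncomputable section

/-- Ambient space `ℝ × ℝ^m`: the universal cover of the torus `𝕋^{m+1}` (so `n = m + 1`). -/
abbrev Spc (m : ℕ) : Type := ℝ × (Fin m → ℝ)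

/-- Unit cube in the last `m` coordinates: a fundamental domain for `𝕋^m`. -/
def cube1 (m : ℕ) : Set (Fin m → ℝ) := Set.pi Set.univ fun _ => Set.Ico (0 : ℝ) 1

/-- A fundamental domain for the torus `𝕋^{m+1}`. -/
def cube (m : ℕ) : Set (Spc m) := Set.Ico (0 : ℝ) 1 ×ˢ cube1 m

/-- The measure of the torus: Lebesgue measure restricted to a fundamental domain. -/
def μT (m : ℕ) : Measure (Spc m) := volume.restrict (cube m)

/-- `ℤ^{m+1}`-periodicity: `f` is a function on the torus `𝕋^{m+1}`. -/
def IsPeriodic {m : ℕ} (f : Spc m → ℝ) : Prop :=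
  ∀ (x : Spc m) (k : ℤ) (j : Fin m → ℤ), f (x.1 + k, fun i => x.2 i + j i) = f x

/-- The first coordinate direction. -/
def e1 (m : ℕ) : Spc m := (1, 0)

/-- The remaining coordinate directions. -/
def eC (m : ℕ) (i : Fin m) : Spc m := (0, Pi.single i 1)

/-- Partial derivative in the direction `v`. -/
def pd {m : ℕ} (v : Spc m) (f : Spc m → ℝ) (x : Spc m) : ℝ := fderiv ℝ f x v

/-- `∇f ⋅ ∇g`. -/
def gradDot {m : ℕ} (f g : Spc m → ℝ) (x : Spc m) : ℝ :=
  pd (e1 m) f x * pd (e1 m) g x + ∑ i, pd (eC m i) f x * pd (eC m i) g x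

/-- The Laplacian. -/
def lap {m : ℕ} (f : Spc m → ℝ) (x : Spc m) : ℝ :=
  pd (e1 m) (pd (e1 m) f) x + ∑ i, pd (eC m i) (pd (eC m i) f) x

/-- The marginal `ψ̄(x₁) = ∫_{𝕋^m} ψ(x₁, ⋅)`. -/
def marg {m : ℕ} (ψ : Spc m → ℝ) (x1 : ℝ) : ℝ := ∫ y in cube1 m, ψ (x1, y)

/-- The nonlocal coefficient `φ_ψ = (∫ ∂_{x₁}V ψ dx₂…dxₙ) / ψ̄`. -/
def phiF {m : ℕ} (V ψ : Spc m → ℝ) (x1 : ℝ) : ℝ :=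
  (∫ y in cube1 m, pd (e1 m) V (x1, y) * ψ (x1, y)) / marg ψ x1

/-- `F(ψ) = ∇V⋅∇ψ + ΔV ψ − ∂_{x₁}(φ_ψ ψ)`. -/
def Fop {m : ℕ} (V ψ : Spc m → ℝ) (x : Spc m) : ℝ :=
  gradDot V ψ x + lap V x * ψ x - pd (e1 m) (fun z => phiF V ψ z.1 * ψ z) x

/-- `L^p`-norm on the torus. -/
def LpN {m : ℕ} (p : ℝ) (f : Spc m → ℝ) : ℝ≥0∞ := eLpNorm f (ENNReal.ofReal p) (μT m)

/-- Gagliardo (Sobolev–Slobodeckij) seminorm of fractional order `s`. -/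
def gagl {m : ℕ} {F : Type*} [NormedAddCommGroup F] (s p : ℝ) (f : Spc m → F) : ℝ≥0∞ :=
  (∫⁻ x in cube m, ∫⁻ y in cube m,
      ENNReal.ofReal (‖f x - f y‖ ^ p / ‖x - y‖ ^ ((m : ℝ) + 1 + s * p))) ^ (1 / p)

/-- The differential of `f`. -/
def grd {m : ℕ} (f : Spc m → ℝ) (x : Spc m) : Spc m →L[ℝ] ℝ := fderiv ℝ f x

/-- The `W^{σ,p}`-norm on the torus, for `0 ≤ σ ≤ 2`. -/
def WNorm {m : ℕ} (σ p : ℝ) (f : Spc m → ℝ) : ℝ≥0∞ :=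
  if σ ≤ 0 then LpN p f
  else if σ < 1 then LpN p f + gagl σ p f
  else if σ < 2 then
    LpN p f + eLpNorm (fun x => ‖grd f x‖) (ENNReal.ofReal p) (μT m)
      + (if σ = 1 then 0 else gagl (σ - 1) p (grd f))
  else
    LpN p f + eLpNorm (fun x => ‖grd f x‖) (ENNReal.ofReal p) (μT m)
      + eLpNorm (fun x => ‖iteratedFDeriv ℝ 2 f x‖) (ENNReal.ofReal p) (μT m)

/-- Membership in `W^{σ,p}(𝕋^{m+1})`, for `0 ≤ σ ≤ 2`. -/
def MemW {m : ℕ} (σ p : ℝ) (f : Spc m → ℝ) : Prop :=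
  IsPeriodic f ∧ Measurable f ∧ (1 ≤ σ → Differentiable ℝ f) ∧
    (2 ≤ σ → Differentiable ℝ (grd f)) ∧ WNorm σ p f < ⊤

/-- Membership in `𝒟^{σ,p}(𝕋^{m+1}) = {ψ ∈ W^{σ,p} | ψ̄ > 0}`. -/
def MemD {m : ℕ} (σ p : ℝ) (f : Spc m → ℝ) : Prop :=
  MemW σ p f ∧ ∀ x1 : ℝ, 0 < marg f x1

/-- Hypothesis `[H₁]`: `ψ₀ ∈ 𝒟^{σ,p}`, `ψ₀ ≥ 0`, `∫ ψ₀ = 1`. -/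
def Hyp1 {m : ℕ} (σ p : ℝ) (ψ0 : Spc m → ℝ) : Prop :=
  MemD σ p ψ0 ∧ (∀ x, 0 ≤ ψ0 x) ∧ (∫ x in cube m, ψ0 x) = 1

/-- Hypothesis `[H₂]`: `n = m + 1 ≥ 2`, `p > n`, `σ ∈ (1 + n/p, 2)`. -/
def Hyp2 (m : ℕ) (σ p : ℝ) : Prop :=
  1 ≤ m ∧ (m : ℝ) + 1 < p ∧ 1 + ((m : ℝ) + 1) / p < σ ∧ σ < 2

/-- The real interval `[0, Tmax)`, where `Tmax ∈ (0, ∞]`. -/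
def Ico0 (Tmax : ℝ≥0∞) : Set ℝ := {t : ℝ | 0 ≤ t ∧ ENNReal.ofReal t < Tmax}

/-- The real interval `(0, Tmax)`, where `Tmax ∈ (0, ∞]`. -/
def Ioo0 (Tmax : ℝ≥0∞) : Set ℝ := {t : ℝ | 0 < t ∧ ENNReal.ofReal t < Tmax}

/-- Continuity in `W^{σ,p}`-norm of a curve, on a time set `s`. -/
def ContW {m : ℕ} (σ p : ℝ) (s : Set ℝ) (ψ : ℝ → Spc m → ℝ) : Prop :=
  ∀ t ∈ s, ∀ ε : ℝ, 0 < ε → ∃ δ > 0, ∀ t' ∈ s, |t' - t| < δ →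
    WNorm σ p (fun x => ψ t' x - ψ t x) < ENNReal.ofReal ε

/-- Hölder continuity (exponent `α`) in `W^{σ,p}`-norm of a curve, on a time set `s`. -/
def HolderW {m : ℕ} (α σ p : ℝ) (s : Set ℝ) (ψ : ℝ → Spc m → ℝ) : Prop :=
  ∃ C : ℝ, ∀ t ∈ s, ∀ t' ∈ s,
    WNorm σ p (fun x => ψ t' x - ψ t x) ≤ ENNReal.ofReal (C * |t' - t| ^ α)

/-- `ψ` is an `L^p`-solution on `[0, Tmax)` of the nonlocal Fokker–Planck equation
`∂ₜψ = div(∇V ψ + β⁻¹∇ψ) − ∂_{x₁}(φ_ψ ψ) = β⁻¹Δψ + F(ψ)`, `ψ(0) = ψ₀`. -/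
structure IsLpSolution {m : ℕ} (V : Spc m → ℝ) (β σ p : ℝ) (ψ0 : Spc m → ℝ)
    (Tmax : ℝ≥0∞) (ψ : ℝ → Spc m → ℝ) : Prop where
  init : ∀ x, ψ 0 x = ψ0 x
  contLp : ContW 0 p (Ico0 Tmax) ψ
  regW2 : ∀ t ∈ Ioo0 Tmax, MemW 2 p (ψ t)
  regD : ∀ t ∈ Ioo0 Tmax, MemD σ p (ψ t)
  eqn : ∀ t ∈ Ioo0 Tmax,
    Tendsto (fun h : ℝ => LpN p
        (fun x => (ψ (t + h) x - ψ t x) / h - (β⁻¹ * lap (ψ t) x + Fop V (ψ t) x)))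
      (nhdsWithin 0 {h : ℝ | h ≠ 0}) (nhds 0)
  derivCont : ContW 0 p (Ioo0 Tmax)
    (fun t x => β⁻¹ * lap (ψ t) x + Fop V (ψ t) x)

/-- A maximal `L^p`-solution: an `L^p`-solution admitting no proper extension. -/
def IsMaximalLpSolution {m : ℕ} (V : Spc m → ℝ) (β σ p : ℝ) (ψ0 : Spc m → ℝ)
    (Tmax : ℝ≥0∞) (ψ : ℝ → Spc m → ℝ) : Prop :=
  IsLpSolution V β σ p ψ0 Tmax ψ ∧ 0 < Tmax ∧
    ∀ (Tmax' : ℝ≥0∞) (ψ' : ℝ → Spc m → ℝ), IsLpSolution V β σ p ψ0 Tmax' ψ' →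
      (∀ t ∈ Ico0 Tmax, ψ' t = ψ t) → Tmax' ≤ Tmax

/-- The Euclidean quadratic form on `Spc m`. -/
def qd {m : ℕ} (z : Spc m) : ℝ := z.1 ^ 2 + ∑ i, z.2 i ^ 2

/-- The heat semigroup `e^{β⁻¹ t Δ}` on the torus, realized by convolution with the Gaussian
heat kernel on the universal cover (and the identity for `t ≤ 0`). -/
def heatSG {m : ℕ} (β t : ℝ) (f : Spc m → ℝ) (x : Spc m) : ℝ :=
  if t ≤ 0 then f x
  else ∫ y : Spc m, (4 * Real.pi * (t / β)) ^ (-((m : ℝ) + 1) / 2) *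
      Real.exp (-qd (x - y) / (4 * (t / β))) * f y

/-- `ψ` is a mild solution of the nonlocal Fokker–Planck equation on `[0, Tmax)`:
`ψ ∈ C([0,Tmax), 𝒟^{σ,p})` and `ψ(t) = e^{β⁻¹tΔ}ψ₀ + ∫₀ᵗ e^{β⁻¹(t−s)Δ} F(ψ(s)) ds`. -/
def IsMildSolution {m : ℕ} (V : Spc m → ℝ) (β σ p : ℝ) (ψ0 : Spc m → ℝ)
    (Tmax : ℝ≥0∞) (ψ : ℝ → Spc m → ℝ) : Prop :=
  (∀ x, ψ 0 x = ψ0 x) ∧ (∀ t ∈ Ico0 Tmax, MemD σ p (ψ t)) ∧ ContW σ p (Ico0 Tmax) ψ ∧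
    ∀ t ∈ Ico0 Tmax, ∀ᵐ x ∂(volume : Measure (Spc m)),
      ψ t x = heatSG β t ψ0 x + ∫ s in Set.Ioc (0 : ℝ) t, heatSG β (t - s) (Fop V (ψ s)) x

/-- A maximal mild solution. -/
def IsMaximalMildSolution {m : ℕ} (V : Spc m → ℝ) (β σ p : ℝ) (ψ0 : Spc m → ℝ)
    (Tmax : ℝ≥0∞) (ψ : ℝ → Spc m → ℝ) : Prop :=
  IsMildSolution V β σ p ψ0 Tmax ψ ∧ 0 < Tmax ∧
    ∀ (Tmax' : ℝ≥0∞) (ψ' : ℝ → Spc m → ℝ), IsMildSolution V β σ p ψ0 Tmax' ψ' →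
      (∀ t ∈ Ico0 Tmax, ψ' t = ψ t) → Tmax' ≤ Tmax

/-- `L^p`-norm on the one-dimensional torus `𝕋`. -/
def LpN1 (p : ℝ) (g : ℝ → ℝ) : ℝ≥0∞ :=
  eLpNorm g (ENNReal.ofReal p) (volume.restrict (Set.Ico (0 : ℝ) 1))

/-- Membership in `L^p₀(𝕋^{m+1})`: periodic, `L^p` and of mean zero. -/
def MemL0 {m : ℕ} (p : ℝ) (f : Spc m → ℝ) : Prop :=
  IsPeriodic f ∧ Measurable f ∧ LpN p f < ⊤ ∧ (∫ x in cube m, f x) = 0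

/-- The `C¹(𝕋^{m+1})`-distance. -/
def C1dist {m : ℕ} (f g : Spc m → ℝ) : ℝ≥0∞ :=
  (⨆ x : Spc m, ENNReal.ofReal |f x - g x|) + ⨆ x : Spc m, ENNReal.ofReal ‖grd f x - grd g x‖

open scoped Pointwise

instance instHaarSpc (m : ℕ) : (volume : Measure (Spc m)).IsAddHaarMeasure := by
  rw [Measure.volume_eq_prod]; infer_instance

def lat {m : ℕ} (k : ℤ × (Fin m → ℤ)) : Spc m := ((k.1 : ℝ), fun i => (k.2 i : ℝ))

def Per {m : ℕ} {α : Type*} (f : Spc m → α) : Prop := ∀ x k, f (x + lat k) = f x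

lemma isPeriodic_iff {m : ℕ} {f : Spc m → ℝ} : IsPeriodic f ↔ Per f :=
  ⟨fun h x k => h x k.1 k.2, fun h x k j => h x (k, j)⟩

def bas (m : ℕ) : Module.Basis (Unit ⊕ Fin m) ℝ (Spc m) :=
  (Module.Basis.singleton Unit ℝ).prod (Pi.basisFun ℝ (Fin m))

lemma fd_eq (m : ℕ) : ZSpan.fundamentalDomain (bas m) = cube m := by
  ext x
  simp [ZSpan.mem_fundamentalDomain, bas, cube, cube1]

lemma fd (m : ℕ) : IsAddFundamentalDomain (Submodule.span ℤ (Set.range (bas m))) (cube m) volume := by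
  rw [← fd_eq]; exact ZSpan.isAddFundamentalDomain _ _

lemma lat_of_span {m : ℕ} (g : Spc m) (hg : g ∈ Submodule.span ℤ (Set.range (bas m))) :
    ∃ k, g = lat k := by
  have h := (bas m).mem_span_iff_repr_mem ℤ g
  rw [h] at hg
  choose c hc using hg
  refine ⟨(c (Sum.inl ()), fun i => c (Sum.inr i)), ?_⟩
  have h1 := hc (Sum.inl ())
  have h2 := fun i => hc (Sum.inr i)
  simp [bas] at h1 h2
  ext <;> simp [lat, h1, h2]

lemma Per.vadd {m : ℕ} {α : Type*} {f : Spc m → α} (hf : Per f)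
    (g : Submodule.span ℤ (Set.range (bas m))) (x : Spc m) : f (g +ᵥ x) = f x := by
  obtain ⟨k, hk⟩ := lat_of_span g.1 g.2
  have : g +ᵥ x = x + lat k := by rw [← hk, add_comm]; rfl
  rw [this, hf]

lemma fd_shift (m : ℕ) (h : Spc m) :
    IsAddFundamentalDomain (Submodule.span ℤ (Set.range (bas m))) (h +ᵥ cube m) volume :=
  (fd m).vadd_of_comm h

instance instVaddSpan (m : ℕ) :
    VAddInvariantMeasure (Submodule.span ℤ (Set.range (bas m))) (Spc m) volume :=
  ⟨fun c _ _ => measure_preimage_add volume c.1 _⟩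

lemma meas_cube (m : ℕ) : MeasurableSet (cube m) :=
  measurableSet_Ico.prod (MeasurableSet.pi Set.countable_univ fun _ _ => measurableSet_Ico)

lemma shift_lint {m : ℕ} {f : Spc m → ℝ≥0∞} (hf : Per f) (h : Spc m) :
    ∫⁻ x in cube m, f (h + x) = ∫⁻ x in cube m, f x := by
  rw [(fd m).setLIntegral_eq (fd_shift m h) f hf.vadd]
  have := (measurePreserving_add_left (volume : Measure (Spc m)) h).setLIntegral_comp_emb
    (MeasurableEquiv.addLeft h).measurableEmbedding f (cube m)
  exact this

lemma shift_int {m : ℕ} {f : Spc m → ℝ} (hf : Per f) (h : Spc m) :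
    ∫ x in cube m, f (h + x) = ∫ x in cube m, f x := by
  rw [(fd m).setIntegral_eq (fd_shift m h) hf.vadd]
  have := (measurePreserving_add_left (volume : Measure (Spc m)) h).setIntegral_image_emb
    (MeasurableEquiv.addLeft h).measurableEmbedding f (cube m)
  rw [← this]; rfl

lemma vol_cube1 (m : ℕ) : volume (cube1 m) = 1 := by
  simp [cube1, volume_pi_pi]

lemma vol_cube (m : ℕ) : volume (cube m) = 1 := by
  rw [cube, Measure.volume_eq_prod, Measure.prod_prod, vol_cube1]; simp

instance (m : ℕ) : IsProbabilityMeasure (volume.restrict (cube m)) := ⟨by simp [vol_cube]⟩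
instance (m : ℕ) : IsProbabilityMeasure (volume.restrict (cube1 m)) := ⟨by simp [vol_cube1]⟩

lemma lat_cover {m : ℕ} (x : Spc m) : ∃ k, x + lat k ∈ cube m := by
  refine ⟨(-⌊x.1⌋, fun i => -⌊x.2 i⌋), ?_⟩
  simp only [cube, cube1, lat, mem_prod, Set.mem_pi, mem_Ico, Prod.fst_add, Prod.snd_add]
  push_cast
  refine ⟨⟨?_, ?_⟩, fun i _ => ⟨?_, ?_⟩⟩
  · linarith [Int.floor_le x.1]
  · linarith [Int.lt_floor_add_one x.1]
  · show 0 ≤ x.2 i + -(⌊x.2 i⌋ : ℝ); linarith [Int.floor_le (x.2 i)]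
  · show x.2 i + -(⌊x.2 i⌋ : ℝ) < 1; linarith [Int.lt_floor_add_one (x.2 i)]

def ccube (m : ℕ) : Set (Spc m) := Icc 0 1 ×ˢ Set.pi univ fun _ => Icc (0:ℝ) 1

lemma cube_sub (m : ℕ) : cube m ⊆ ccube m :=
  prod_mono Ico_subset_Icc_self (pi_mono fun _ _ => Ico_subset_Icc_self)

lemma compact_ccube (m : ℕ) : IsCompact (ccube m) :=
  isCompact_Icc.prod (isCompact_univ_pi fun _ => isCompact_Icc)

/-- periodic continuous functions are bounded -/
lemma Per.bdd {m : ℕ} {F : Type*} [NormedAddCommGroup F] {f : Spc m → F} (hf : Per f)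
    (hc : Continuous f) : ∃ C, 0 ≤ C ∧ ∀ x, ‖f x‖ ≤ C := by
  obtain ⟨C, hC⟩ := (compact_ccube m).exists_bound_of_continuousOn hc.continuousOn
  refine ⟨max C 0, le_max_right _ _, fun x => ?_⟩
  obtain ⟨k, hk⟩ := lat_cover x
  rw [← hf x k]
  exact (hC _ (cube_sub m hk)).trans (le_max_left _ _)

lemma Per.fderiv {m : ℕ} {F : Type*} [NormedAddCommGroup F] [NormedSpace ℝ F] {f : Spc m → F}
    (hf : Per f) : Per (fderiv ℝ f) := fun x k => by
  have : (fun y => f (y + lat k)) = f := funext fun y => hf y k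
  rw [← fderiv_comp_add_right (f := f) (lat k), this]

lemma Per.pd {m : ℕ} {f : Spc m → ℝ} (hf : Per f) (v : Spc m) : Per (pd v f) := fun x k => by
  simp only [_root_.pd, hf.fderiv x k]

lemma int_cube {m : ℕ} {F : Type*} [NormedAddCommGroup F] {f : Spc m → F} (hc : Continuous f) :
    IntegrableOn f (cube m) :=
  (hc.continuousOn.integrableOn_compact (compact_ccube m)).mono_set (cube_sub m)

lemma meas_pd {m : ℕ} (f : Spc m → ℝ) (v : Spc m) : Measurable (pd v f) :=
  measurable_fderiv_apply_const ℝ f v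

/-- integral of a derivative over the torus vanishes -/
lemma ibp0 {m : ℕ} {w : Spc m → ℝ} (hw : Per w) (hd : Differentiable ℝ w)
    (k : ℤ × (Fin m → ℤ)) (hi : IntegrableOn (pd (lat k) w) (cube m)) :
    ∫ x in cube m, pd (lat k) w x = 0 := by
  set v := lat k with hv
  set ν := (volume.restrict (cube m))
  set I := (volume.restrict (Ioc (0:ℝ) 1))
  have hmeas : Measurable (fun q : Spc m × ℝ => pd v w (q.2 • v + q.1)) :=
    (meas_pd w v).comp (by fun_prop)
  have hP := hw.pd v
  have hint : Integrable (fun q : Spc m × ℝ => pd v w (q.2 • v + q.1)) (ν.prod I) := by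
    refine ⟨hmeas.aestronglyMeasurable, ?_⟩
    rw [HasFiniteIntegral, lintegral_prod_symm _ (by exact hmeas.enorm.aemeasurable)]
    have : ∀ θ : ℝ, ∫⁻ x, ‖pd v w (θ • v + x)‖ₑ ∂ν = ∫⁻ x, ‖pd v w x‖ₑ ∂ν := fun θ =>
      shift_lint (f := fun x => ‖pd v w x‖ₑ) (fun x k => by simp only [hP x k]) _
    simp only [this, lintegral_const]
    refine ENNReal.mul_lt_top hi.2 (by simp [I])
  have hae := hint.prod_right_ae
  have h1 : ∫ x, ∫ θ, pd v w (θ • v + x) ∂I ∂ν = 0 := by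
    rw [integral_congr_ae (g := fun _ => (0:ℝ)) ?_, integral_zero]
    filter_upwards [hae] with x hx
    have hder : ∀ θ ∈ uIcc (0:ℝ) 1, HasDerivAt (fun θ : ℝ => w (θ • v + x)) (pd v w (θ • v + x)) θ := by
      intro θ _
      have h2 : HasDerivAt (fun θ : ℝ => θ • v + x) v θ := by
        simpa using ((hasDerivAt_id θ).smul_const v).add_const x
      exact (hd _).hasFDerivAt.comp_hasDerivAt θ h2
    have := intervalIntegral.integral_eq_sub_of_hasDerivAt hder
      ((intervalIntegrable_iff_integrableOn_Ioc_of_le zero_le_one).2 hx)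
    rw [intervalIntegral.integral_of_le zero_le_one] at this
    show ∫ θ in Ioc (0:ℝ) 1, pd v w (θ • v + x) = 0
    rw [this]; simp only [one_smul, zero_smul, zero_add]
    rw [add_comm, hv, hw]; simp
  rw [integral_integral_swap hint] at h1
  have : ∀ θ : ℝ, ∫ x, pd v w (θ • v + x) ∂ν = ∫ x, pd v w x ∂ν := fun θ => shift_int hP _
  simp only [this, integral_const] at h1
  simpa [I] using h1

def dir {m : ℕ} : Option (Fin m) → Spc m
  | none => e1 m
  | some i => eC m i

lemma dir_lat {m : ℕ} (o : Option (Fin m)) : ∃ k, dir o = lat k := by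
  rcases o with _ | i
  · exact ⟨(1, 0), by ext <;> simp [dir, lat, e1]⟩
  · refine ⟨(0, Pi.single i 1), ?_⟩
    ext j
    · simp [dir, lat, eC]
    · by_cases h : j = i
      · subst h; simp [dir, lat, eC]
      · simp [dir, lat, eC, h]

lemma ibp0' {m : ℕ} {w : Spc m → ℝ} (hw : Per w) (hd : Differentiable ℝ w)
    (o : Option (Fin m)) (hi : IntegrableOn (pd (dir o) w) (cube m)) :
    ∫ x in cube m, pd (dir o) w x = 0 := by
  obtain ⟨k, hk⟩ := dir_lat o
  rw [hk] at hi ⊢; exact ibp0 hw hd k hi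

def co {m : ℕ} : Option (Fin m) → Spc m →L[ℝ] ℝ
  | none => ContinuousLinearMap.fst ℝ ℝ (Fin m → ℝ)
  | some i => (ContinuousLinearMap.proj (R := ℝ) (φ := fun _ : Fin m => ℝ) i).comp
      (ContinuousLinearMap.snd ℝ ℝ (Fin m → ℝ))

lemma qd_eq {m : ℕ} (z : Spc m) : qd z = ∑ o, co o z ^ 2 := by
  simp [qd, co, Fintype.sum_option]

lemma co_dir {m : ℕ} (o o' : Option (Fin m)) : co o (dir o') = if o = o' then 1 else 0 := by
  rcases o with _ | i <;> rcases o' with _ | j <;> simp [co, dir, e1, eC, Pi.single_apply]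

lemma co_le {m : ℕ} (o : Option (Fin m)) (z : Spc m) : |co o z| ≤ ‖z‖ := by
  rcases o with _ | i
  · exact norm_fst_le z
  · exact (norm_le_pi_norm z.2 i).trans (norm_snd_le z)

lemma sum_co {m : ℕ} (z : Spc m) : z = ∑ o, co o z • dir o := by
  rw [Fintype.sum_option]
  ext j
  · simp [co, dir, e1, eC, Prod.fst_sum]
  · simp [co, dir, e1, eC, Prod.snd_sum, Finset.sum_apply, Pi.single_apply]

lemma clm_dir {m : ℕ} (L : Spc m →L[ℝ] ℝ) (z : Spc m) : L z = ∑ o, co o z * L (dir o) := by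
  conv_lhs => rw [sum_co z]
  simp

def G {m : ℕ} (τ : ℝ) (z : Spc m) : ℝ := (√(4 * Real.pi * τ))⁻¹ ^ (m + 1) * Real.exp (-qd z / (4 * τ))
def dG {m : ℕ} (τ : ℝ) (o : Option (Fin m)) (z : Spc m) : ℝ := -(co o z / (2 * τ)) * G τ z
def ddG {m : ℕ} (τ : ℝ) (o o' : Option (Fin m)) (z : Spc m) : ℝ :=
  (co o z * co o' z / (4 * τ ^ 2) - (if o = o' then 1 else 0) / (2 * τ)) * G τ z

lemma G_nonneg {m : ℕ} (τ : ℝ) (z : Spc m) : 0 ≤ G τ z := by unfold G; positivity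

lemma qd_nonneg {m : ℕ} (z : Spc m) : 0 ≤ qd z := by rw [qd_eq]; positivity

lemma cont_qd {m : ℕ} : Continuous (qd (m := m)) := by unfold qd; fun_prop

lemma cont_G {m : ℕ} (τ : ℝ) : Continuous (G (m := m) τ) := by
  unfold G; have := cont_qd (m := m); fun_prop
lemma cont_dG {m : ℕ} (τ : ℝ) (o) : Continuous (dG (m := m) τ o) := by
  unfold dG; have := cont_G (m := m) τ; fun_prop
lemma cont_ddG {m : ℕ} (τ : ℝ) (o o') : Continuous (ddG (m := m) τ o o') := by
  unfold ddG; have := cont_G (m := m) τ; fun_prop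

lemma hasF_G {m : ℕ} (τ : ℝ) (z : Spc m) :
    HasFDerivAt (G τ) (∑ o, dG τ o z • co o) z := by
  have h1 : HasFDerivAt (fun z : Spc m => qd z) (∑ o, (2 * co o z) • co o) z := by
    simp only [qd_eq]
    refine HasFDerivAt.fun_sum fun o _ => ?_
    simpa using ((co o).hasFDerivAt (x := z)).pow 2
  have h2 := ((h1.neg.mul_const (4 * τ)⁻¹).exp).const_mul ((√(4 * Real.pi * τ))⁻¹ ^ (m + 1))
  refine HasFDerivAt.congr_fderiv (f := G τ) (by unfold G; simpa only [div_eq_mul_inv] using! h2) ?_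
  refine ContinuousLinearMap.ext fun v => ?_
  simp only [dG, G, smul_apply, neg_apply,
    FunLike.coe_sum, Finset.sum_apply, smul_eq_mul, Finset.mul_sum, ← Finset.sum_neg_distrib]
  refine Finset.sum_congr rfl fun o _ => ?_
  rw [div_eq_mul_inv (-qd z)]
  change _ * (Real.exp (-qd z * (4 * τ)⁻¹) * _) = _
  by_cases h : τ = 0
  · simp [h]
  · field_simp; ring

lemma hasF_dG {m : ℕ} (τ : ℝ) (o : Option (Fin m)) (z : Spc m) :
    HasFDerivAt (dG τ o) (∑ o', ddG τ o o' z • co o') z := by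
  have h := ((((co o).hasFDerivAt (x := z)).mul_const (2 * τ)⁻¹).neg).mul (hasF_G τ z)
  refine HasFDerivAt.congr_fderiv (f := dG τ o)
    (by simpa only [dG, div_eq_mul_inv] using! h) ?_
  refine ContinuousLinearMap.ext fun v => ?_
  simp only [ddG, smul_apply, neg_apply,
    add_apply, sub_mul, Finset.sum_sub_distrib,
    FunLike.coe_sum, Finset.sum_apply, smul_eq_mul, Finset.mul_sum]
  simp only [ite_div, ite_mul, zero_div, zero_mul, Finset.sum_ite_eq, Finset.mem_univ, if_true]
  rw [sub_eq_add_neg]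
  congr 1
  · refine Finset.sum_congr rfl fun o' _ => ?_
    change -(co o z * (2 * τ)⁻¹) * _ = _
    by_cases h : τ = 0
    · simp [h]
    · field_simp; ring
  · by_cases h : τ = 0
    · simp [h]
    · field_simp

lemma pd_G {m : ℕ} (τ : ℝ) (v z : Spc m) : pd v (G τ) z = ∑ o, dG τ o z * co o v := by
  rw [pd, (hasF_G τ z).fderiv]; simp

lemma hasD_G {m : ℕ} {τ : ℝ} (hτ : 0 < τ) (z : Spc m) :
    HasDerivAt (fun τ => G τ z) (∑ o, ddG τ o o z) τ := by
  have hp := Real.pi_pos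
  have h0 : 0 < 4 * Real.pi * τ := by positivity
  have h1 : HasDerivAt (fun τ => (√(4 * Real.pi * τ))) (4 * Real.pi / (2 * √(4 * Real.pi * τ))) τ :=
    HasDerivAt.sqrt (by simpa using (hasDerivAt_id τ).const_mul (4 * Real.pi)) h0.ne'
  have hs : √(4 * Real.pi * τ) ≠ 0 := (Real.sqrt_pos.2 h0).ne'
  have h2 := (h1.inv hs).pow (m + 1)
  have h3 : HasDerivAt (fun τ => -qd z / (4 * τ)) (qd z / (4 * τ ^ 2)) τ := by
    have := ((hasDerivAt_id τ).const_mul 4).inv (by simp; positivity) |>.const_mul (-qd z)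
    refine (this.congr_deriv ?_)
    simp; field_simp
  refine (h2.mul h3.exp).congr_deriv ?_
  simp only [ddG, G, ← Finset.sum_mul, Finset.sum_sub_distrib, ← Finset.sum_div, ← pow_two, ← qd_eq]
  simp only [if_true, Finset.sum_const, Finset.card_univ, Fintype.card_option, Fintype.card_fin]
  have hsq : √(4 * Real.pi * τ) ^ 2 = 4 * Real.pi * τ := Real.sq_sqrt h0.le
  set r := √(4 * Real.pi * τ)
  simp only [nsmul_eq_mul, mul_one, Pi.pow_apply, Pi.inv_apply]
  simp only [show (r:ℝ)⁻¹ ^ (m + 1) = r⁻¹ ^ m * r⁻¹ from pow_succ _ _, Nat.add_sub_cancel]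
  have h4 : -(4 * Real.pi / (2 * r)) / r ^ 2 = - r⁻¹ / (2 * τ) := by
    rw [hsq]; field_simp; try norm_num
  rw [h4]; push_cast; ring

lemma G_mono {m : ℕ} {a b : ℝ} (ha : 0 < a) (h1 : a ≤ b) (h2 : b ≤ 16 * a) (z : Spc m) :
    G a z ≤ 4 ^ (m + 1) * G b z := by
  have hp := Real.pi_pos
  have hb : 0 < b := ha.trans_le h1
  have hq := qd_nonneg z
  unfold G
  rw [← mul_assoc, ← mul_pow]
  have hsa : 0 < √(4 * Real.pi * a) := Real.sqrt_pos.2 (by positivity)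
  have hsb : 0 < √(4 * Real.pi * b) := Real.sqrt_pos.2 (by positivity)
  refine mul_le_mul (pow_le_pow_left₀ (by positivity) ?_ _) (Real.exp_le_exp.2 ?_) (by positivity) (by positivity)
  · rw [inv_le_iff_one_le_mul₀ hsa, mul_comm, ← mul_assoc, ← div_eq_mul_inv, le_div_iff₀ hsb, one_mul]
    rw [Real.sqrt_le_left (by positivity), mul_pow, Real.sq_sqrt (by positivity)]
    nlinarith
  · rw [neg_div, neg_div, neg_le_neg_iff]; gcongr

lemma G_double {m : ℕ} {τ : ℝ} (hτ : 0 < τ) (z : Spc m) :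
    G τ z ≤ 2 ^ (m + 1) * (G (2 * τ) z * Real.exp (-qd z / (8 * τ))) := by
  have hp := Real.pi_pos
  have hsa : 0 < √(4 * Real.pi * τ) := Real.sqrt_pos.2 (by positivity)
  have hsb : 0 < √(4 * Real.pi * (2 * τ)) := Real.sqrt_pos.2 (by positivity)
  have h : (√(4 * Real.pi * τ))⁻¹ ^ (m + 1) ≤ 2 ^ (m + 1) * (√(4 * Real.pi * (2 * τ)))⁻¹ ^ (m + 1) := by
    rw [← mul_pow]
    gcongr
    rw [inv_le_iff_one_le_mul₀ hsa, mul_comm, ← mul_assoc, ← div_eq_mul_inv, le_div_iff₀ hsb, one_mul]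
    rw [Real.sqrt_le_left (by positivity), mul_pow, Real.sq_sqrt (by positivity)]
    nlinarith [mul_pos hp hτ]
  have e : Real.exp (-qd z / (4 * τ)) = Real.exp (-qd z / (4 * (2 * τ))) * Real.exp (-qd z / (8 * τ)) := by
    rw [← Real.exp_add]; congr 1; field_simp; ring
  unfold G
  rw [e]
  calc _ ≤ (2 ^ (m + 1) * (√(4 * Real.pi * (2 * τ)))⁻¹ ^ (m + 1)) * (Real.exp (-qd z / (4 * (2 * τ))) * Real.exp (-qd z / (8 * τ))) := by gcongr
    _ = _ := by ring

lemma co_sq_le {m : ℕ} (o : Option (Fin m)) (z : Spc m) : co o z ^ 2 ≤ qd z := by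
  rw [qd_eq]; exact Finset.single_le_sum (f := fun o => co o z ^ 2) (fun _ _ => sq_nonneg _) (Finset.mem_univ o)

lemma exp_aux (x : ℝ) : x * Real.exp (-x) ≤ 1 := by
  rw [Real.exp_neg, ← div_eq_mul_inv, div_le_one (Real.exp_pos _)]
  linarith [Real.add_one_le_exp x]

lemma dG_le {m : ℕ} {τ : ℝ} (hτ : 0 < τ) (o) (z : Spc m) :
    |dG τ o z| ≤ (3 * 2 ^ (m + 1)) * (√τ)⁻¹ * G (2 * τ) z := by
  have hs : 0 < √τ := Real.sqrt_pos.2 hτ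
  have hss : √τ * √τ = τ := Real.mul_self_sqrt hτ.le
  have hq := qd_nonneg z
  have hG := G_nonneg (2 * τ) z
  have h1 : |co o z| / (2 * τ) * Real.exp (-qd z / (8 * τ)) ≤ 3 * (√τ)⁻¹ := by
    have e1 : -qd z / (8 * τ) = -(qd z / (8 * τ)) := by ring
    set X := qd z / (8 * τ) with hX
    have hX0 : 0 ≤ X := by positivity
    have h2 : |co o z| ≤ √τ * (2 + 2 * X) := by
      have h3 : |co o z| ^ 2 ≤ 8 * τ * X := by
        rw [sq_abs, hX]; field_simp; exact co_sq_le o z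
      refine abs_le_of_sq_le_sq' ?_ (by positivity) |>.2
      rw [mul_pow, Real.sq_sqrt hτ.le]; nlinarith [sq_nonneg (X - 1), mul_nonneg hτ.le (sq_nonneg (X - 1))]
    rw [e1]
    have h4 : Real.exp (-X) ≤ 1 := Real.exp_le_one_iff.2 (by linarith)
    calc |co o z| / (2 * τ) * Real.exp (-X) ≤ √τ * (2 + 2 * X) / (2 * τ) * Real.exp (-X) := by gcongr
      _ = (√τ)⁻¹ * (Real.exp (-X) + X * Real.exp (-X)) := by
        have : (2 * τ) = 2 * (√τ * √τ) := by rw [hss]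
        rw [this]; field_simp
      _ ≤ (√τ)⁻¹ * (1 + 1) := by gcongr; exact exp_aux X
      _ ≤ 3 * (√τ)⁻¹ := by nlinarith [inv_pos.2 hs]
  have h0 : |dG τ o z| = |co o z| / (2 * τ) * G τ z := by
    rw [dG, abs_mul, abs_neg, abs_div, abs_of_nonneg (G_nonneg τ z), abs_of_pos (by positivity : 0 < 2 * τ)]
  rw [h0]
  calc _ ≤ |co o z| / (2 * τ) * (2 ^ (m + 1) * (G (2 * τ) z * Real.exp (-qd z / (8 * τ)))) := by
        gcongr; exact G_double hτ z
    _ = 2 ^ (m + 1) * G (2 * τ) z * (|co o z| / (2 * τ) * Real.exp (-qd z / (8 * τ))) := by ring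
    _ ≤ 2 ^ (m + 1) * G (2 * τ) z * (3 * (√τ)⁻¹) := by gcongr
    _ = _ := by ring

lemma ddG_le {m : ℕ} {τ : ℝ} (hτ : 0 < τ) (o o') (z : Spc m) :
    |ddG τ o o' z| ≤ (3 * 2 ^ (m + 1)) * τ⁻¹ * G (2 * τ) z := by
  have hq := qd_nonneg z
  have hG := G_nonneg (2 * τ) z
  have h1 : |co o z * co o' z / (4 * τ ^ 2) - (if o = o' then 1 else 0) / (2 * τ)| *
      Real.exp (-qd z / (8 * τ)) ≤ 3 * τ⁻¹ := by
    have e1 : -qd z / (8 * τ) = -(qd z / (8 * τ)) := by ring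
    set X := qd z / (8 * τ) with hX
    have hX0 : 0 ≤ X := by positivity
    have h3 : |co o z * co o' z / (4 * τ ^ 2) - (if o = o' then 1 else 0) / (2 * τ)| ≤ τ⁻¹ * (2 * X + 1) := by
      refine (abs_sub _ _).trans ?_
      have ha : |co o z * co o' z / (4 * τ ^ 2)| ≤ τ⁻¹ * (2 * X) := by
        rw [abs_div, abs_of_pos (by positivity : 0 < 4 * τ ^ 2), div_le_iff₀ (by positivity), hX]
        have : τ⁻¹ * (2 * (qd z / (8 * τ))) * (4 * τ ^ 2) = qd z := by field_simp; ring
        rw [this, abs_le]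
        constructor <;> nlinarith [co_sq_le o z, co_sq_le o' z, sq_nonneg (co o z + co o' z), sq_nonneg (co o z - co o' z)]
      have hb : |(if o = o' then (1:ℝ) else 0) / (2 * τ)| ≤ τ⁻¹ * 1 := by
        rw [abs_div, abs_of_pos (by positivity : 0 < 2 * τ), div_le_iff₀ (by positivity)]
        have : τ⁻¹ * 1 * (2 * τ) = 2 := by field_simp
        rw [this]; split_ifs <;> norm_num
      linarith
    rw [e1]
    have h4 : Real.exp (-X) ≤ 1 := Real.exp_le_one_iff.2 (by linarith)
    calc _ ≤ τ⁻¹ * (2 * X + 1) * Real.exp (-X) := by gcongr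
      _ = τ⁻¹ * (2 * (X * Real.exp (-X)) + Real.exp (-X)) := by ring
      _ ≤ τ⁻¹ * (2 * 1 + 1) := by gcongr; exact exp_aux X
      _ = _ := by ring
  rw [ddG, abs_mul, abs_of_nonneg (G_nonneg τ z)]
  calc _ ≤ _ * (2 ^ (m + 1) * (G (2 * τ) z * Real.exp (-qd z / (8 * τ)))) := by
        gcongr; exact G_double hτ z
    _ = 2 ^ (m + 1) * G (2 * τ) z * (|co o z * co o' z / (4 * τ ^ 2) - (if o = o' then 1 else 0) / (2 * τ)| * Real.exp (-qd z / (8 * τ))) := by ring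
    _ ≤ 2 ^ (m + 1) * G (2 * τ) z * (3 * τ⁻¹) := by gcongr
    _ = _ := by ring

lemma int_G {m : ℕ} {τ : ℝ} (hτ : 0 < τ) : ∫ z : Spc m, G τ z = 1 := by
  have hp := Real.pi_pos
  set a := (√(4 * Real.pi * τ))⁻¹ with ha
  have h1 : ∫ x : ℝ, a * Real.exp (-(4 * τ)⁻¹ * x ^ 2) = 1 := by
    rw [integral_const_mul, integral_gaussian, ha]
    rw [show Real.pi / (4 * τ)⁻¹ = 4 * Real.pi * τ by field_simp]
    exact inv_mul_cancel₀ (Real.sqrt_pos.2 (by positivity)).ne'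
  have h2 : ∀ z : Spc m, G τ z = (a * Real.exp (-(4 * τ)⁻¹ * z.1 ^ 2)) *
      ∏ i, (a * Real.exp (-(4 * τ)⁻¹ * z.2 i ^ 2)) := fun z => by
    rw [Finset.prod_mul_distrib, ← Real.exp_sum, Finset.prod_const, Finset.card_univ, Fintype.card_fin,
      mul_mul_mul_comm, ← Real.exp_add, ← pow_succ', G, ← Finset.mul_sum, ← mul_add]
    congr 2; rw [qd]; ring
  simp_rw [h2]
  rw [Measure.volume_eq_prod,
    integral_prod_mul (f := fun x : ℝ => a * Real.exp (-(4 * τ)⁻¹ * x ^ 2))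
      (g := fun x : Fin m → ℝ => ∏ i, (a * Real.exp (-(4 * τ)⁻¹ * x i ^ 2))), h1,
    integral_fintype_prod_volume_eq_prod (fun _ : Fin m => fun x : ℝ => a * Real.exp (-(4 * τ)⁻¹ * x ^ 2))]
  simp only [h1]; simp

lemma integrable_G {m : ℕ} {τ : ℝ} (hτ : 0 < τ) : Integrable (G (m := m) τ) :=
  integrable_of_integral_eq_one (int_G hτ)

lemma lint_G {m : ℕ} {τ : ℝ} (hτ : 0 < τ) : ∫⁻ z : Spc m, ENNReal.ofReal (G τ z) = 1 := by
  rw [← ofReal_integral_eq_lintegral_ofReal (integrable_G hτ) (ae_of_all _ (G_nonneg τ)), int_G hτ]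
  simp

def Kc (m : ℕ) (τ : ℝ) : ℝ := 2 ^ (m + 1) * Real.exp ((m + 1) / (4 * τ))

lemma Kc_anti {m : ℕ} {a b : ℝ} (ha : 0 < a) (h : a ≤ b) : Kc m b ≤ Kc m a := by
  unfold Kc; gcongr

lemma Kc_pos (m : ℕ) (a : ℝ) : 0 < Kc m a := by unfold Kc; positivity

lemma qd_cube {m : ℕ} {z : Spc m} (hz : z ∈ cube m) : qd z ≤ m + 1 := by
  have h : ∀ o, co o z ^ 2 ≤ 1 := by
    rintro (_ | i)
    · have := hz.1; simp only [mem_Ico] at this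
      change z.1 ^ 2 ≤ 1; nlinarith
    · have := hz.2 i (mem_univ _); simp only [mem_Ico] at this
      change z.2 i ^ 2 ≤ 1; nlinarith
  rw [qd_eq]
  refine (Finset.sum_le_sum fun o _ => h o).trans ?_
  simp

lemma G_shift {m : ℕ} {τ : ℝ} (hτ : 0 < τ) (w : Spc m) {z : Spc m} (hz : z ∈ cube m) :
    G τ w ≤ Kc m τ * G (2 * τ) (w + z) := by
  have hp := Real.pi_pos
  have hq : qd (w + z) ≤ 2 * qd w + 2 * (m + 1) := by
    have := qd_cube hz
    have h2 : qd (w + z) ≤ 2 * qd w + 2 * qd z := by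
      rw [qd_eq, qd_eq w, qd_eq z, Finset.mul_sum, Finset.mul_sum, ← Finset.sum_add_distrib]
      refine Finset.sum_le_sum fun o _ => ?_
      rw [map_add]; nlinarith [sq_nonneg (co o w - co o z)]
    linarith
  have hsa : 0 < √(4 * Real.pi * τ) := Real.sqrt_pos.2 (by positivity)
  have hsb : 0 < √(4 * Real.pi * (2 * τ)) := Real.sqrt_pos.2 (by positivity)
  have h : (√(4 * Real.pi * τ))⁻¹ ^ (m + 1) ≤ 2 ^ (m + 1) * (√(4 * Real.pi * (2 * τ)))⁻¹ ^ (m + 1) := by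
    rw [← mul_pow]
    gcongr
    rw [inv_le_iff_one_le_mul₀ hsa, mul_comm, ← mul_assoc, ← div_eq_mul_inv, le_div_iff₀ hsb, one_mul]
    rw [Real.sqrt_le_left (by positivity), mul_pow, Real.sq_sqrt (by positivity)]
    nlinarith [mul_pos hp hτ]
  have e : Real.exp (-qd w / (4 * τ)) ≤ Real.exp ((m + 1) / (4 * τ)) * Real.exp (-qd (w + z) / (4 * (2 * τ))) := by
    rw [← Real.exp_add, Real.exp_le_exp, ← sub_nonneg]
    have : ((m:ℝ) + 1) / (4 * τ) + -qd (w + z) / (4 * (2 * τ)) - -qd w / (4 * τ) =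
      (2 * qd w + 2 * (m + 1) - qd (w + z)) / (8 * τ) := by field_simp; ring
    rw [this]; apply div_nonneg <;> linarith
  unfold G Kc
  calc _ ≤ (2 ^ (m + 1) * (√(4 * Real.pi * (2 * τ)))⁻¹ ^ (m + 1)) * (Real.exp ((m + 1) / (4 * τ)) * Real.exp (-qd (w + z) / (4 * (2 * τ)))) := by gcongr
    _ = _ := by ring

lemma lemL {m : ℕ} {f : Spc m → ℝ≥0∞} (hf : Per f) (hm : Measurable f) {τ : ℝ} (hτ : 0 < τ)
    (x : Spc m) : ∫⁻ y, ENNReal.ofReal (G τ (x - y)) * f y ≤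
      ENNReal.ofReal (Kc m τ) * ∫⁻ y in cube m, f y := by
  have hGm : Measurable fun z : Spc m => ENNReal.ofReal (G (2 * τ) z) :=
    (cont_G _).measurable.ennreal_ofReal
  have h0 : ∀ y, ∀ z ∈ cube m, ENNReal.ofReal (G τ (x - y)) * f y ≤
      ENNReal.ofReal (Kc m τ) * (ENNReal.ofReal (G (2 * τ) (x - y + z)) * f y) := fun y z hz => by
    rw [← mul_assoc, ← ENNReal.ofReal_mul (Kc_pos m τ).le]
    gcongr; exact G_shift hτ _ hz
  calc ∫⁻ y, ENNReal.ofReal (G τ (x - y)) * f y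
      = ∫⁻ y, ∫⁻ z in cube m, ENNReal.ofReal (G τ (x - y)) * f y := by simp
    _ ≤ ∫⁻ y, ∫⁻ z in cube m, ENNReal.ofReal (Kc m τ) * (ENNReal.ofReal (G (2 * τ) (x - y + z)) * f y) :=
        lintegral_mono fun y => setLIntegral_mono' (meas_cube m) (h0 y)
    _ = ∫⁻ z in cube m, ∫⁻ y, ENNReal.ofReal (Kc m τ) * (ENNReal.ofReal (G (2 * τ) (x - y + z)) * f y) := by
        refine lintegral_lintegral_swap (Measurable.aemeasurable ?_)
        refine measurable_const.mul ((hGm.comp ?_).mul (hm.comp measurable_fst))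
        fun_prop
    _ = ∫⁻ z in cube m, ∫⁻ w, ENNReal.ofReal (Kc m τ) * (ENNReal.ofReal (G (2 * τ) w) * f (x + z - w)) := by
        refine lintegral_congr fun z => ?_
        rw [← lintegral_sub_left_eq_self _ (x + z)]
        refine lintegral_congr fun w => ?_
        congr 4; abel
    _ = ∫⁻ w, ∫⁻ z in cube m, ENNReal.ofReal (Kc m τ) * (ENNReal.ofReal (G (2 * τ) w) * f (x + z - w)) := by
        refine lintegral_lintegral_swap (Measurable.aemeasurable ?_)
        refine measurable_const.mul ((hGm.comp measurable_snd).mul (hm.comp ?_))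
        fun_prop
    _ = ∫⁻ w, ENNReal.ofReal (Kc m τ) * (∫⁻ z in cube m, f z) * ENNReal.ofReal (G (2 * τ) w) := by
        refine lintegral_congr fun w => ?_
        rw [lintegral_const_mul, lintegral_const_mul, ← shift_lint hf (x - w)]
        · simp_rw [show ∀ z, x + z - w = x - w + z from fun z => by abel]; ring
        all_goals fun_prop
    _ = _ := by rw [lintegral_const_mul _ hGm, lint_G (by positivity), mul_one]

lemma aesm_sub {m : ℕ} {k : Spc m → ℝ} (hk : Continuous k) (x : Spc m) {f : Spc m → ℝ} (hm : Measurable f) :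
    AEStronglyMeasurable (fun y => k (x - y) * f y) :=
  ((hk.comp (continuous_const.sub continuous_id)).measurable.mul hm).aestronglyMeasurable

/-- integrability of kernels dominated by Gaussians -/
lemma int_ker {m : ℕ} {k : Spc m → ℝ} (hk : Continuous k) {C τ : ℝ} (hτ : 0 < τ)
    (hC : ∀ z, |k z| ≤ C * G τ z) {f : Spc m → ℝ} (hf : Per f) (hm : Measurable f)
    (hi : IntegrableOn f (cube m)) (x : Spc m) :
    Integrable (fun y => k (x - y) * f y) ∧
      ∫ y, |k (x - y) * f y| ≤ C * Kc m τ * ∫ y in cube m, |f y| := by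
  have hC0 : 0 ≤ C := by
    have h := (abs_nonneg _).trans (hC 0)
    have : 0 < G (m := m) τ 0 := by
      unfold G
      have : 0 < √(4 * Real.pi * τ) := Real.sqrt_pos.2 (by positivity)
      positivity
    exact nonneg_of_mul_nonneg_left h this
  have hL := lemL (f := fun y => ‖f y‖ₑ) (fun y k => by simp only [hf y k]) hm.enorm hτ x
  have hb : ∫⁻ y, ‖k (x - y) * f y‖ₑ ≤ ENNReal.ofReal C * (ENNReal.ofReal (Kc m τ) * ∫⁻ y in cube m, ‖f y‖ₑ) := by
    refine le_trans ?_ (mul_le_mul_right hL _)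
    rw [← lintegral_const_mul']
    · refine lintegral_mono fun y => ?_
      rw [enorm_mul, ← mul_assoc, ← ENNReal.ofReal_mul hC0]
      gcongr
      rw [Real.enorm_eq_ofReal_abs]
      exact ENNReal.ofReal_le_ofReal (hC _)
    · simp
  have hfin : ENNReal.ofReal C * (ENNReal.ofReal (Kc m τ) * ∫⁻ y in cube m, ‖f y‖ₑ) < ⊤ :=
    ENNReal.mul_lt_top (by simp) (ENNReal.mul_lt_top (by simp) hi.2)
  have hint : Integrable (fun y => k (x - y) * f y) := ⟨aesm_sub hk x hm, hb.trans_lt hfin⟩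
  refine ⟨hint, ?_⟩
  simp only [← Real.norm_eq_abs]
  rw [integral_norm_eq_lintegral_enorm hint.1, integral_norm_eq_lintegral_enorm hi.1]
  refine (ENNReal.toReal_mono hfin.ne hb).trans ?_
  rw [ENNReal.toReal_mul, ENNReal.toReal_mul, ENNReal.toReal_ofReal hC0, ENNReal.toReal_ofReal (Kc_pos _ _).le, mul_assoc]

/-- pairing of a kernel with a function -/
def cv {m : ℕ} (k f : Spc m → ℝ) (x : Spc m) : ℝ := ∫ y, k (x - y) * f y

lemma cv_comm {m : ℕ} (k f : Spc m → ℝ) (x : Spc m) : cv k f x = ∫ z, k z * f (x - z) := by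
  rw [cv, ← integral_sub_left_eq_self _ volume x]; simp

lemma cv_shift {m : ℕ} (k f : Spc m → ℝ) (x h : Spc m) :
    cv k f (x + h) = cv k (fun y => f (y + h)) x := by
  rw [cv_comm, cv_comm]; congr 1; ext z; congr 2; abel

lemma cv_shift' {m : ℕ} (k f : Spc m → ℝ) (x h : Spc m) :
    cv k f (x + h) = cv (fun z => k (z + h)) f x := by
  rw [cv, cv]; congr 1; ext z; congr 2; abel

/-- sup bound -/
lemma cv_sup {m : ℕ} {k : Spc m → ℝ} (hk : Integrable k) {f : Spc m → ℝ} {A M : ℝ}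
    (hA : ∫ z, |k z| ≤ A) (hM0 : 0 ≤ M) (hM : ∀ y, |f y| ≤ M) (x : Spc m) : |cv k f x| ≤ A * M := by
  rw [cv_comm, ← Real.norm_eq_abs]
  refine (norm_integral_le_integral_norm _).trans ?_
  refine (integral_mono_of_nonneg (ae_of_all _ fun _ => norm_nonneg _) (hk.abs.mul_const M)
    (ae_of_all _ fun z => ?_)).trans ?_
  · simp only [norm_mul, Real.norm_eq_abs]; gcongr; exact hM _
  · rw [integral_mul_const]; gcongr

lemma cv_L1 {m : ℕ} {k : Spc m → ℝ} (hk : Continuous k) {C τ : ℝ} (hτ : 0 < τ)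
    (hC : ∀ z, |k z| ≤ C * G τ z) {f : Spc m → ℝ} (hf : Per f) (hm : Measurable f)
    (hi : IntegrableOn f (cube m)) (x : Spc m) : |cv k f x| ≤ C * Kc m τ * ∫ y in cube m, |f y| := by
  rw [cv, ← Real.norm_eq_abs]
  exact (norm_integral_le_integral_norm _).trans (int_ker hk hτ hC hf hm hi x).2

lemma ker_dom {m : ℕ} {k : Spc m → ℝ} (hk : Continuous k) {C τ : ℝ} (hτ : 0 < τ)
    (hC : ∀ z, |k z| ≤ C * G τ z) : Integrable k ∧ ∫ z, |k z| ≤ C := by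
  have hi : Integrable k := Integrable.mono' ((integrable_G hτ).const_mul C) hk.aestronglyMeasurable
    (ae_of_all _ hC)
  refine ⟨hi, (integral_mono hi.abs ((integrable_G hτ).const_mul C) hC).trans ?_⟩
  rw [integral_const_mul, int_G hτ, mul_one]

structure PI {m : ℕ} (f : Spc m → ℝ) : Prop where
  per : Per f
  meas : Measurable f
  int : IntegrableOn f (cube m)

structure Dom {m : ℕ} (k : Spc m → ℝ) (C τ : ℝ) : Prop where
  pos : 0 < τ
  cont : Continuous k
  le : ∀ z, |k z| ≤ C * G τ z

def cG (m : ℕ) : ℝ := 3 * 2 ^ (m + 1)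
lemma cG_pos (m : ℕ) : 0 < cG m := by unfold cG; positivity

lemma dom_G {m : ℕ} {τ : ℝ} (h : 0 < τ) : Dom (G (m := m) τ) 1 τ :=
  ⟨h, cont_G τ, fun z => by rw [one_mul, abs_of_nonneg (G_nonneg τ z)]⟩
lemma dom_dG {m : ℕ} {τ : ℝ} (h : 0 < τ) (o) : Dom (dG (m := m) τ o) (cG m * (√τ)⁻¹) (2 * τ) :=
  ⟨by positivity, cont_dG τ o, fun z => dG_le h o z⟩
lemma dom_ddG {m : ℕ} {τ : ℝ} (h : 0 < τ) (o o') : Dom (ddG (m := m) τ o o') (cG m * τ⁻¹) (2 * τ) :=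
  ⟨by positivity, cont_ddG τ o o', fun z => ddG_le h o o' z⟩

lemma Dom.int {m : ℕ} {k f : Spc m → ℝ} {C τ : ℝ} (hk : Dom k C τ) (hf : PI f) (x : Spc m) :
    Integrable (fun y => k (x - y) * f y) := (int_ker hk.cont hk.pos hk.le hf.per hf.meas hf.int x).1

lemma Dom.L1 {m : ℕ} {k f : Spc m → ℝ} {C τ : ℝ} (hk : Dom k C τ) (hf : PI f) (x : Spc m) :
    |cv k f x| ≤ C * Kc m τ * ∫ y in cube m, |f y| := cv_L1 hk.cont hk.pos hk.le hf.per hf.meas hf.int x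

lemma Dom.ker {m : ℕ} {k : Spc m → ℝ} {C τ : ℝ} (hk : Dom k C τ) :
    Integrable k ∧ ∫ z, |k z| ≤ C := ker_dom hk.cont hk.pos hk.le

lemma PI.add {m : ℕ} {f g : Spc m → ℝ} (hf : PI f) (hg : PI g) : PI (fun x => f x + g x) :=
  ⟨fun x k => by simp only [hf.per x k, hg.per x k], hf.meas.add hg.meas, hf.int.add hg.int⟩
lemma PI.sub {m : ℕ} {f g : Spc m → ℝ} (hf : PI f) (hg : PI g) : PI (fun x => f x - g x) :=
  ⟨fun x k => by simp only [hf.per x k, hg.per x k], hf.meas.sub hg.meas, hf.int.sub hg.int⟩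
lemma PI.smul {m : ℕ} {f : Spc m → ℝ} (hf : PI f) (c : ℝ) : PI (fun x => c * f x) :=
  ⟨fun x k => by simp only [hf.per x k], hf.meas.const_mul c, hf.int.const_mul c⟩
lemma PI.sum {m : ℕ} {ι : Type*} [Fintype ι] {f : ι → Spc m → ℝ} (hf : ∀ i, PI (f i)) : PI (fun x => ∑ i, f i x) :=
  ⟨fun x k => by simp only [(hf _).per x k], Finset.measurable_sum _ fun i _ => (hf i).meas,
    integrable_finsetSum _ fun i _ => (hf i).int⟩
lemma PI.of_cont {m : ℕ} {f : Spc m → ℝ} (hf : Per f) (hc : Continuous f) : PI f :=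
  ⟨hf, hc.measurable, int_cube hc⟩

lemma cv_add {m : ℕ} {k f g : Spc m → ℝ} {C τ : ℝ} (hk : Dom k C τ) (hf : PI f) (hg : PI g) (x : Spc m) :
    cv k (fun y => f y + g y) x = cv k f x + cv k g x := by
  simp only [cv, mul_add]; exact integral_add (hk.int hf x) (hk.int hg x)
lemma cv_sub {m : ℕ} {k f g : Spc m → ℝ} {C τ : ℝ} (hk : Dom k C τ) (hf : PI f) (hg : PI g) (x : Spc m) :
    cv k (fun y => f y - g y) x = cv k f x - cv k g x := by
  simp only [cv, mul_sub]; exact integral_sub (hk.int hf x) (hk.int hg x)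
lemma cv_smul {m : ℕ} (k f : Spc m → ℝ) (c : ℝ) (x : Spc m) :
    cv k (fun y => c * f y) x = c * cv k f x := by
  simp only [cv, ← integral_const_mul]; congr 1; ext; ring
lemma cv_sum {m : ℕ} {ι : Type*} [Fintype ι] {k : Spc m → ℝ} {f : ι → Spc m → ℝ} {C τ : ℝ}
    (hk : Dom k C τ) (hf : ∀ i, PI (f i)) (x : Spc m) :
    cv k (fun y => ∑ i, f i y) x = ∑ i, cv k (f i) x := by
  simp only [cv, Finset.mul_sum]; exact integral_finsetSum _ fun i _ => hk.int (hf i) x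

/-- integration by parts against a kernel -/
lemma cv_ibp {m : ℕ} {k : Spc m → ℝ} {k' : Option (Fin m) → Spc m → ℝ} {C τ C' τ' : ℝ}
    (hk : Dom k C τ) (hk' : ∀ o, Dom (k' o) C' τ') (hd : ∀ z, HasFDerivAt k (∑ o, k' o z • co o) z)
    {w : Spc m → ℝ} (hw : Per w) (hwd : Differentiable ℝ w) (o : Option (Fin m))
    (hi : IntegrableOn (pd (dir o) w) (cube m)) (x : Spc m) :
    cv k (pd (dir o) w) x = cv (k' o) w x := by
  have hd' : ∀ y, HasFDerivAt (fun y => k (x - y)) (-(∑ o, k' o (x - y) • co o)) y := fun y => by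
    have := (hd (x - y)).comp y ((hasFDerivAt_id y).const_sub x)
    refine this.congr_fderiv ?_
    refine ContinuousLinearMap.ext fun v => ?_
    simp
  have he : ∀ y, fderiv ℝ (fun y => k (x - y)) y (dir o) = - k' o (x - y) := fun y => by
    rw [(hd' y).fderiv]; simp only [neg_apply, FunLike.coe_sum, Finset.sum_apply, smul_apply, co_dir, smul_eq_mul, mul_ite, mul_one, mul_zero, Finset.sum_ite_eq', Finset.mem_univ, if_true]
  have hPI := PI.of_cont hw hwd.continuous
  have := integral_mul_fderiv_eq_neg_fderiv_mul_of_integrable (μ := (volume : Measure (Spc m)))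
    (f := fun y => k (x - y)) (g := w) (v := dir o) ?_ ?_ (hk.int hPI x)
    (fun y _ => (hd' y).differentiableAt) (fun y _ => hwd y)
  · simp only [he, neg_mul, integral_neg, neg_neg] at this
    exact this
  · simp only [he, neg_mul]; exact ((hk' o).int hPI x).neg
  · exact hk.int ⟨hw.pd _, meas_pd w _, hi⟩ x

lemma cv_G_ibp {m : ℕ} {τ : ℝ} (hτ : 0 < τ) {w : Spc m → ℝ} (hw : Per w) (hwd : Differentiable ℝ w)
    (o : Option (Fin m)) (hi : IntegrableOn (pd (dir o) w) (cube m)) (x : Spc m) :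
    cv (G τ) (pd (dir o) w) x = cv (dG τ o) w x :=
  cv_ibp (dom_G hτ) (dom_dG hτ) (hasF_G τ) hw hwd o hi x

lemma cv_dG_ibp {m : ℕ} {τ : ℝ} (hτ : 0 < τ) {w : Spc m → ℝ} (hw : Per w) (hwd : Differentiable ℝ w)
    (o o' : Option (Fin m)) (hi : IntegrableOn (pd (dir o') w) (cube m)) (x : Spc m) :
    cv (dG τ o) (pd (dir o') w) x = cv (ddG τ o o') w x :=
  cv_ibp (dom_dG hτ o) (dom_ddG hτ o) (hasF_dG τ o) hw hwd o' hi x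

/-- derivative in the time parameter of the kernel -/
lemma cv_time {m : ℕ} {τ : ℝ} (hτ : 0 < τ) {f : Spc m → ℝ} (hf : PI f) (x : Spc m) :
    HasDerivAt (fun τ => cv (G τ) f x) (∑ o, cv (ddG τ o o) f x) τ := by
  have hpos : ∀ τ' ∈ Metric.ball τ (τ / 2), τ / 2 < τ' ∧ τ' < 2 * τ := fun τ' h => by
    rw [Metric.mem_ball, Real.dist_eq, abs_lt] at h; constructor <;> linarith
  have hb : ∀ τ' ∈ Metric.ball τ (τ / 2), ∀ o, ∀ z : Spc m, |ddG τ' o o z| ≤ cG m * (τ / 2)⁻¹ * (4 ^ (m + 1) * G (4 * τ) z) := by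
    intro τ' h o z
    obtain ⟨h1, h2⟩ := hpos τ' h
    have := cG_pos m
    have hg := G_nonneg (4 * τ) z
    refine (ddG_le (by linarith) o o z).trans ?_
    refine mul_le_mul ?_ (G_mono (by linarith) (by linarith) (by linarith) z) (G_nonneg _ _) (by positivity)
    unfold cG; gcongr
  have key := hasDerivAt_integral_of_dominated_loc_of_deriv_le (μ := (volume : Measure (Spc m)))
    (F := fun τ y => G τ (x - y) * f y) (F' := fun τ y => (∑ o, ddG τ o o (x - y)) * f y)
    (bound := fun y => (m + 1) * (cG m * (τ / 2)⁻¹ * (4 ^ (m + 1) * |G (4 * τ) (x - y) * f y|)))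
    (s := Metric.ball τ (τ / 2)) (x₀ := τ) (Metric.ball_mem_nhds _ (by positivity)) ?_ ?_ ?_ ?_ ?_ ?_
  · refine key.2.congr_deriv ?_
    simp only [Finset.sum_mul, cv]
    exact integral_finsetSum _ fun o _ => (dom_ddG hτ o o).int hf x
  · exact Eventually.of_forall fun τ => aesm_sub (cont_G τ) x hf.meas
  · exact (dom_G hτ).int hf x
  · exact aesm_sub (continuous_finsetSum _ fun o _ => cont_ddG τ o o) x hf.meas
  · refine ae_of_all _ fun y τ' h => ?_
    rw [norm_mul, Real.norm_eq_abs, Real.norm_eq_abs, abs_mul, abs_of_nonneg (G_nonneg (4 * τ) _)]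
    have : |∑ o, ddG τ' o o (x - y)| ≤ (m + 1) * (cG m * (τ / 2)⁻¹ * (4 ^ (m + 1) * G (4 * τ) (x - y))) := by
      refine (Finset.abs_sum_le_sum_abs _ _).trans ?_
      refine (Finset.sum_le_sum fun o _ => hb τ' h o (x - y)).trans ?_
      simp
    calc _ ≤ (m + 1) * (cG m * (τ / 2)⁻¹ * (4 ^ (m + 1) * G (4 * τ) (x - y))) * |f y| := by gcongr
      _ = _ := by ring
  · exact ((((dom_G (by positivity : 0 < 4 * τ)).int hf x).abs.const_mul _).const_mul _).const_mul _
  · refine ae_of_all _ fun y τ' h => ?_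
    exact (hasD_G (by linarith [hpos τ' h]) (x - y)).mul_const (f y)

/-- L1 norm of differences of kernels -/
lemma ker_diff {m : ℕ} {k : Spc m → ℝ} {k' : Option (Fin m) → Spc m → ℝ} {C τ : ℝ}
    (hki : Integrable k) (hk' : ∀ o, Dom (k' o) C τ)
    (hd : ∀ z, HasFDerivAt k (∑ o, k' o z • co o) z) (h : Spc m) :
    Integrable (fun z => k (z + h) - k z) ∧ ∫ z, |k (z + h) - k z| ≤ (m + 1) * C * ‖h‖ := by
  have hτ := (hk' none).pos
  have hC0 : 0 ≤ C := (integral_nonneg fun _ => abs_nonneg _).trans (hk' none).ker.2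
  have hint : Integrable (fun z => k (z + h) - k z) := (hki.comp_add_right h).sub hki
  refine ⟨hint, ?_⟩
  set g : ℝ → Spc m → ℝ := fun t z => (m + 1) * C * ‖h‖ * G τ (z + t • h) with hg
  have hg0 : ∀ t z, 0 ≤ g t z := fun t z => by have := G_nonneg τ (z + t • h); positivity
  have hgc : Continuous (fun q : Spc m × ℝ => g q.2 q.1) := by
    have := cont_G (m := m) τ
    simp only [hg]; fun_prop
  have hpt : ∀ z, ‖k (z + h) - k z‖ₑ ≤ ∫⁻ t in Ioc (0:ℝ) 1, ENNReal.ofReal (g t z) := fun z => by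
    have hD : ∀ t ∈ uIcc (0:ℝ) 1, HasDerivAt (fun t : ℝ => k (z + t • h)) (∑ o, k' o (z + t • h) * co o h) t := fun t _ => by
      have h1 : HasDerivAt (fun t : ℝ => z + t • h) h t := by
        simpa using ((hasDerivAt_id t).smul_const h).const_add z
      simpa using! (hd (z + t • h)).comp_hasDerivAt t h1
    have hcd : Continuous (fun t : ℝ => ∑ o, k' o (z + t • h) * co o h) := by
      have := fun o => (hk' o).cont
      fun_prop
    have hF := intervalIntegral.integral_eq_sub_of_hasDerivAt hD (hcd.intervalIntegrable 0 1)
    simp only [one_smul, zero_smul, add_zero] at hF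
    rw [← hF, intervalIntegral.integral_of_le zero_le_one]
    refine (enorm_integral_le_lintegral_enorm _).trans (lintegral_mono fun t => ?_)
    rw [Real.enorm_eq_ofReal_abs]
    refine ENNReal.ofReal_le_ofReal ((Finset.abs_sum_le_sum_abs _ _).trans ?_)
    refine (Finset.sum_le_sum (g := fun _ => C * G τ (z + t • h) * ‖h‖) fun o _ => ?_).trans ?_
    · rw [abs_mul]; exact mul_le_mul ((hk' o).le _) (co_le o h) (abs_nonneg _)
        ((abs_nonneg _).trans ((hk' o).le _))
    · simp [hg]; apply le_of_eq; ring
  have hL : ∫⁻ z, ‖k (z + h) - k z‖ₑ ≤ ENNReal.ofReal ((m + 1) * C * ‖h‖) := by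
    calc _ ≤ ∫⁻ z, ∫⁻ t in Ioc (0:ℝ) 1, ENNReal.ofReal (g t z) := lintegral_mono hpt
      _ = ∫⁻ t in Ioc (0:ℝ) 1, ∫⁻ z, ENNReal.ofReal (g t z) :=
        lintegral_lintegral_swap hgc.measurable.ennreal_ofReal.aemeasurable
      _ = ∫⁻ t in Ioc (0:ℝ) 1, ENNReal.ofReal ((m + 1) * C * ‖h‖) := by
        refine lintegral_congr fun t => ?_
        simp only [hg]
        simp_rw [ENNReal.ofReal_mul (show 0 ≤ ((m:ℝ) + 1) * C * ‖h‖ by positivity)]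
        rw [lintegral_const_mul' _ _ (by simp), lintegral_add_right_eq_self (fun z => ENNReal.ofReal (G τ z)), lint_G hτ, mul_one]
      _ = _ := by simp
  simp only [← Real.norm_eq_abs]
  rw [integral_norm_eq_lintegral_enorm hint.1]
  exact ENNReal.toReal_le_of_le_ofReal (by positivity) hL

/-- approximate identity -/
lemma cv_approx {m : ℕ} {f : Spc m → ℝ} (hf : Per f) (hc : Continuous f) (x : Spc m) :
    Tendsto (fun ε => cv (G ε) f x) (nhdsWithin 0 (Ioi 0)) (nhds (f x)) := by
  obtain ⟨M, hM0, hM⟩ := hf.bdd hc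
  rw [Metric.tendsto_nhdsWithin_nhds]
  intro η hη
  obtain ⟨r, hr, hrb⟩ := Metric.continuous_iff.1 hc x (η / 2) (by positivity)
  set A := (2 * M / r ^ 2) * (2 ^ (m + 1) * 8) * (m + 1) with hA
  refine ⟨η / (2 * (A + 1)), by positivity, fun ε hε hd => ?_⟩
  have hε : 0 < ε := hε
  rw [dist_zero_right, Real.norm_eq_abs, abs_of_pos hε] at hd
  have hpt : ∀ z, |f (x - z) - f x| ≤ η / 2 + 2 * M / r ^ 2 * ((m + 1) * qd z) := fun z => by
    have hq := qd_nonneg z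
    by_cases hz : ‖z‖ < r
    · have h1 := hrb (x - z) (by simpa [dist_eq_norm] using hz)
      rw [Real.dist_eq] at h1
      have : 0 ≤ 2 * M / r ^ 2 * ((m + 1) * qd z) := by positivity
      linarith
    · have h2 : r ^ 2 ≤ (m + 1) * qd z := by
        have h3 : ‖z‖ ^ 2 ≤ qd z := by
          have : ‖z‖ ≤ √(qd z) := by
            rw [norm_prod_le_iff, pi_norm_le_iff_of_nonneg (Real.sqrt_nonneg _)]
            exact ⟨Real.abs_le_sqrt (co_sq_le none z), fun i => Real.abs_le_sqrt (co_sq_le (some i) z)⟩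
          calc _ ≤ √(qd z) ^ 2 := by gcongr
            _ = _ := Real.sq_sqrt hq
        have h4 : r ^ 2 ≤ ‖z‖ ^ 2 := by rw [not_lt] at hz; gcongr
        nlinarith [mul_nonneg (Nat.cast_nonneg (α := ℝ) m) hq]
      have h5 : 2 * M ≤ 2 * M / r ^ 2 * ((m + 1) * qd z) := by
        rw [div_mul_eq_mul_div, le_div_iff₀ (by positivity)]; gcongr
      have h6 := abs_sub (f (x - z)) (f x)
      have h7 := hM (x - z)
      have h8 := hM x
      rw [Real.norm_eq_abs] at h7 h8
      linarith
  have hq2 : ∀ z : Spc m, G ε z * qd z ≤ (2 ^ (m + 1) * 8) * ε * G (2 * ε) z := fun z => by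
    have hq := qd_nonneg z
    have hg := G_nonneg (2 * ε) z
    have h1 := exp_aux (qd z / (8 * ε))
    have e : qd z * Real.exp (-qd z / (8 * ε)) ≤ 8 * ε := by
      rw [neg_div]
      calc _ = 8 * ε * (qd z / (8 * ε) * Real.exp (-(qd z / (8 * ε)))) := by field_simp
        _ ≤ 8 * ε * 1 := by gcongr
        _ = _ := by ring
    calc _ ≤ 2 ^ (m + 1) * (G (2 * ε) z * Real.exp (-qd z / (8 * ε))) * qd z := by
          gcongr; exact G_double hε z
      _ = 2 ^ (m + 1) * G (2 * ε) z * (qd z * Real.exp (-qd z / (8 * ε))) := by ring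
      _ ≤ 2 ^ (m + 1) * G (2 * ε) z * (8 * ε) := by gcongr
      _ = _ := by ring
  have hi1 : Integrable (fun z => G ε z * f (x - z)) :=
    Integrable.mono' ((integrable_G hε).mul_const M)
      ((cont_G ε).mul (hc.comp (continuous_const.sub continuous_id))).aestronglyMeasurable
      (ae_of_all _ fun z => by
        rw [norm_mul, Real.norm_eq_abs, abs_of_nonneg (G_nonneg ε z)]
        exact mul_le_mul_of_nonneg_left (hM _) (G_nonneg _ _))
  have e1 : cv (G ε) f x - f x = ∫ z, G ε z * (f (x - z) - f x) := by
    simp only [mul_sub]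
    rw [integral_sub hi1 ((integrable_G hε).mul_const _), integral_mul_const, int_G hε, one_mul, cv_comm]
  rw [Real.dist_eq, e1, ← Real.norm_eq_abs]
  have hbd : Integrable (fun z : Spc m => η / 2 * G ε z + A * ε * G (2 * ε) z) :=
    ((integrable_G hε).const_mul _).add ((integrable_G (by positivity)).const_mul _)
  refine (norm_integral_le_of_norm_le hbd (ae_of_all _ fun z => ?_)).trans_lt ?_
  · have hg := G_nonneg ε z
    rw [norm_mul, Real.norm_eq_abs, abs_of_nonneg hg, Real.norm_eq_abs]
    calc _ ≤ G ε z * (η / 2 + 2 * M / r ^ 2 * ((m + 1) * qd z)) := by gcongr; exact hpt z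
      _ = η / 2 * G ε z + 2 * M / r ^ 2 * (m + 1) * (G ε z * qd z) := by ring
      _ ≤ η / 2 * G ε z + 2 * M / r ^ 2 * (m + 1) * ((2 ^ (m + 1) * 8) * ε * G (2 * ε) z) := by
        have := mul_le_mul_of_nonneg_left (hq2 z) (by positivity : 0 ≤ 2 * M / r ^ 2 * (m + 1))
        linarith
      _ = _ := by rw [hA]; ring
  · rw [integral_add ((integrable_G hε).const_mul _) ((integrable_G (by positivity)).const_mul _),
      integral_const_mul, integral_const_mul, int_G hε, int_G (by positivity)]
    have hA0 : 0 ≤ A := by positivity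
    rw [lt_div_iff₀ (by positivity)] at hd
    nlinarith

lemma marg_cont {m : ℕ} {g : Spc m → ℝ} (hp : Per g) (hc : Continuous g) : Continuous (marg g) := by
  obtain ⟨C, _, hC⟩ := hp.bdd hc
  refine continuous_of_dominated (bound := fun _ => C)
    (fun x => (hc.comp (by fun_prop : Continuous fun y => (x, y))).aestronglyMeasurable)
    (fun x => ae_of_all _ fun y => hC _) (integrable_const C) (ae_of_all _ fun y => by fun_prop)

lemma marg_deriv {m : ℕ} {g : Spc m → ℝ} (hp : Per g) (hc : ContDiff ℝ 1 g) (x : ℝ) :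
    HasDerivAt (marg g) (marg (pd (e1 m) g) x) x := by
  have hd : Continuous (pd (e1 m) g) := (hc.continuous_fderiv (by norm_num)).clm_apply continuous_const
  obtain ⟨C, _, hC⟩ := (hp.pd (e1 m)).bdd hd
  obtain ⟨C', _, hC'⟩ := hp.bdd hc.continuous
  refine (hasDerivAt_integral_of_dominated_loc_of_deriv_le (μ := volume.restrict (cube1 m)) (s := univ)
    (F := fun x y => g (x, y)) (F' := fun x y => pd (e1 m) g (x, y)) (bound := fun _ => C) (x₀ := x)
    univ_mem ?_ ?_ ?_ ?_ (integrable_const C) ?_).2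
  · exact Eventually.of_forall fun x => (hc.continuous.comp (by fun_prop : Continuous fun y => (x, y))).aestronglyMeasurable
  · exact Integrable.mono' (integrable_const C') (hc.continuous.comp (by fun_prop : Continuous fun y => (x, y))).aestronglyMeasurable
      (ae_of_all _ fun y => hC' _)
  · exact (hd.comp (by fun_prop : Continuous fun y => (x, y))).aestronglyMeasurable
  · exact ae_of_all _ fun y x _ => hC _
  · refine ae_of_all _ fun y x _ => ?_
    have h1 : HasDerivAt (fun t : ℝ => ((t, y) : Spc m)) (e1 m) x := (hasDerivAt_id x).prodMk (hasDerivAt_const x y)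
    exact ((hc.differentiable (by norm_num)).differentiableAt.hasFDerivAt (x := (x, y))).comp_hasDerivAt x h1

lemma marg_C1 {m : ℕ} {g : Spc m → ℝ} (hp : Per g) (hc : ContDiff ℝ 1 g) : ContDiff ℝ 1 (marg g) := by
  have hd : Continuous (pd (e1 m) g) := (hc.continuous_fderiv (by norm_num)).clm_apply continuous_const
  rw [contDiff_one_iff_deriv]
  refine ⟨fun x => (marg_deriv hp hc x).differentiableAt, ?_⟩
  rw [show deriv (marg g) = marg (pd (e1 m) g) from funext fun x => (marg_deriv hp hc x).deriv]
  exact marg_cont (hp.pd _) hd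

lemma marg_per {m : ℕ} {g : Spc m → ℝ} (hp : Per g) (x : ℝ) (k : ℤ) : marg g (x + k) = marg g x := by
  unfold marg; congr 1; ext y
  have := hp (x, y) (k, 0)
  rw [← this]; congr 1; ext <;> simp [lat]

lemma Per.mul {m : ℕ} {f g : Spc m → ℝ} (hf : Per f) (hg : Per g) : Per (fun x => f x * g x) :=
  fun x k => by simp only [hf x k, hg x k]

lemma pd_C1 {m : ℕ} {V : Spc m → ℝ} (hV : ContDiff ℝ 2 V) (v : Spc m) : ContDiff ℝ 1 (pd v V) :=
  (hV.fderiv_right (m := 1) (by norm_num)).clm_apply contDiff_const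

structure Reg {m : ℕ} (f : Spc m → ℝ) : Prop where
  per : Per f
  c1 : ContDiff ℝ 1 f
  d2 : Differentiable ℝ (grd f)
  i2 : ∀ v w, IntegrableOn (pd v (pd w f)) (cube m)
  pos : ∀ x1, 0 < marg f x1

lemma reg_of {m : ℕ} {σ p : ℝ} (hp : 1 ≤ p) {f : Spc m → ℝ} (h2 : MemW 2 p f) (hD : MemD σ p f) : Reg f := by
  obtain ⟨h1, _, h3, h4, h5⟩ := h2
  have hper := isPeriodic_iff.1 h1
  have hdf := h3 (by norm_num)
  have hdd := h4 (by norm_num)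
  refine ⟨hper, contDiff_one_iff_fderiv.2 ⟨hdf, hdd.continuous⟩, hdd, fun v w => ?_, hD.2⟩
  have e : ∀ x, pd v (pd w f) x = (fderiv ℝ (grd f) x v) w := fun x => by
    have : HasFDerivAt (pd w f) ((ContinuousLinearMap.apply ℝ ℝ w).comp (fderiv ℝ (grd f) x)) x :=
      (ContinuousLinearMap.apply ℝ ℝ w).hasFDerivAt.comp x (hdd x).hasFDerivAt
    rw [pd, this.fderiv]; simp
  have hn : ∀ x, ‖iteratedFDeriv ℝ 2 f x‖ = ‖fderiv ℝ (grd f) x‖ := fun x => by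
    rw [← norm_iteratedFDeriv_fderiv, norm_iteratedFDeriv_one]; rfl
  have hfin : eLpNorm (fun x => ‖iteratedFDeriv ℝ 2 f x‖) (ENNReal.ofReal p) (μT m) < ⊤ := by
    rw [WNorm] at h5
    norm_num at h5
    simpa using h5.2
  have hm : MemLp (fun x => ‖fderiv ℝ (grd f) x‖) (ENNReal.ofReal p) (μT m) := by
    simp only [hn] at hfin
    exact ⟨(measurable_fderiv ℝ (grd f)).norm.aestronglyMeasurable, hfin⟩
  have hm1 : Integrable (fun x => ‖fderiv ℝ (grd f) x‖) (μT m) := by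
    have : IsProbabilityMeasure (μT m) := inferInstanceAs (IsProbabilityMeasure (volume.restrict (cube m)))
    exact hm.integrable (by simpa using hp)
  refine Integrable.mono' (hm1.mul_const (‖v‖ * ‖w‖)) (meas_pd _ _).aestronglyMeasurable (ae_of_all _ fun x => ?_)
  rw [e x, ← mul_assoc]
  exact (ContinuousLinearMap.le_opNorm _ _).trans (mul_le_mul_of_nonneg_right (ContinuousLinearMap.le_opNorm _ _) (norm_nonneg _))

lemma phi_C1 {m : ℕ} {V f : Spc m → ℝ} (hV : ContDiff ℝ 2 V) (hVp : Per V) (hf : Reg f) :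
    ContDiff ℝ 1 (phiF V f) := by
  have h := marg_C1 ((hVp.pd (e1 m)).mul hf.per) ((pd_C1 hV (e1 m)).mul hf.c1)
  exact h.div (marg_C1 hf.per hf.c1) fun x => (hf.pos x).ne'

def bo {m : ℕ} (V f : Spc m → ℝ) (o : Option (Fin m)) (z : Spc m) : ℝ :=
  pd (dir o) V z - if o = none then phiF V f z.1 else 0

lemma bo_C1 {m : ℕ} {V f : Spc m → ℝ} (hV : ContDiff ℝ 2 V) (hVp : Per V) (hf : Reg f) (o) :
    ContDiff ℝ 1 (bo V f o) := by
  unfold bo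
  have h1 := pd_C1 hV (dir o)
  have h2 : ContDiff ℝ 1 fun z : Spc m => phiF V f z.1 := (phi_C1 hV hVp hf).comp contDiff_fst
  split_ifs
  · exact h1.sub h2
  · simpa using h1

lemma bo_per {m : ℕ} {V f : Spc m → ℝ} (hVp : Per V) (hf : Per f) (o) : Per (bo V f o) := fun x k => by
  have h1 : phiF V f (x + lat k).1 = phiF V f x.1 := by
    have := marg_per ((hVp.pd (e1 m)).mul hf) x.1 k.1
    have h2 := marg_per hf x.1 k.1
    simp only [marg] at this h2
    simp only [phiF, marg, lat, Prod.fst_add, this, h2]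
  simp only [bo, hVp.pd _ x k, h1]

/-- the flux -/
def fl {m : ℕ} (κ : ℝ) (V f : Spc m → ℝ) (o : Option (Fin m)) (z : Spc m) : ℝ :=
  κ * pd (dir o) f z + bo V f o z * f z

def Rop {m : ℕ} (κ : ℝ) (V f : Spc m → ℝ) (x : Spc m) : ℝ := κ * lap f x + Fop V f x

lemma pd_mul {m : ℕ} {f g : Spc m → ℝ} {x : Spc m} (hf : DifferentiableAt ℝ f x) (hg : DifferentiableAt ℝ g x) (v : Spc m) :
    pd v (fun z => f z * g z) x = pd v f x * g x + f x * pd v g x := by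
  unfold pd; rw [fderiv_fun_mul hf hg]; simp; ring

lemma pd_diff {m : ℕ} {f : Spc m → ℝ} (h : Differentiable ℝ (grd f)) (v : Spc m) : Differentiable ℝ (pd v f) :=
  fun x => (h x).clm_apply (differentiableAt_const v)

lemma fl_diff {m : ℕ} {κ : ℝ} {V f : Spc m → ℝ} (hV : ContDiff ℝ 2 V) (hVp : Per V) (hf : Reg f) (o) :
    Differentiable ℝ (fl κ V f o) :=
  ((pd_diff hf.d2 _).const_mul κ).add (((bo_C1 hV hVp hf o).differentiable (by norm_num)).mul (hf.c1.differentiable (by norm_num)))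

lemma fl_per {m : ℕ} {κ : ℝ} {V f : Spc m → ℝ} (hVp : Per V) (hf : Per f) (o) : Per (fl κ V f o) := fun x k => by
  simp only [fl, hf.pd _ x k, bo_per hVp hf o x k, hf x k]

lemma pd_fl {m : ℕ} {κ : ℝ} {V f : Spc m → ℝ} (hV : ContDiff ℝ 2 V) (hVp : Per V) (hf : Reg f) (o o') (x : Spc m) :
    pd (dir o') (fl κ V f o) x = κ * pd (dir o') (pd (dir o) f) x + pd (dir o') (fun z => bo V f o z * f z) x := by
  have h1 := (pd_diff hf.d2 (dir o)) x
  have h2 := (((bo_C1 hV hVp hf o).differentiable (by norm_num)).mul (hf.c1.differentiable (by norm_num))) x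
  have h3 : HasFDerivAt (fl κ V f o) _ x := (h1.hasFDerivAt.const_mul κ).add h2.hasFDerivAt
  unfold pd; unfold pd at h3; rw [h3.fderiv]; rfl

lemma fl_PI {m : ℕ} {κ : ℝ} {V f : Spc m → ℝ} (hV : ContDiff ℝ 2 V) (hVp : Per V) (hf : Reg f) (o o') :
    PI (pd (dir o') (fl κ V f o)) := by
  refine ⟨(fl_per hVp hf.per o).pd _, meas_pd _ _, ?_⟩
  have h2 : ContDiff ℝ 1 fun z => bo V f o z * f z := (bo_C1 hV hVp hf o).mul hf.c1
  have h3 : Continuous (pd (dir o') (fun z => bo V f o z * f z)) :=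
    (h2.continuous_fderiv (by norm_num)).clm_apply continuous_const
  have := ((hf.i2 (dir o') (dir o)).const_mul κ).add (int_cube h3)
  exact this.congr (ae_of_all _ fun x => (pd_fl hV hVp hf o o' x).symm)

lemma Rop_eq {m : ℕ} {κ : ℝ} {V f : Spc m → ℝ} (hV : ContDiff ℝ 2 V) (hVp : Per V) (hf : Reg f) :
    Rop κ V f = fun x => ∑ o, pd (dir o) (fl κ V f o) x := by
  ext x
  have hdf := hf.c1.differentiable (by norm_num) x
  have hdV := fun o => (pd_C1 hV (dir o)).differentiable (by norm_num) x
  have hphi : DifferentiableAt ℝ (fun z : Spc m => phiF V f z.1) x :=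
    (((phi_C1 hV hVp hf).comp contDiff_fst).differentiable (by norm_num)) x
  have h1 : ∀ i, pd (dir (some i)) (fun z => bo V f (some i) z * f z) x =
      pd (dir (some i)) (pd (dir (some i)) V) x * f x + pd (dir (some i)) V x * pd (dir (some i)) f x := fun i => by
    have : (fun z => bo V f (some i) z * f z) = fun z => pd (dir (some i)) V z * f z := by
      ext z; simp [bo]
    rw [this, pd_mul (hdV _) hdf]
  have h2 : pd (dir none) (fun z => bo V f none z * f z) x =
      pd (dir none) (pd (dir none) V) x * f x + pd (dir none) V x * pd (dir none) f x
        - pd (dir none) (fun z => phiF V f z.1 * f z) x := by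
    rw [← pd_mul (hdV _) hdf]
    have : (fun z => bo V f none z * f z) = fun z => pd (dir none) V z * f z - phiF V f z.1 * f z := by
      ext z; simp [bo]; ring
    rw [this]; unfold pd
    rw [fderiv_fun_sub]
    · rfl
    · exact (hdV none).fun_mul hdf
    · exact hphi.fun_mul hdf
  simp only [pd_fl hV hVp hf]
  rw [Fintype.sum_option, h2]
  simp only [h1]
  simp only [Rop, lap, Fop, gradDot, dir, Finset.sum_add_distrib, ← Finset.sum_mul, ← Finset.mul_sum]
  ring

lemma Rop_PI {m : ℕ} {κ : ℝ} {V f : Spc m → ℝ} (hV : ContDiff ℝ 2 V) (hVp : Per V) (hf : Reg f) :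
    PI (Rop κ V f) := by
  rw [Rop_eq hV hVp hf]; exact PI.sum fun o => fl_PI hV hVp hf o o

lemma dini {J : ℝ → ℝ} {t : ℝ} (ht : 0 ≤ t) (hc : ContinuousOn J (Icc 0 t))
    (h : ∀ s ∈ Ioc 0 t, ∀ ε > 0, ∀ᶠ s' in nhdsWithin s (Iio s), J s - J s' ≤ ε * (s - s')) : J t ≤ J 0 := by
  have hmap : ∀ r, Tendsto (fun z => t - z) (nhdsWithin r (Ioi r)) (nhdsWithin (t - r) (Iio (t - r))) := fun r => by
    refine tendsto_nhdsWithin_iff.2 ⟨?_, ?_⟩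
    · exact ((continuous_const.sub continuous_id).tendsto r).mono_left nhdsWithin_le_nhds
    · filter_upwards [self_mem_nhdsWithin] with z hz
      simpa using hz
  have key := image_le_of_liminf_slope_right_le_deriv_boundary (f := fun r => -J (t - r)) (a := 0) (b := t)
    (B := fun _ => -J t) (B' := fun _ => 0) ?_ (by simp) continuousOn_const
    (fun x _ => hasDerivWithinAt_const _ _ _) ?_ (x := t) ⟨ht, le_rfl⟩
  · simpa using key
  · refine (hc.comp (by fun_prop) fun r hr => ?_).neg
    exact ⟨by linarith [hr.2], by linarith [hr.1]⟩
  · intro r hr q hq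
    refine Eventually.frequently ?_
    have h1 := (hmap r).eventually (h (t - r) ⟨by linarith [hr.2], by linarith [hr.1]⟩ (q / 2) (by linarith))
    filter_upwards [h1, self_mem_nhdsWithin] with z hz hzr
    have hzr : r < z := hzr
    rw [slope_def_field, div_lt_iff₀ (by linarith)]
    nlinarith

structure Sys {m : ℕ} (V : Spc m → ℝ) (κ : ℝ) (T : ℝ≥0∞) (u : ℝ → Spc m → ℝ) : Prop where
  hV : ContDiff ℝ 2 V
  hVp : Per V
  hκ : 0 < κ
  reg : ∀ t ∈ Ioo0 T, Reg (u t)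
  per0 : Per (u 0)
  c0 : ContDiff ℝ 1 (u 0)
  nn0 : ∀ x, 0 ≤ u 0 x
  mass0 : ∫ x in cube m, u 0 x = 1
  pos0 : ∀ x1, 0 < marg (u 0) x1
  contL1 : ∀ t ∈ Ico0 T, Tendsto (fun s => ∫ x in cube m, |u s x - u t x|) (nhdsWithin t (Ico0 T)) (nhds 0)
  eqL1 : ∀ s ∈ Ioo0 T, (fun t => ∫ x in cube m, |u t x - u s x - (t - s) * Rop κ V (u s) x|) =o[nhds s] fun t => t - s

lemma Ico0_cases {T : ℝ≥0∞} {t : ℝ} (h : t ∈ Ico0 T) : t = 0 ∨ t ∈ Ioo0 T := by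
  rcases h.1.eq_or_lt with h0 | h0
  · exact Or.inl h0.symm
  · exact Or.inr ⟨h0, h.2⟩

lemma Ioo0_sub {T : ℝ≥0∞} {t : ℝ} (h : t ∈ Ioo0 T) : t ∈ Ico0 T := ⟨h.1.le, h.2⟩

lemma Ico0_down {T : ℝ≥0∞} {s t : ℝ} (h : t ∈ Ico0 T) (h0 : 0 ≤ s) (hs : s ≤ t) : s ∈ Ico0 T :=
  ⟨h0, (ENNReal.ofReal_le_ofReal hs).trans_lt h.2⟩
lemma Ioo0_down {T : ℝ≥0∞} {s t : ℝ} (h : t ∈ Ico0 T) (h0 : 0 < s) (hs : s ≤ t) : s ∈ Ioo0 T :=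
  ⟨h0, (ENNReal.ofReal_le_ofReal hs).trans_lt h.2⟩

lemma Ioo0_nhds {T : ℝ≥0∞} {t : ℝ} (h : t ∈ Ioo0 T) : Ioo0 T ∈ nhds t :=
  ((isOpen_Ioi (a := (0:ℝ))).inter (isOpen_Iio.preimage ENNReal.continuous_ofReal)).mem_nhds h

namespace Sys
variable {m : ℕ} {V : Spc m → ℝ} {κ : ℝ} {T : ℝ≥0∞} {u : ℝ → Spc m → ℝ}

lemma per (S : Sys V κ T u) {t : ℝ} (ht : t ∈ Ico0 T) : Per (u t) := by
  rcases Ico0_cases ht with rfl | h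
  · exact S.per0
  · exact (S.reg t h).per
lemma c1 (S : Sys V κ T u) {t : ℝ} (ht : t ∈ Ico0 T) : ContDiff ℝ 1 (u t) := by
  rcases Ico0_cases ht with rfl | h
  · exact S.c0
  · exact (S.reg t h).c1
lemma cont (S : Sys V κ T u) {t : ℝ} (ht : t ∈ Ico0 T) : Continuous (u t) := (S.c1 ht).continuous
lemma pos (S : Sys V κ T u) {t : ℝ} (ht : t ∈ Ico0 T) : ∀ x1, 0 < marg (u t) x1 := by
  rcases Ico0_cases ht with rfl | h
  · exact S.pos0
  · exact (S.reg t h).pos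
lemma pI (S : Sys V κ T u) {t : ℝ} (ht : t ∈ Ico0 T) : PI (u t) := PI.of_cont (S.per ht) (S.cont ht)
lemma rPI (S : Sys V κ T u) {t : ℝ} (ht : t ∈ Ioo0 T) : PI (Rop κ V (u t)) := Rop_PI S.hV S.hVp (S.reg t ht)

lemma _root_.bdd_int {θ f : Spc m → ℝ} {C : ℝ} (hθ : Measurable θ) (hb : ∀ x, |θ x| ≤ C) (hf : IntegrableOn f (cube m)) :
    IntegrableOn (fun x => θ x * f x) (cube m) ∧ |∫ x in cube m, θ x * f x| ≤ C * ∫ x in cube m, |f x| := by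
  have hi : IntegrableOn (fun x => θ x * f x) (cube m) :=
    Integrable.bdd_mul (c := C) hf hθ.aestronglyMeasurable (ae_of_all _ hb)
  refine ⟨hi, ?_⟩
  rw [← integral_const_mul, ← Real.norm_eq_abs]
  refine norm_integral_le_of_norm_le (hf.abs.const_mul C) (ae_of_all _ fun x => ?_)
  rw [norm_mul]; exact mul_le_mul_of_nonneg_right (hb x) (abs_nonneg _)

lemma energy (S : Sys V κ T u) {J : ℝ → ℝ} {L : ℝ}
    (hL : ∀ s ∈ Ico0 T, ∀ t ∈ Ico0 T, J s - J t ≤ L * ∫ x in cube m, |u s x - u t x|)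
    (hJ : ∀ s ∈ Ioo0 T, ∃ (θ : Spc m → ℝ) (C : ℝ), Measurable θ ∧ (∀ x, |θ x| ≤ C) ∧
      (∀ t ∈ Ico0 T, J s - J t ≤ ∫ x in cube m, θ x * (u s x - u t x)) ∧
      ∫ x in cube m, θ x * Rop κ V (u s) x ≤ 0) {t : ℝ} (ht : t ∈ Ico0 T) : J t ≤ J 0 := by
  have hsym : ∀ s t, ∫ x in cube m, |u s x - u t x| = ∫ x in cube m, |u t x - u s x| := fun s t => by
    simp only [abs_sub_comm]
  refine dini ht.1 ?_ ?_
  · refine ContinuousOn.mono (s := Ico0 T) ?_ fun s hs => Ico0_down ht hs.1 hs.2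
    intro s hs
    have h1 : Tendsto (fun s' => L * ∫ x in cube m, |u s' x - u s x|) (nhdsWithin s (Ico0 T)) (nhds 0) := by
      simpa using (S.contL1 s hs).const_mul L
    refine tendsto_iff_norm_sub_tendsto_zero.2 (squeeze_zero' (Eventually.of_forall fun _ => norm_nonneg _) ?_ h1)
    filter_upwards [self_mem_nhdsWithin] with s' hs'
    rw [Real.norm_eq_abs, abs_le]
    have h2 := hL s' hs' s hs
    have h3 := hL s hs s' hs'
    rw [hsym] at h3
    constructor <;> linarith
  · intro s hs ε hε
    have hs0 : s ∈ Ioo0 T := Ioo0_down ht hs.1 hs.2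
    obtain ⟨θ, C, hm, hb, hθ, hR⟩ := hJ s hs0
    have hC0 : 0 ≤ C := (abs_nonneg _).trans (hb 0)
    have h1 := (S.eqL1 s hs0).def (show 0 < ε / (C + 1) by positivity)
    filter_upwards [nhdsWithin_le_nhds h1, self_mem_nhdsWithin, nhdsWithin_le_nhds (Ioo0_nhds hs0)] with s' h2 h3 h4
    have h3 : s' < s := h3
    refine (hθ s' (Ioo0_sub h4)).trans ?_
    have hRi := (S.rPI hs0)
    have hd := (((S.pI (Ioo0_sub h4)).sub (S.pI (Ioo0_sub hs0))).sub (hRi.smul (s' - s)))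
    have e : ∫ x in cube m, θ x * (u s x - u s' x) =
        -(∫ x in cube m, θ x * (u s' x - u s x - (s' - s) * Rop κ V (u s) x)) + (s - s') * ∫ x in cube m, θ x * Rop κ V (u s) x := by
      rw [neg_add_eq_sub, ← integral_const_mul, ← integral_sub ((bdd_int hm hb hRi.int).1.const_mul _) (bdd_int hm hb hd.int).1]
      congr 1; ext x; ring
    rw [e]
    have h5 := (neg_le_abs _).trans (bdd_int hm hb hd.int).2
    rw [Real.norm_eq_abs, abs_of_nonneg (integral_nonneg fun _ => abs_nonneg _), Real.norm_eq_abs, abs_of_neg (by linarith)] at h2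
    have h6 := mul_le_mul_of_nonneg_left h2 hC0
    have h7 : (s - s') * ∫ x in cube m, θ x * Rop κ V (u s) x ≤ 0 := mul_nonpos_of_nonneg_of_nonpos (by linarith) hR
    have h8 : C * (ε / (C + 1) * -(s' - s)) ≤ ε * (s - s') := by
      have : C * (ε / (C + 1) * -(s' - s)) = C / (C + 1) * (ε * (s - s')) := by field_simp; ring
      rw [this]
      refine mul_le_of_le_one_left (mul_nonneg hε.le (by linarith)) ?_
      rw [div_le_one (by positivity)]; linarith
    linarith

end Sys

lemma per_zero {m : ℕ} {f : Spc m → ℝ} (hf : Per f) (hc : Continuous f) (h0 : ∀ x, 0 ≤ f x)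
    (hi : ∫ x in cube m, f x ≤ 0) (x : Spc m) : f x = 0 := by
  have h : ∀ ε ∈ Ioi (0:ℝ), (0:ℝ) = cv (G ε) f x := fun ε hε => by
    have := (dom_G hε).L1 (PI.of_cont hf hc) x
    simp only [abs_of_nonneg (h0 _)] at this
    have h2 : ∫ x in cube m, f x = 0 := le_antisymm hi (integral_nonneg h0)
    rw [h2, mul_zero] at this
    exact (abs_nonpos_iff.1 this).symm
  refine (tendsto_nhds_unique (cv_approx hf hc x) ?_)
  exact tendsto_const_nhds.congr' (eventually_nhdsWithin_of_forall h)

lemma hasD_sq (r : ℝ) : HasDerivAt (fun r : ℝ => max r 0 ^ 2) (2 * max r 0) r := by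
  rcases lt_trichotomy r 0 with h | h | h
  · rw [max_eq_right h.le, mul_zero]
    refine (hasDerivAt_const r (0:ℝ)).congr_of_eventuallyEq ?_
    filter_upwards [Iio_mem_nhds h] with x hx
    have hx : x < 0 := hx
    simp [max_eq_right hx.le]
  · subst h
    rw [hasDerivAt_iff_isLittleO]
    simp only [max_self, mul_zero, sub_zero]
    have h2 : (fun x : ℝ => x ^ 2) =o[nhds 0] fun x : ℝ => x := by
      simpa using Asymptotics.isLittleO_pow_pow (𝕜 := ℝ) (show 1 < 2 by norm_num)
    refine Asymptotics.IsBigO.trans_isLittleO (Asymptotics.IsBigO.of_bound 1 (Eventually.of_forall fun x => ?_)) h2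
    rcases le_total x 0 with hx | hx
    · simp [hx]; positivity
    · simp [hx]
  · rw [max_eq_left h.le]
    have h1 : HasDerivAt (fun r : ℝ => r ^ 2) (2 * r) r := by simpa using hasDerivAt_pow 2 r
    refine h1.congr_of_eventuallyEq ?_
    filter_upwards [Ioi_mem_nhds h] with x hx
    have hx : 0 < x := hx
    simp [max_eq_left hx.le]

lemma cv_conv {c a b : ℝ} : max (c - a) 0 ^ 3 - max (c - b) 0 ^ 3 ≤ -3 * max (c - a) 0 ^ 2 * (a - b) := by
  set A := max (c - a) 0
  set B := max (c - b) 0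
  have hA : 0 ≤ A := le_max_right _ _
  have hB : 0 ≤ B := le_max_right _ _
  have hB' : c - b ≤ B := le_max_left _ _
  have h1 : A ^ 3 - B ^ 3 ≤ 3 * A ^ 2 * (A - B) := by
    nlinarith [mul_nonneg (add_nonneg (add_nonneg hA hA) hB) (sq_nonneg (A - B))]
  have h2 : A ^ 2 * (A - B) ≤ A ^ 2 * (b - a) := by
    rcases le_total (c - a) 0 with h | h
    · have : A = 0 := max_eq_right h
      simp [this]
    · have : A = c - a := max_eq_left h
      exact mul_le_mul_of_nonneg_left (by linarith) (sq_nonneg _)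
  nlinarith

lemma fub {m : ℕ} {g : ℝ → ℝ} (hg : Continuous g) {f : Spc m → ℝ} (hf : Continuous f) (hp : Per f) :
    ∫ x in cube m, g x.1 * f x = ∫ x in cube m, g x.1 * marg f x.1 := by
  have hm := marg_cont hp hf
  have h1 : ∀ F : Spc m → ℝ, Continuous F → ∫ x in cube m, F x = ∫ x1 in Ico (0:ℝ) 1, ∫ y in cube1 m, F (x1, y) := fun F hF => by
    have h := int_cube hF
    rw [IntegrableOn, cube, Measure.volume_eq_prod] at h
    rw [cube, Measure.volume_eq_prod, setIntegral_prod _ h]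
  rw [h1 _ (by fun_prop), h1 _ (by fun_prop)]
  congr 1; ext x1
  simp only [integral_const_mul]
  congr 1
  simp [marg]

namespace Sys
variable {m : ℕ} {V : Spc m → ℝ} {κ : ℝ} {T : ℝ≥0∞} {u : ℝ → Spc m → ℝ}

lemma test (S : Sys V κ T u) {s : ℝ} (hs : s ∈ Ioo0 T) {θ : Spc m → ℝ} (hθ : ContDiff ℝ 1 θ) (hp : Per θ) :
    ∫ x in cube m, θ x * Rop κ V (u s) x = -∑ o, ∫ x in cube m, pd (dir o) θ x * fl κ V (u s) o x := by
  have hr := S.reg s hs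
  obtain ⟨C, _, hC⟩ := hp.bdd hθ.continuous
  have hθd := hθ.differentiable (by norm_num)
  have hfd := fun o => fl_diff (κ := κ) S.hV S.hVp hr o
  have hi1 := fun o => (bdd_int hθ.continuous.measurable hC (fl_PI (κ := κ) S.hV S.hVp hr o o).int).1
  have hpdc : ∀ o, Continuous (pd (dir o) θ) := fun o => (hθ.continuous_fderiv (by norm_num)).clm_apply continuous_const
  have hi2 : ∀ o, IntegrableOn (fun x => pd (dir o) θ x * fl κ V (u s) o x) (cube m) := fun o =>
    int_cube ((hpdc o).mul (hfd o).continuous)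
  have h : ∀ o, ∫ x in cube m, θ x * pd (dir o) (fl κ V (u s) o) x = -∫ x in cube m, pd (dir o) θ x * fl κ V (u s) o x := fun o => by
    have e : pd (dir o) (fun x => θ x * fl κ V (u s) o x) = fun x => pd (dir o) θ x * fl κ V (u s) o x + θ x * pd (dir o) (fl κ V (u s) o) x :=
      funext fun x => pd_mul (hθd x) (hfd o x) _
    have h0 := ibp0' (hp.mul (fl_per (κ := κ) S.hVp hr.per o)) (hθd.mul (hfd o)) o (by
      have := (hi2 o).add (hi1 o)
      rw [e]; exact this)
    rw [e, integral_add (hi2 o) (hi1 o)] at h0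
    linarith
  rw [Rop_eq S.hV S.hVp hr]
  simp only [Finset.mul_sum]
  rw [integral_finsetSum _ fun o _ => hi1 o, ← Finset.sum_neg_distrib]
  exact Finset.sum_congr rfl fun o _ => h o

lemma mass (S : Sys V κ T u) {t : ℝ} (ht : t ∈ Ico0 T) : ∫ x in cube m, u t x = 1 := by
  have key : ∀ c : ℝ, ∫ x in cube m, c * u t x ≤ ∫ x in cube m, c * u 0 x := fun c => by
    refine S.energy (J := fun t => ∫ x in cube m, c * u t x) (L := |c|) (fun s hs t ht => ?_) (fun s hs => ?_) ht
    · rw [← integral_sub ((S.pI hs).smul c).int ((S.pI ht).smul c).int, ← integral_const_mul]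
      refine integral_mono (((S.pI hs).smul c).sub ((S.pI ht).smul c)).int (((S.pI hs).sub (S.pI ht)).int.abs.const_mul _) fun x => ?_
      simp only; rw [← abs_mul, ← mul_sub]; exact le_abs_self _
    · refine ⟨fun _ => c, |c|, measurable_const, fun _ => le_rfl, fun t ht => ?_, ?_⟩
      · rw [← integral_sub ((S.pI (Ioo0_sub hs)).smul c).int ((S.pI ht).smul c).int]
        simp only [mul_sub]; exact le_rfl
      · rw [S.test hs contDiff_const (fun _ _ => rfl)]
        simp [pd]
  have h1 := key 1
  have h2 := key (-1)
  simp only [one_mul, neg_mul, integral_neg, S.mass0] at h1 h2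
  linarith

lemma marg_lb (S : Sys V κ T u) : ∃ c > 0, ∀ t ∈ Ico0 T, ∀ x1, c ≤ marg (u t) x1 := by
  obtain ⟨x0, _, hx0⟩ := isCompact_Icc.exists_isMinOn (s := Icc (0:ℝ) 1) ⟨0, by simp⟩ (marg_cont S.per0 S.c0.continuous).continuousOn
  set c := marg (u 0) x0 with hc
  have hc0 : 0 < c := S.pos0 x0
  have hc1 : ∀ x, c ≤ marg (u 0) x := fun x => by
    have h1 := marg_per S.per0 x (-⌊x⌋)
    rw [← h1]
    refine hx0 ⟨?_, ?_⟩ <;> push_cast <;> linarith [Int.floor_le x, Int.lt_floor_add_one x]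
  refine ⟨c, hc0, fun t ht => ?_⟩
  have hper : ∀ t ∈ Ico0 T, ∀ g : ℝ → ℝ, Per (fun x : Spc m => g (marg (u t) x.1)) := fun t ht g x k => by
    simp only [lat, Prod.fst_add, marg_per (S.per ht)]
  have hcm : ∀ t ∈ Ico0 T, Continuous fun x : Spc m => marg (u t) x.1 := fun t ht =>
    (marg_cont (S.per ht) (S.cont ht)).comp continuous_fst
  set J : ℝ → ℝ := fun t => ∫ x in cube m, max (c - marg (u t) x.1) 0 ^ 3 with hJ
  have hJc : ∀ t ∈ Ico0 T, Continuous fun x : Spc m => max (c - marg (u t) x.1) 0 ^ 3 := fun t ht => by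
    have := hcm t ht; fun_prop
  have hb : ∀ s ∈ Ico0 T, ∀ x1 : ℝ, |(-3 * max (c - marg (u s) x1) 0 ^ 2)| ≤ 3 * c ^ 2 := fun s hs x1 => by
    have h1 : 0 ≤ max (c - marg (u s) x1) 0 := le_max_right _ _
    have h2 : max (c - marg (u s) x1) 0 ≤ c := max_le (by linarith [S.pos hs x1]) hc0.le
    rw [abs_mul, abs_of_nonneg (sq_nonneg (max (c - marg (u s) x1) 0))]; norm_num; gcongr
  have hconv : ∀ s ∈ Ico0 T, ∀ t ∈ Ico0 T, J s - J t ≤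
      ∫ x in cube m, (-3 * max (c - marg (u s) x.1) 0 ^ 2) * (u s x - u t x) := fun s hs t ht => by
    have hus := S.cont hs
    have hut := S.cont ht
    have hms := marg_cont (S.per hs) hus
    rw [fub (g := fun r => -3 * max (c - marg (u s) r) 0 ^ 2) (f := fun x => u s x - u t x) (by fun_prop) (hus.sub hut)
      (fun x k => by simp only [S.per hs x k, S.per ht x k])]
    have e : ∀ x1, marg (fun x => u s x - u t x) x1 = marg (u s) x1 - marg (u t) x1 := fun x1 => by
      have hin : ∀ f : Spc m → ℝ, Continuous f → Per f → Integrable (fun y => f (x1, y)) (volume.restrict (cube1 m)) := fun f hf hp => by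
        obtain ⟨C, _, hC⟩ := hp.bdd hf
        exact Integrable.mono' (integrable_const C) (hf.comp (by fun_prop : Continuous fun y => (x1, y))).aestronglyMeasurable (ae_of_all _ fun y => hC _)
      exact integral_sub (hin _ hus (S.per hs)) (hin _ hut (S.per ht))
    simp only [e, hJ]
    have h1 := hcm s hs
    have h2 := hcm t ht
    rw [← integral_sub (int_cube (hJc s hs)) (int_cube (hJc t ht))]
    refine integral_mono (int_cube ((hJc s hs).sub (hJc t ht))) (int_cube (by fun_prop)) fun x => cv_conv
  have hle := S.energy (J := J) (L := 3 * c ^ 2) (fun s hs t ht => ?_) (fun s hs => ?_) ht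
  · have hJ0 : J 0 = 0 := by
      simp only [hJ]
      simp [max_eq_right (sub_nonpos.2 (hc1 _))]
    rw [hJ0] at hle
    intro x1
    have := per_zero (hper t ht fun r => max (c - r) 0 ^ 3) (hJc t ht) (fun x => by positivity) hle (x1, 0)
    simp only [pow_eq_zero_iff (by norm_num : 3 ≠ 0), max_eq_right_iff] at this
    linarith
  · refine (hconv s hs t ht).trans ((le_abs_self _).trans ?_)
    have := hcm s hs
    exact (bdd_int (by fun_prop : Continuous fun x : Spc m => -3 * max (c - marg (u s) x.1) 0 ^ 2).measurable (fun x => hb s hs x.1) ((S.pI hs).sub (S.pI ht)).int).2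
  · have hs' := Ioo0_sub hs
    have hcs := hcm s hs'
    refine ⟨fun x => -3 * max (c - marg (u s) x.1) 0 ^ 2, 3 * c ^ 2, (by fun_prop : Continuous fun x : Spc m => -3 * max (c - marg (u s) x.1) 0 ^ 2).measurable, fun x => hb s hs' x.1,
      fun t ht => hconv s hs' t ht, ?_⟩
    have hr := S.reg s hs
    have hM := marg_C1 hr.per hr.c1
    set M := marg (u s) with hMdef
    set M' : ℝ → ℝ := marg (pd (e1 m) (u s)) with hM'
    have hMd : ∀ x, HasDerivAt M (M' x) x := marg_deriv hr.per hr.c1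
    have hpc : ∀ v, Continuous (pd v (u s)) := fun v => (hr.c1.continuous_fderiv (by norm_num)).clm_apply continuous_const
    have hM'c : Continuous M' := marg_cont (hr.per.pd _) (hpc _)
    set θ1 : ℝ → ℝ := fun r => -3 * max (c - M r) 0 ^ 2 with hθ1
    have hd1 : ∀ x, HasDerivAt θ1 (6 * max (c - M x) 0 * M' x) x := fun x => by
      have h1 := ((hasD_sq (c - M x)).comp x ((hMd x).const_sub c)).const_mul (-3)
      refine h1.congr_deriv ?_; ring
    have hMc := hM.continuous
    have hθC1 : ContDiff ℝ 1 θ1 := by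
      rw [contDiff_one_iff_deriv]
      refine ⟨fun x => (hd1 x).differentiableAt, ?_⟩
      rw [show deriv θ1 = _ from funext fun x => (hd1 x).deriv]
      fun_prop
    have hpd : ∀ v x, pd v (fun x : Spc m => θ1 x.1) x = 6 * max (c - M x.1) 0 * M' x.1 * v.1 := fun v x => by
      have := (hd1 x.1).hasFDerivAt.comp x (hasFDerivAt_fst (𝕜 := ℝ) (E := ℝ) (F := Fin m → ℝ) (p := x))
      have h2 : HasFDerivAt (fun x : Spc m => θ1 x.1) _ x := this
      rw [pd, h2.fderiv]; simp; ring
    have htest := S.test hs (θ := fun x => θ1 x.1) (hθC1.comp contDiff_fst) (hper s hs' fun r => -3 * max (c - r) 0 ^ 2)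
    rw [htest, neg_nonpos]
    have hflc := fun o => (fl_diff (κ := κ) S.hV S.hVp hr o).continuous
    have hflm : ∀ x1, marg (fl κ V (u s) none) x1 = κ * M' x1 := fun x1 => by
      have hin : ∀ f : Spc m → ℝ, Continuous f → Per f → Integrable (fun y => f (x1, y)) (volume.restrict (cube1 m)) := fun f hf hp => by
        obtain ⟨C, _, hC⟩ := hp.bdd hf
        exact Integrable.mono' (integrable_const C) (hf.comp (by fun_prop : Continuous fun y => (x1, y))).aestronglyMeasurable (ae_of_all _ fun y => hC _)
      have hVc := (pd_C1 S.hV (e1 m)).continuous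
      have i1 := (hin _ (hpc (e1 m)) (hr.per.pd _)).const_mul κ
      have i2 : Integrable (fun y => pd (e1 m) V (x1, y) * u s (x1, y)) (volume.restrict (cube1 m)) := hin _ (hVc.mul hr.c1.continuous) ((S.hVp.pd (e1 m)).mul hr.per)
      have i3 := (hin _ hr.c1.continuous hr.per).const_mul (phiF V (u s) x1)
      have i23 : Integrable (fun y => pd (e1 m) V (x1, y) * u s (x1, y) - phiF V (u s) x1 * u s (x1, y)) (volume.restrict (cube1 m)) := i2.sub i3
      have e : ∀ y, fl κ V (u s) none (x1, y) = κ * pd (e1 m) (u s) (x1, y) +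
          (pd (e1 m) V (x1, y) * u s (x1, y) - phiF V (u s) x1 * u s (x1, y)) := fun y => by
        simp only [fl, bo, dir, if_true]; ring
      simp only [marg, e]
      rw [integral_add i1 i23, integral_sub i2 i3, integral_const_mul, integral_const_mul]
      have h0 : phiF V (u s) x1 * (∫ y in cube1 m, u s (x1, y)) = ∫ y in cube1 m, pd (e1 m) V (x1, y) * u s (x1, y) := by
        rw [phiF]; exact div_mul_cancel₀ _ (hr.pos x1).ne'
      rw [h0, hM', marg]; ring
    refine Finset.sum_nonneg fun o _ => ?_
    rcases o with _ | i
    · simp only [hpd, dir, e1, mul_one]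
      rw [fub (g := fun x1 => 6 * max (c - M x1) 0 * M' x1) (by fun_prop) (hflc none) (fl_per S.hVp hr.per none)]
      refine integral_nonneg fun x => ?_
      simp only [hflm]
      have h1 : 0 ≤ max (c - M x.1) 0 := le_max_right _ _
      have := S.hκ
      have h3 : 6 * max (c - M x.1) 0 * M' x.1 * (κ * M' x.1) = 6 * max (c - M x.1) 0 * κ * (M' x.1 ^ 2) := by ring
      rw [h3]; simp only [Pi.zero_apply]; positivity
    · simp [hpd, dir, eC]

lemma sgn_le (a b : ℝ) : |a| - |b| ≤ Real.sign a * (a - b) := by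
  rcases lt_trichotomy a 0 with h | h | h
  · rw [Real.sign_of_neg h, abs_of_neg h]; linarith [neg_abs_le b]
  · simp [h]
  · rw [Real.sign_of_pos h, abs_of_pos h]; linarith [le_abs_self b]

lemma atan_lim (r : ℝ) : Tendsto (fun k : ℕ => 2 / Real.pi * Real.arctan (k * r)) atTop (nhds (Real.sign r)) := by
  have hp := Real.pi_pos
  have hpos : ∀ r > 0, Tendsto (fun k : ℕ => 2 / Real.pi * Real.arctan (k * r)) atTop (nhds 1) := fun r hr => by
    have h1 : Tendsto (fun k : ℕ => (k : ℝ) * r) atTop atTop := tendsto_natCast_atTop_atTop.atTop_mul_const hr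
    have h2 := ((Real.tendsto_arctan_atTop.mono_right nhdsWithin_le_nhds).comp h1).const_mul (2 / Real.pi)
    rwa [show 2 / Real.pi * (Real.pi / 2) = 1 by field_simp] at h2
  rcases lt_trichotomy r 0 with h | h | h
  · rw [Real.sign_of_neg h]
    have := (hpos (-r) (by linarith)).neg
    simpa using this
  · simp [h]
  · rw [Real.sign_of_pos h]; exact hpos r h

lemma nonneg (S : Sys V κ T u) {t : ℝ} (ht : t ∈ Ico0 T) : ∀ x, 0 ≤ u t x := by
  have hp := Real.pi_pos
  have hle := S.energy (J := fun t => ∫ x in cube m, |u t x|) (L := 1) (fun s hs t ht => ?_) (fun s hs => ?_) ht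
  · simp only [abs_of_nonneg (S.nn0 _), S.mass0] at hle
    have hc := S.cont ht
    have h0 : ∫ x in cube m, (|u t x| - u t x) ≤ 0 := by
      rw [integral_sub (S.pI ht).int.abs (S.pI ht).int, S.mass ht]; linarith
    intro x
    have := per_zero (f := fun x => |u t x| - u t x) (fun x k => by simp only [S.per ht x k]) (by fun_prop)
      (fun x => sub_nonneg.2 (le_abs_self _)) h0 x
    linarith [abs_nonneg (u t x)]
  · rw [← integral_sub (S.pI hs).int.abs (S.pI ht).int.abs, one_mul]
    exact integral_mono ((S.pI hs).int.abs.sub (S.pI ht).int.abs) ((S.pI hs).sub (S.pI ht)).int.abs fun x => abs_sub_abs_le_abs_sub _ _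
  · have hs' := Ioo0_sub hs
    have hr := S.reg s hs
    have hsm : Measurable fun x => Real.sign (u s x) := by
      have : Measurable Real.sign := by
        unfold Real.sign
        exact Measurable.ite measurableSet_Iio measurable_const (Measurable.ite measurableSet_Ioi measurable_const measurable_const)
      exact this.comp hr.c1.continuous.measurable
    have hsb : ∀ x, |Real.sign (u s x)| ≤ 1 := fun x => by
      rcases Real.sign_apply_eq (u s x) with h | h | h <;> simp [h]
    refine ⟨fun x => Real.sign (u s x), 1, hsm, hsb, fun t ht => ?_, ?_⟩
    · rw [← integral_sub (S.pI hs').int.abs (S.pI ht).int.abs]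
      exact integral_mono ((S.pI hs').int.abs.sub (S.pI ht).int.abs)
        (bdd_int hsm hsb ((S.pI hs').sub (S.pI ht)).int).1 fun x => sgn_le _ _
    · set θ : ℕ → Spc m → ℝ := fun k x => 2 / Real.pi * Real.arctan (k * u s x) with hθ
      have hθc : ∀ k, ContDiff ℝ 1 (θ k) := fun k => contDiff_const.mul (Real.contDiff_arctan.comp (contDiff_const.mul hr.c1))
      have hlim : Tendsto (fun k => ∫ x in cube m, θ k x * Rop κ V (u s) x) atTop (nhds (∫ x in cube m, Real.sign (u s x) * Rop κ V (u s) x)) := by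
        refine tendsto_integral_of_dominated_convergence (fun x => |Rop κ V (u s) x|) (fun k => ?_) (S.rPI hs).int.abs (fun k => ae_of_all _ fun x => ?_) (ae_of_all _ fun x => (atan_lim _).mul_const _)
        · exact ((hθc k).continuous.measurable.mul (S.rPI hs).meas).aestronglyMeasurable
        · rw [norm_mul, Real.norm_eq_abs, Real.norm_eq_abs]
          refine mul_le_of_le_one_left (abs_nonneg _) ?_
          simp only [hθ]
          rw [abs_mul, abs_of_pos (by positivity : 0 < 2 / Real.pi), div_mul_eq_mul_div, div_le_one hp]
          have := (abs_lt.2 ⟨Real.neg_pi_div_two_lt_arctan (k * u s x), Real.arctan_lt_pi_div_two (k * u s x)⟩)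
          linarith
      set q : ℕ → Option (Fin m) → Spc m → ℝ := fun k o x => 2 / Real.pi * (k * |u s x| / (1 + (k * u s x) ^ 2)) * |bo V (u s) o x * pd (dir o) (u s) x| with hq
      have hpc : ∀ v, Continuous (pd v (u s)) := fun v => (hr.c1.continuous_fderiv (by norm_num)).clm_apply continuous_const
      have hbc := fun o => (bo_C1 S.hV S.hVp hr o).continuous
      have huc := hr.c1.continuous
      have hqc : ∀ k o, Continuous (q k o) := fun k o => by
        have h1 := hbc o
        have h2 := hpc (dir o)
        simp only [hq]
        refine Continuous.mul (continuous_const.mul (Continuous.div (by fun_prop) (by fun_prop) fun x => by positivity)) (by fun_prop)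
      have hpd : ∀ k v x, pd v (θ k) x = 2 / Real.pi * (k / (1 + (k * u s x) ^ 2)) * pd v (u s) x := fun k v x => by
        have h1 := ((hr.c1.differentiable (by norm_num) x).hasFDerivAt.const_mul (k:ℝ)).arctan.const_mul (2 / Real.pi)
        have h2 : HasFDerivAt (θ k) _ x := h1
        rw [pd, h2.fderiv]; simp [pd]; ring
      have hbd : ∀ k, ∫ x in cube m, θ k x * Rop κ V (u s) x ≤ ∑ o, ∫ x in cube m, q k o x := fun k => by
        rw [S.test hs (hθc k) (fun x j => by simp only [hθ, hr.per x j]), ← Finset.sum_neg_distrib]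
        refine Finset.sum_le_sum fun o _ => ?_
        rw [← integral_neg]
        have hflc := (fl_diff (κ := κ) S.hV S.hVp hr o).continuous
        have hpt : Continuous (pd (dir o) (θ k)) := ((hθc k).continuous_fderiv (by norm_num)).clm_apply continuous_const
        refine integral_mono (int_cube (by fun_prop)) (int_cube (hqc k o)) fun x => ?_
        simp only [hpd, hq, fl]
        have hκ := S.hκ
        set P := pd (dir o) (u s) x
        set b := bo V (u s) o x
        set U := u s x
        have h1 : 0 ≤ 2 / Real.pi * (k / (1 + (k * U) ^ 2)) := by positivity
        have h2 : 2 / Real.pi * (k * |U| / (1 + (k * U) ^ 2)) * |b * P| = 2 / Real.pi * (k / (1 + (k * U) ^ 2)) * |U * (b * P)| := by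
          rw [abs_mul U]; ring
        rw [h2, mul_assoc, ← mul_neg]
        refine mul_le_mul_of_nonneg_left ?_ h1
        have := neg_abs_le (U * (b * P))
        nlinarith [mul_nonneg hκ.le (sq_nonneg P)]
      have hq0 : Tendsto (fun k => ∑ o, ∫ x in cube m, q k o x) atTop (nhds 0) := by
        rw [show (0:ℝ) = ∑ _o : Option (Fin m), ∫ x in cube m, (0:ℝ) by simp]
        refine tendsto_finsetSum _ fun o _ => ?_
        refine tendsto_integral_of_dominated_convergence (fun x => 2 / Real.pi * |bo V (u s) o x * pd (dir o) (u s) x|) (fun k => (hqc k o).aestronglyMeasurable)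
          (int_cube (by have := hbc o; have := hpc (dir o); fun_prop)) (fun k => ae_of_all _ fun x => ?_) (ae_of_all _ fun x => ?_)
        · simp only [hq]
          rw [Real.norm_eq_abs, abs_of_nonneg (by positivity)]
          gcongr
          refine mul_le_of_le_one_right (by positivity) ?_
          rw [div_le_one (by positivity)]
          have : (k * u s x) ^ 2 = (k * |u s x|) ^ 2 := by rw [mul_pow, mul_pow, sq_abs]
          rw [this]; nlinarith [sq_nonneg (k * |u s x| - 1)]
        · simp only [hq]
          rw [show (0:ℝ) = 2 / Real.pi * 0 * |bo V (u s) o x * pd (dir o) (u s) x| by simp]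
          refine (Filter.Tendsto.const_mul _ ?_).mul_const _
          by_cases h0 : u s x = 0
          · simp [h0]
          · have hU : 0 < |u s x| := abs_pos.2 h0
            have h1 : Tendsto (fun k : ℕ => (k * |u s x|)⁻¹) atTop (nhds 0) :=
              (tendsto_natCast_atTop_atTop.atTop_mul_const hU).inv_tendsto_atTop
            refine squeeze_zero' (Eventually.of_forall fun k => by positivity) ?_ h1
            filter_upwards [eventually_gt_atTop 0] with k hk
            have hk' : (0:ℝ) < k := by exact_mod_cast hk
            have : (k * u s x) ^ 2 = (k * |u s x|) ^ 2 := by rw [mul_pow, mul_pow, sq_abs]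
            rw [this, div_le_iff₀ (by positivity)]
            have hpos : 0 < k * |u s x| := by positivity
            rw [inv_mul_eq_div, le_div_iff₀ hpos]; nlinarith
      exact le_of_tendsto_of_tendsto' hlim hq0 hbd

end Sys

lemma mv_one {Φ Φ' : ℝ → ℝ} {a t K γ : ℝ} (hat : a ≤ t) (hγ : γ < 1) (hc : ContinuousOn Φ (Icc a t))
    (hd : ∀ s ∈ Ioo a t, HasDerivAt Φ (Φ' s) s) (hb : ∀ s ∈ Ioo a t, Φ' s ≤ K * (t - s) ^ (-γ)) :
    Φ t - Φ a ≤ K * (t - a) ^ (1 - γ) / (1 - γ) := by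
  have hg : 0 < 1 - γ := by linarith
  have hd2 : ∀ s ∈ Ioo a t, HasDerivAt (fun s => Φ s + K * (t - s) ^ (1 - γ) / (1 - γ)) (Φ' s - K * (t - s) ^ (-γ)) s := fun s hs => by
    have h1 : HasDerivAt (fun s => t - s) (-1) s := by simpa using (hasDerivAt_id s).const_sub t
    have h2 := ((h1.rpow_const (p := 1 - γ) (Or.inl (by linarith [hs.2]))).const_mul K).div_const (1 - γ)
    refine ((hd s hs).add h2).congr_deriv ?_
    rw [show 1 - γ - 1 = -γ by ring]; field_simp; ring
  have hc2 : ContinuousOn (fun s => Φ s + K * (t - s) ^ (1 - γ) / (1 - γ)) (Icc a t) := by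
    refine hc.add (ContinuousOn.div_const (ContinuousOn.mul continuousOn_const ?_) _)
    exact (continuous_const.sub continuous_id).continuousOn.rpow_const fun s hs => Or.inr hg.le
  have := antitoneOn_of_deriv_nonpos (convex_Icc a t) hc2
    (fun s hs => by
      rw [interior_Icc] at hs
      exact (hd2 s hs).differentiableAt.differentiableWithinAt)
    (fun s hs => by
      rw [interior_Icc] at hs
      rw [(hd2 s hs).deriv]; linarith [hb s hs]) (left_mem_Icc.2 hat) (right_mem_Icc.2 hat) hat
  simp only [sub_self, Real.zero_rpow hg.ne', mul_zero, zero_div] at this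
  linarith

lemma mv_two {Φ Φ' : ℝ → ℝ} {a t K γ : ℝ} (hat : a ≤ t) (hγ : γ < 1) (hc : ContinuousOn Φ (Icc a t))
    (hd : ∀ s ∈ Ioo a t, HasDerivAt Φ (Φ' s) s) (hb : ∀ s ∈ Ioo a t, |Φ' s| ≤ K * (t - s) ^ (-γ)) :
    |Φ t - Φ a| ≤ K * (t - a) ^ (1 - γ) / (1 - γ) := by
  rw [abs_le']
  refine ⟨mv_one hat hγ hc hd fun s hs => (le_abs_self _).trans (hb s hs), ?_⟩
  have := mv_one hat hγ hc.neg (fun s hs => (hd s hs).neg) fun s hs => (neg_le_abs _).trans (hb s hs)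
  simp only [Pi.neg_apply] at this
  linarith

namespace Sys
variable {m : ℕ} {V : Spc m → ℝ} {κ : ℝ} {T : ℝ≥0∞} {u : ℝ → Spc m → ℝ}

lemma bu_c (S : Sys V κ T u) {s : ℝ} (hs : s ∈ Ioo0 T) (o : Option (Fin m)) : Continuous fun y => bo V (u s) o y * u s y :=
  (bo_C1 S.hV S.hVp (S.reg s hs) o).continuous.mul (S.reg s hs).c1.continuous
lemma bu_per (S : Sys V κ T u) {s : ℝ} (hs : s ∈ Ioo0 T) (o : Option (Fin m)) : Per fun y => bo V (u s) o y * u s y :=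
  (bo_per S.hVp (S.reg s hs).per o).mul (S.reg s hs).per
lemma bu_PI (S : Sys V κ T u) {s : ℝ} (hs : s ∈ Ioo0 T) (o : Option (Fin m)) : PI fun y => bo V (u s) o y * u s y :=
  PI.of_cont (S.bu_per hs o) (S.bu_c hs o)

lemma duh_alg (S : Sys V κ T u) {s τ : ℝ} (hs : s ∈ Ioo0 T) (hτ : 0 < τ) (x : Spc m) :
    cv (G τ) (Rop κ V (u s)) x - κ * ∑ o, cv (ddG τ o o) (u s) x = ∑ o, cv (dG τ o) (fun y => bo V (u s) o y * u s y) x := by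
  have hr := S.reg s hs
  rw [Rop_eq S.hV S.hVp hr, cv_sum (dom_G hτ) (fun o => fl_PI S.hV S.hVp hr o o), Finset.mul_sum, ← Finset.sum_sub_distrib]
  refine Finset.sum_congr rfl fun o _ => ?_
  have hpc : Continuous (pd (dir o) (u s)) := (hr.c1.continuous_fderiv (by norm_num)).clm_apply continuous_const
  have hpp : PI (pd (dir o) (u s)) := PI.of_cont (hr.per.pd _) hpc
  rw [cv_G_ibp hτ (fl_per S.hVp hr.per o) (fl_diff S.hV S.hVp hr o) o (fl_PI S.hV S.hVp hr o o).int,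
    ← cv_dG_ibp hτ hr.per (hr.c1.differentiable (by norm_num)) o o hpp.int]
  have : fl κ V (u s) o = fun y => κ * pd (dir o) (u s) y + bo V (u s) o y * u s y := rfl
  rw [this, cv_add (dom_dG hτ o) (hpp.smul κ) (S.bu_PI hs o), cv_smul]; ring

lemma duh_deriv (S : Sys V κ T u) {τ0 t s : ℝ} (hs : s ∈ Ioo0 T) (hτ : 0 < τ0 + κ * (t - s)) (x : Spc m) :
    HasDerivAt (fun s => cv (G (τ0 + κ * (t - s))) (u s) x)
      (∑ o, cv (dG (τ0 + κ * (t - s)) o) (fun y => bo V (u s) o y * u s y) x) s := by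
  have hlin : HasDerivAt (fun s => τ0 + κ * (t - s)) (-κ) s := by
    have h := (((hasDerivAt_id s).const_sub t).const_mul κ).const_add τ0
    simpa using h
  set τ : ℝ → ℝ := fun s => τ0 + κ * (t - s) with hτd
  have hτ' : 0 < τ s := hτ
  have hu := S.pI (Ioo0_sub hs)
  have hR := S.rPI hs
  have h1 : HasDerivAt (fun s' => cv (G (τ s')) (u s) x) _ s := (cv_time hτ' hu x).comp s hlin
  have h2 : HasDerivAt (fun s' => cv (G (τ s')) (Rop κ V (u s)) x) _ s := (cv_time hτ' hR x).comp s hlin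
  have h2' := ((hasDerivAt_id s).sub_const s).mul h2
  set w : ℝ → Spc m → ℝ := fun s' y => u s' y - u s y - (s' - s) * Rop κ V (u s) y with hw
  have hwPI : ∀ s' ∈ Ioo0 T, PI (w s') := fun s' hs' => ((S.pI (Ioo0_sub hs')).sub hu).sub (hR.smul _)
  have hev : ∀ᶠ s' in nhds s, τ s / 2 < τ s' := hlin.continuousAt.eventually (lt_mem_nhds (by linarith))
  have hw0 : w s = fun _ => 0 := by ext y; simp [hw]
  have h3 : HasDerivAt (fun s' => cv (G (τ s')) (w s') x) 0 s := by
    rw [hasDerivAt_iff_isLittleO]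
    refine Asymptotics.IsBigO.trans_isLittleO ?_ (S.eqL1 s hs)
    refine Asymptotics.IsBigO.of_bound (Kc m (τ s / 2)) ?_
    filter_upwards [hev, Ioo0_nhds hs] with s' h1 h2
    have h0 : cv (G (τ s)) (w s) x = 0 := by rw [hw0]; simp [cv]
    simp only [h0, sub_zero, smul_zero, Real.norm_eq_abs]
    have h4 := (dom_G (show 0 < τ s' by linarith)).L1 (hwPI s' h2) x
    rw [one_mul] at h4
    refine h4.trans ?_
    rw [abs_of_nonneg (integral_nonneg fun y => abs_nonneg _)]
    exact mul_le_mul_of_nonneg_right (Kc_anti (by linarith) h1.le) (integral_nonneg fun y => abs_nonneg _)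
  have hsum := (h1.add h2').add h3
  refine (hsum.congr_of_eventuallyEq ?_).congr_deriv ?_
  · filter_upwards [hev, Ioo0_nhds hs] with s' h1 h2
    have hd := dom_G (m := m) (show 0 < τ s' by linarith)
    have e : u s' = fun y => u s y + (s' - s) * Rop κ V (u s) y + w s' y := by ext y; simp only [hw]; ring
    simp only [Pi.add_apply, Pi.mul_apply, id]
    conv_lhs => rw [e]
    rw [cv_add hd (hu.add (hR.smul _)) (hwPI s' h2), cv_add hd hu (hR.smul _), cv_smul]
  · rw [← S.duh_alg hs hτ x]
    simp only [id, sub_self, zero_mul, add_zero, one_mul, hτd]; ring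

lemma duh_cont (S : Sys V κ T u) {τ0 t : ℝ} (ht : t ∈ Ico0 T) (hτ : 0 < τ0) (x : Spc m) :
    ContinuousOn (fun s => cv (G (τ0 + κ * (t - s))) (u s) x) (Icc 0 t) := by
  intro s hs
  have hs' := Ico0_down ht hs.1 hs.2
  have hκ := S.hκ
  have hτ' : ∀ s ∈ Icc 0 t, τ0 ≤ τ0 + κ * (t - s) := fun s hs => by
    have := mul_nonneg hκ.le (sub_nonneg.2 hs.2); linarith
  have h1 : ContinuousWithinAt (fun s' => cv (G (τ0 + κ * (t - s'))) (u s) x) (Icc 0 t) s := by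
    have h := (cv_time (hτ.trans_le (hτ' s hs)) (S.pI hs') x).continuousAt
    exact (ContinuousAt.comp (f := fun s' => τ0 + κ * (t - s')) h (by fun_prop)).continuousWithinAt
  have h2 : Tendsto (fun s' => cv (G (τ0 + κ * (t - s'))) (fun y => u s' y - u s y) x) (nhdsWithin s (Icc 0 t)) (nhds 0) := by
    have hsub : Icc 0 t ⊆ Ico0 T := fun r hr => Ico0_down ht hr.1 hr.2
    have h3 := ((S.contL1 s hs').mono_left (nhdsWithin_mono s hsub)).const_mul (Kc m τ0)
    rw [mul_zero] at h3
    refine squeeze_zero_norm' ?_ h3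
    filter_upwards [self_mem_nhdsWithin] with s' hs2
    have h4 := (dom_G (hτ.trans_le (hτ' s' hs2))).L1 ((S.pI (hsub hs2)).sub (S.pI hs')) x
    rw [one_mul] at h4
    refine h4.trans ?_
    exact mul_le_mul_of_nonneg_right (Kc_anti hτ (hτ' s' hs2)) (integral_nonneg fun y => abs_nonneg _)
  have h3 := h2.add h1
  rw [zero_add] at h3
  refine h3.congr' ?_
  filter_upwards [self_mem_nhdsWithin] with s' hs2
  rw [cv_sub (dom_G (hτ.trans_le (hτ' s' hs2))) (S.pI (Ico0_down ht hs2.1 hs2.2)) (S.pI hs')]; ring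

lemma duh0 (S : Sys V κ T u) {ι : Type} [Fintype ι] {c : ι → ℝ} {x : ι → Spc m} {τ1 a t K γ N : ℝ} (ht : t ∈ Ico0 T)
    (h0 : 0 ≤ a) (hat : a ≤ t) (hγ : γ < 1) (hτ : 0 < τ1)
    (hb : ∀ s ∈ Ioo a t, |∑ j, c j * ∑ o, cv (dG (τ1 + κ * (t - s)) o) (fun y => bo V (u s) o y * u s y) (x j)| ≤ K * (t - s) ^ (-γ))
    (hN : |∑ j, c j * cv (G (τ1 + κ * (t - a))) (u a) (x j)| ≤ N) :
    |∑ j, c j * cv (G τ1) (u t) (x j)| ≤ N + K * (t - a) ^ (1 - γ) / (1 - γ) := by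
  have := mv_two (Φ := fun s => ∑ j, c j * cv (G (τ1 + κ * (t - s))) (u s) (x j)) hat hγ
    (continuousOn_finsetSum _ fun j _ => continuousOn_const.mul ((S.duh_cont ht hτ (x j)).mono (Icc_subset_Icc_left h0)))
    (fun s hs => HasDerivAt.fun_sum fun j _ => (S.duh_deriv (Ioo0_down ht (h0.trans_lt hs.1) hs.2.le) (by
      have := mul_nonneg S.hκ.le (sub_nonneg.2 hs.2.le); linarith) (x j)).const_mul (c j)) hb
  simp only [sub_self, mul_zero, add_zero] at this
  have h2 := abs_sub_abs_le_abs_sub (∑ j, c j * cv (G τ1) (u t) (x j)) (∑ j, c j * cv (G (τ1 + κ * (t - a))) (u a) (x j))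
  linarith

lemma duh (S : Sys V κ T u) {ι : Type} [Fintype ι] {c : ι → ℝ} {x : ι → Spc m} {a t K γ N : ℝ} (ht : t ∈ Ico0 T)
    (h0 : 0 ≤ a) (hat : a ≤ t) (hγ : γ < 1)
    (hb : ∀ s ∈ Ioo a t, ∀ τ, κ * (t - s) ≤ τ → |∑ j, c j * ∑ o, cv (dG τ o) (fun y => bo V (u s) o y * u s y) (x j)| ≤ K * (t - s) ^ (-γ))
    (hN : ∀ τ > 0, κ * (t - a) ≤ τ → |∑ j, c j * cv (G τ) (u a) (x j)| ≤ N) :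
    |∑ j, c j * u t (x j)| ≤ N + K * (t - a) ^ (1 - γ) / (1 - γ) := by
  have hl : Tendsto (fun ε => |∑ j, c j * cv (G ε) (u t) (x j)|) (nhdsWithin 0 (Ioi 0)) (nhds |∑ j, c j * u t (x j)|) :=
    (tendsto_finsetSum _ fun j _ => (cv_approx (S.per ht) (S.cont ht) (x j)).const_mul (c j)).abs
  refine le_of_tendsto hl (eventually_nhdsWithin_of_forall fun ε hε => ?_)
  have hε : 0 < ε := hε
  refine S.duh0 ht h0 hat hγ hε (fun s hs => hb s hs _ (by linarith)) (hN _ ?_ (by linarith))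
  have := mul_nonneg S.hκ.le (sub_nonneg.2 hat); linarith

end Sys

lemma norm_dir {m : ℕ} (o : Option (Fin m)) : ‖dir o‖ ≤ 1 := by
  rcases o with _ | i
  · simp [dir, e1, Prod.norm_def]
  · simp only [dir, eC, Prod.norm_def, norm_zero]
    refine max_le zero_le_one ?_
    rw [pi_norm_le_iff_of_nonneg zero_le_one]
    intro j
    by_cases h : j = i
    · subst h; simp
    · simp [h]

lemma pd_le {m : ℕ} {f : Spc m → ℝ} {C : ℝ} {x : Spc m} (h : ‖fderiv ℝ f x‖ ≤ C) (o : Option (Fin m)) : |pd (dir o) f x| ≤ C :=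
  ((fderiv ℝ f x).le_opNorm _).trans ((mul_le_of_le_one_right (norm_nonneg _) (norm_dir o)).trans h)

lemma lip_C1 {m : ℕ} {f : Spc m → ℝ} (hf : ContDiff ℝ 1 f) (hp : Per f) : ∃ L, 0 ≤ L ∧ ∀ x h, |f (x + h) - f x| ≤ L * ‖h‖ := by
  obtain ⟨C, hC0, hC⟩ := hp.fderiv.bdd (hf.continuous_fderiv (by norm_num))
  refine ⟨C, hC0, fun x h => ?_⟩
  have := convex_univ.norm_image_sub_le_of_norm_fderiv_le (𝕜 := ℝ) (f := f) (C := C)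
    (fun x _ => hf.differentiable (by norm_num) x) (fun x _ => hC x) (mem_univ x) (mem_univ (x + h))
  simpa using this

lemma int_slice {m : ℕ} {f : Spc m → ℝ} (hf : Continuous f) (hp : Per f) (x1 : ℝ) :
    Integrable (fun y => f (x1, y)) (volume.restrict (cube1 m)) := by
  obtain ⟨C, _, hC⟩ := hp.bdd hf
  exact Integrable.mono' (integrable_const C) (hf.comp (by fun_prop : Continuous fun y => (x1, y))).aestronglyMeasurable (ae_of_all _ fun y => hC _)

lemma half_lem {ι : Type} {f : ι → ℝ} {C : ℝ} (hb : ∃ A, ∀ i, f i ≤ A)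
    (h : ∀ A, (∀ i, f i ≤ A) → ∀ i, f i ≤ C + A / 2) (i : ι) : f i ≤ 2 * C := by
  obtain ⟨A, hA⟩ := hb
  have hbd : BddAbove (range f) := ⟨A, by rintro _ ⟨j, rfl⟩; exact hA j⟩
  have hne : (range f).Nonempty := ⟨_, ⟨i, rfl⟩⟩
  have h1 := h (sSup (range f)) fun j => le_csSup hbd ⟨j, rfl⟩
  have h2 : sSup (range f) ≤ C + sSup (range f) / 2 := csSup_le hne (by rintro _ ⟨j, rfl⟩; exact h1 j)
  have := le_csSup hbd ⟨i, rfl⟩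
  linarith

namespace Sys
variable {m : ℕ} {V : Spc m → ℝ} {κ : ℝ} {T : ℝ≥0∞} {u : ℝ → Spc m → ℝ}

lemma dV (S : Sys V κ T u) : ∃ B, 0 ≤ B ∧ (∀ z, ‖fderiv ℝ V z‖ ≤ B) ∧ ∀ o x h, |pd (dir o) V (x + h) - pd (dir o) V x| ≤ B * ‖h‖ := by
  obtain ⟨C, hC0, hC⟩ := S.hVp.fderiv.bdd (S.hV.continuous_fderiv (by norm_num))
  have := fun o => lip_C1 (pd_C1 S.hV (dir o)) (S.hVp.pd (dir o))
  choose L hL0 hL using this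
  refine ⟨C + ∑ o, L o, add_nonneg hC0 (Finset.sum_nonneg fun o _ => hL0 o), fun z => (hC z).trans ?_, fun o x h => (hL o x h).trans ?_⟩
  · linarith [Finset.sum_nonneg fun o (_ : o ∈ Finset.univ) => hL0 o]
  · have := Finset.single_le_sum (fun o _ => hL0 o) (Finset.mem_univ o)
    gcongr; linarith

lemma phi_le (S : Sys V κ T u) {B : ℝ} (hB : ∀ z, ‖fderiv ℝ V z‖ ≤ B) {s : ℝ} (hs : s ∈ Ico0 T) (x1 : ℝ) :
    |∫ y in cube1 m, pd (e1 m) V (x1, y) * u s (x1, y)| ≤ B * marg (u s) x1 := by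
  have hu := int_slice (S.cont hs) (S.per hs) x1
  rw [marg, ← integral_const_mul, ← Real.norm_eq_abs]
  refine norm_integral_le_of_norm_le (hu.const_mul B) (ae_of_all _ fun y => ?_)
  rw [norm_mul, Real.norm_eq_abs, Real.norm_eq_abs, abs_of_nonneg (S.nonneg hs _)]
  exact mul_le_mul_of_nonneg_right (pd_le (hB _) none) (S.nonneg hs _)

lemma bo_le (S : Sys V κ T u) {B : ℝ} (hB : ∀ z, ‖fderiv ℝ V z‖ ≤ B) {s : ℝ} (hs : s ∈ Ico0 T) (o : Option (Fin m)) (z : Spc m) :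
    |bo V (u s) o z| ≤ 2 * B := by
  have h1 : |phiF V (u s) z.1| ≤ B := by
    rw [phiF, abs_div, abs_of_pos (S.pos hs _), div_le_iff₀ (S.pos hs _)]; exact S.phi_le hB hs _
  have h2 := pd_le (hB z) o
  have h3 : |if o = none then phiF V (u s) z.1 else 0| ≤ B := by
    split_ifs
    · exact h1
    · simpa using (norm_nonneg _).trans (hB z)
  rw [bo]; linarith [abs_sub (pd (dir o) V z) (if o = none then phiF V (u s) z.1 else 0)]

lemma sqrt_rpow {a : ℝ} : (√a)⁻¹ = a ^ (-(1/2 : ℝ)) ∨ a < 0 := by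
  rcases lt_or_ge a 0 with h | h
  · exact Or.inr h
  · left; rw [Real.rpow_neg h, Real.sqrt_eq_rpow]

lemma sq_bd {κ t s τ : ℝ} (hκ : 0 < κ) (hts : s < t) (hτ : κ * (t - s) ≤ τ) : (√τ)⁻¹ ≤ (√κ)⁻¹ * (t - s) ^ (-(1/2 : ℝ)) := by
  have h0 : 0 < t - s := sub_pos.2 hts
  have h1 : 0 < κ * (t - s) := mul_pos hκ h0
  rw [← (sqrt_rpow (a := t - s)).resolve_right (by linarith), ← mul_inv, ← Real.sqrt_mul hκ.le]
  gcongr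

/-- choose the time step -/
lemma step_ex (C : ℝ) : ∃ d > 0, C * d ^ (1 - (1/2 : ℝ)) / (1 - 1/2) ≤ 1 / 2 := by
  have h : Tendsto (fun d : ℝ => C * d ^ (1 - (1/2 : ℝ)) / (1 - 1/2)) (nhdsWithin 0 (Ioi 0)) (nhds 0) := by
    have h1 : ContinuousAt (fun d : ℝ => C * d ^ (1 - (1/2 : ℝ)) / (1 - 1/2)) 0 :=
      ((Real.continuousAt_rpow_const 0 _ (Or.inr (by norm_num))).const_mul C).div_const _
    have h2 := h1.tendsto.mono_left (nhdsWithin_le_nhds (s := Ioi 0))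
    rwa [Real.zero_rpow (show (1 - (1/2:ℝ)) ≠ 0 by norm_num), mul_zero, zero_div] at h2
  obtain ⟨d, h1, h2⟩ := ((h.eventually (gt_mem_nhds (show (0:ℝ) < 1/2 by norm_num))).and self_mem_nhdsWithin).exists
  exact ⟨d, h2, h1.le⟩

lemma cv_nonneg (S : Sys V κ T u) {s : ℝ} (hs : s ∈ Ico0 T) (τ : ℝ) (x : Spc m) : 0 ≤ cv (G τ) (u s) x :=
  integral_nonneg fun _ => mul_nonneg (G_nonneg _ _) (S.nonneg hs _)

lemma cv_mass (S : Sys V κ T u) {s τ ε : ℝ} (hs : s ∈ Ico0 T) (hε : 0 < ε) (hτ : ε ≤ τ) (x : Spc m) : |cv (G τ) (u s) x| ≤ Kc m ε := by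
  have h := (dom_G (hε.trans_le hτ)).L1 (S.pI hs) x
  simp only [abs_of_nonneg (S.nonneg hs _), S.mass hs, one_mul, mul_one] at h
  exact h.trans (Kc_anti hε hτ)

lemma sup_bd (S : Sys V κ T u) : ∃ M, 0 < M ∧ ∀ t ∈ Ico0 T, ∀ x, |u t x| ≤ M := by
  obtain ⟨B, hB0, hB, _⟩ := S.dV
  obtain ⟨M0, hM0, hM⟩ := S.per0.bdd S.c0.continuous
  set K := (m + 1) * (2 * B * cG m * (√κ)⁻¹) with hK
  obtain ⟨d, hd0, hd⟩ := step_ex K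
  have hκ := S.hκ
  set C := M0 + Kc m (κ * d) with hC
  have hKc := Kc_pos m (κ * d)
  have hC0 : 0 < C := by positivity
  have hcG := cG_pos m
  have hK0 : 0 ≤ K := by positivity
  have key : ∀ ε > 0, ∀ t ∈ Ico0 T, ∀ τ, ε ≤ τ → ∀ x, cv (G τ) (u t) x ≤ 2 * C := fun ε hε t ht τ hτ x => by
    refine half_lem (ι := {q : ℝ × ℝ × Spc m // q.1 ∈ Ico0 T ∧ ε ≤ q.2.1}) (f := fun q => cv (G q.1.2.1) (u q.1.1) q.1.2.2) (C := C) ?_ ?_ ⟨(t, τ, x), ht, hτ⟩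
    · exact ⟨Kc m ε, fun q => (le_abs_self _).trans (S.cv_mass q.2.1 hε q.2.2 _)⟩
    · rintro A hA ⟨⟨t, τ1, x⟩, ht, hτ⟩
      simp only at ht hτ ⊢
      have hA0 : 0 ≤ A := (S.cv_nonneg ht τ1 x).trans (hA ⟨⟨t, τ1, x⟩, ht, hτ⟩)
      have hτ1 : 0 < τ1 := hε.trans_le hτ
      have hat : max (t - d) 0 ≤ t := max_le (by linarith) ht.1
      have main := S.duh0 (ι := Unit) (c := fun _ => 1) (x := fun _ => x) (τ1 := τ1) (a := max (t - d) 0) (K := K * A) (γ := 1/2) (N := C) ht (le_max_right _ _) hat (by norm_num) hτ1 ?_ ?_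
      · simp only [Finset.univ_unique, Finset.sum_singleton, one_mul] at main
        refine (le_abs_self _).trans (main.trans ?_)
        have h1 : (t - max (t - d) 0) ^ (1 - (1/2:ℝ)) ≤ d ^ (1 - (1/2:ℝ)) :=
          Real.rpow_le_rpow (by linarith) (by linarith [le_max_left (t - d) 0]) (by norm_num)
        have h2 : K * A * (t - max (t - d) 0) ^ (1 - (1/2:ℝ)) / (1 - 1/2) ≤ A * (K * d ^ (1 - (1/2:ℝ)) / (1 - 1/2)) := by
          rw [mul_comm K A, mul_assoc, mul_div_assoc]; gcongr
        have h3 := mul_le_mul_of_nonneg_left hd hA0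
        linarith
      · intro s hs
        have hs0 : 0 < s := (le_max_right _ _).trans_lt hs.1
        have hsT := Ioo0_down ht hs0 hs.2.le
        have hsT' := Ioo0_sub hsT
        have hts : 0 < t - s := sub_pos.2 hs.2
        have hp := mul_pos hκ hts
        set τ := τ1 + κ * (t - s) with hτd
        have hτp : 0 < τ := by linarith
        simp only [Finset.univ_unique, Finset.sum_singleton, one_mul]
        refine (Finset.abs_sum_le_sum_abs _ _).trans ?_
        have hone : ∀ o, |cv (dG τ o) (fun y => bo V (u s) o y * u s y) x| ≤ 2 * B * cG m * (√κ)⁻¹ * A * (t - s) ^ (-(1/2:ℝ)) := fun o => by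
          have hdom := dom_dG (m := m) hτp o
          have hI := ((dom_G (m := m) (show 0 < 2 * τ by linarith)).int (S.pI hsT') x).const_mul (2 * B * (cG m * (√τ)⁻¹))
          have h1 : |cv (dG τ o) (fun y => bo V (u s) o y * u s y) x| ≤ ∫ y, 2 * B * (cG m * (√τ)⁻¹) * (G (2 * τ) (x - y) * u s y) := by
            rw [cv, ← Real.norm_eq_abs]
            refine norm_integral_le_of_norm_le hI (ae_of_all _ fun y => ?_)
            rw [norm_mul, norm_mul, Real.norm_eq_abs, Real.norm_eq_abs, Real.norm_eq_abs, abs_of_nonneg (S.nonneg hsT' y)]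
            have h2 := hdom.le (x - y)
            have h3 := S.bo_le hB hsT' o y
            have h4 := S.nonneg hsT' y
            have h5 := (abs_nonneg _).trans h2
            calc |dG τ o (x - y)| * (|bo V (u s) o y| * u s y) ≤ (cG m * (√τ)⁻¹ * G (2 * τ) (x - y)) * ((2 * B) * u s y) := by gcongr
              _ = _ := by ring
          rw [integral_const_mul] at h1
          have h2 : cv (G (2 * τ)) (u s) x ≤ A := hA ⟨(s, 2 * τ, x), hsT', by simp only; linarith⟩
          have h3 := sq_bd hκ hs.2 (show κ * (t - s) ≤ τ by linarith)
          have h5 := S.cv_nonneg hsT' (2 * τ) x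
          refine h1.trans ?_
          calc 2 * B * (cG m * (√τ)⁻¹) * cv (G (2 * τ)) (u s) x ≤ 2 * B * (cG m * ((√κ)⁻¹ * (t - s) ^ (-(1/2:ℝ)))) * A := by gcongr
            _ = _ := by ring
        refine (Finset.sum_le_sum fun o _ => hone o).trans (le_of_eq ?_)
        simp [hK]; ring
      · simp only [Finset.univ_unique, Finset.sum_singleton, one_mul]
        rcases le_total (t - d) 0 with h | h
        · rw [max_eq_right h]
          have hp : 0 < τ1 + κ * (t - 0) := by have := mul_nonneg hκ.le ht.1; simp only [sub_zero]; linarith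
          have := cv_sup (dom_G hp).ker.1 (dom_G hp).ker.2 hM0 hM x
          linarith
        · rw [max_eq_left h]
          have := S.cv_mass (Ico0_down ht h (by linarith)) (mul_pos hκ hd0) (show κ * d ≤ τ1 + κ * (t - (t - d)) by linarith [show κ * (t - (t - d)) = κ * d by ring]) x
          linarith
  refine ⟨2 * C, by linarith, fun t ht x => ?_⟩
  rw [abs_of_nonneg (S.nonneg ht x)]
  refine le_of_tendsto (cv_approx (S.per ht) (S.cont ht) x) (eventually_nhdsWithin_of_forall fun ε hε => key ε hε t ht ε le_rfl x)

end Sys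

lemma quot_diff {N N' p p' c B D A : ℝ} (hc : 0 < c) (hp : c ≤ p) (hp' : c ≤ p') (hN : |N| ≤ B * p)
    (h1 : |N' - N| ≤ D) (h2 : |p' - p| ≤ A) : |N' / p' - N / p| ≤ (D + B * A) / c := by
  have hp0 : 0 < p := hc.trans_le hp
  have hp0' : 0 < p' := hc.trans_le hp'
  have e : N' / p' - N / p = ((N' - N) - N / p * (p' - p)) / p' := by field_simp; ring
  have h3 : |N / p| ≤ B := by rw [abs_div, abs_of_pos hp0, div_le_iff₀ hp0]; exact hN
  rw [e, abs_div, abs_of_pos hp0']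
  have h4 : |(N' - N) - N / p * (p' - p)| ≤ D + B * A := by
    refine (abs_sub _ _).trans (add_le_add h1 ?_)
    rw [abs_mul]
    exact mul_le_mul h3 h2 (abs_nonneg _) ((abs_nonneg _).trans h3)
  have h5 : 0 ≤ D + B * A := (abs_nonneg _).trans h4
  gcongr

lemma prod_diff {a a' b b' D M A B : ℝ} (h1 : |a' - a| ≤ D) (h2 : |b'| ≤ M) (h3 : |a| ≤ B) (h4 : |b' - b| ≤ A) :
    |a' * b' - a * b| ≤ D * M + B * A := by
  rw [show a' * b' - a * b = (a' - a) * b' + a * (b' - b) by ring]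
  refine (abs_add_le _ _).trans ?_
  rw [abs_mul, abs_mul]
  exact add_le_add (mul_le_mul h1 h2 (abs_nonneg _) ((abs_nonneg _).trans h1)) (mul_le_mul h3 h4 (abs_nonneg _) ((abs_nonneg _).trans h3))

lemma slice_diff {m : ℕ} {f : Spc m → ℝ} (hf : Continuous f) (hp : Per f) {A : ℝ} {x1 h1 : ℝ}
    (h : ∀ y, |f (x1 + h1, y) - f (x1, y)| ≤ A) :
    |(∫ y in cube1 m, f (x1 + h1, y)) - ∫ y in cube1 m, f (x1, y)| ≤ A := by
  rw [← integral_sub (int_slice hf hp _) (int_slice hf hp _), ← Real.norm_eq_abs]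
  refine (norm_integral_le_of_norm_le (integrable_const A) (ae_of_all _ h)).trans ?_
  simp

namespace Sys
variable {m : ℕ} {V : Spc m → ℝ} {κ : ℝ} {T : ℝ≥0∞} {u : ℝ → Spc m → ℝ}

lemma bu_diff (S : Sys V κ T u) : ∃ C, 0 < C ∧ ∀ s ∈ Ico0 T, ∀ r A, 0 ≤ r → (∀ x h, ‖h‖ ≤ r → |u s (x + h) - u s x| ≤ A) →
    ∀ o x h, ‖h‖ ≤ r → |bo V (u s) o (x + h) * u s (x + h) - bo V (u s) o x * u s x| ≤ C * (r + A) := by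
  obtain ⟨B, hB0, hB, hBL⟩ := S.dV
  obtain ⟨M, hM0, hM⟩ := S.sup_bd
  obtain ⟨c, hc0, hc⟩ := S.marg_lb
  refine ⟨(B + (B * M + 2 * B) / c) * M + 2 * B + 1, by positivity, fun s hs r A hr hA o x h hh => ?_⟩
  have hA0 : 0 ≤ A := (abs_nonneg _).trans (hA 0 0 (by simpa using hr))
  have hV1 : ∀ o x h, ‖h‖ ≤ r → |pd (dir o) V (x + h) - pd (dir o) V x| ≤ B * r := fun o x h hh =>
    (hBL o x h).trans (mul_le_mul_of_nonneg_left hh hB0)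
  have hh1 : ‖((h.1, 0) : Spc m)‖ ≤ r := by
    rw [Prod.norm_def]; simp only [norm_zero]
    exact max_le ((norm_fst_le h).trans hh) hr
  have hcu := S.cont hs
  have hcV := (pd_C1 S.hV (e1 m)).continuous
  have e : ∀ y, ((x.1 + h.1, y) : Spc m) = (x.1, y) + (h.1, 0) := fun y => by simp
  have hphi : |phiF V (u s) (x + h).1 - phiF V (u s) x.1| ≤ (B * r * M + B * A + B * A) / c := by
    refine quot_diff hc0 (hc s hs _) (hc s hs _) (S.phi_le hB hs _) ?_ ?_
    · refine slice_diff (f := fun z => pd (e1 m) V z * u s z) (hcV.mul hcu) ((S.hVp.pd _).mul (S.per hs)) fun y => ?_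
      rw [e]
      exact prod_diff (hV1 none _ _ hh1) (hM s hs _) (pd_le (hB _) none) (hA _ _ hh1)
    · refine slice_diff hcu (S.per hs) fun y => ?_
      rw [e]; exact hA _ _ hh1
  have hphi0 : 0 ≤ (B * r * M + B * A + B * A) / c := (abs_nonneg _).trans hphi
  have hbo : |bo V (u s) o (x + h) - bo V (u s) o x| ≤ B * r + (B * r * M + B * A + B * A) / c := by
    have e2 : bo V (u s) o (x + h) - bo V (u s) o x = (pd (dir o) V (x + h) - pd (dir o) V x) -
        (if o = none then phiF V (u s) (x + h).1 - phiF V (u s) x.1 else 0) := by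
      simp only [bo]; split_ifs <;> ring
    rw [e2]
    refine (abs_sub _ _).trans (add_le_add (hV1 o x h hh) ?_)
    split_ifs
    · exact hphi
    · simpa using hphi0
  refine (prod_diff hbo (hM s hs _) (S.bo_le hB hs o x) (hA x h hh)).trans ?_
  have e3 : (B * r + (B * r * M + B * A + B * A) / c) * M + 2 * B * A = (B + B * M / c) * M * r + (2 * B / c * M + 2 * B) * A := by
    field_simp; ring
  have h1 : 0 ≤ B * M / c := by positivity
  have h2 : 0 ≤ 2 * B / c := by positivity
  rw [e3, add_div]
  nlinarith [mul_nonneg (mul_nonneg h2 hM0.le) hr, mul_nonneg hB0 hr, mul_nonneg (mul_nonneg hB0 hM0.le) hA0, mul_nonneg (mul_nonneg h1 hM0.le) hA0]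

lemma lip_bd (S : Sys V κ T u) : ∃ L, 0 < L ∧ ∀ t ∈ Ico0 T, ∀ x h, |u t (x + h) - u t x| ≤ L * ‖h‖ := by
  obtain ⟨M, hM0, hM⟩ := S.sup_bd
  obtain ⟨C1, hC10, hC1⟩ := S.bu_diff
  obtain ⟨L0, hL00, hL0⟩ := lip_C1 S.c0 S.per0
  have hκ := S.hκ
  have hcG := cG_pos m
  set K := (m + 1) * (cG m * (√κ)⁻¹ * C1) with hK
  have hK0 : 0 ≤ K := by positivity
  obtain ⟨d, hd0, hd⟩ := step_ex K
  set C := L0 + (m + 1) * (cG m * (√(κ * d))⁻¹) * M + 1 with hC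
  have hC0 : 0 < C := by positivity
  have key : ∀ r, 0 ≤ r → ∀ t ∈ Ico0 T, ∀ x h, ‖h‖ ≤ r → |u t (x + h) - u t x| ≤ 2 * (C * r) := fun r hr t ht x h hh => by
    refine half_lem (ι := {q : ℝ × Spc m × Spc m // q.1 ∈ Ico0 T ∧ ‖q.2.2‖ ≤ r}) (f := fun q => |u q.1.1 (q.1.2.1 + q.1.2.2) - u q.1.1 q.1.2.1|) (C := C * r) ?_ ?_ ⟨(t, x, h), ht, hh⟩
    · exact ⟨M + M, fun q => (abs_sub _ _).trans (add_le_add (hM _ q.2.1 _) (hM _ q.2.1 _))⟩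
    · rintro A hA ⟨⟨t, x, h⟩, ht, hh⟩
      simp only at ht hh ⊢
      have hA0 : 0 ≤ A := (abs_nonneg _).trans (hA ⟨⟨t, x, h⟩, ht, hh⟩)
      have hat : max (t - d) 0 ≤ t := max_le (by linarith) ht.1
      have main := S.duh (ι := Fin 2) (c := ![1, -1]) (x := ![x + h, x]) (a := max (t - d) 0) (K := K * (r + A)) (γ := 1/2) (N := (C - 1) * r) ht (le_max_right _ _) hat (by norm_num) ?_ ?_
      · simp only [Fin.sum_univ_two, Matrix.cons_val_zero, Matrix.cons_val_one, one_mul, neg_one_mul, ← sub_eq_add_neg] at main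
        refine main.trans ?_
        have h1 : (t - max (t - d) 0) ^ (1 - (1/2:ℝ)) ≤ d ^ (1 - (1/2:ℝ)) :=
          Real.rpow_le_rpow (by linarith) (by linarith [le_max_left (t - d) 0]) (by norm_num)
        have h2 : K * (r + A) * (t - max (t - d) 0) ^ (1 - (1/2:ℝ)) / (1 - 1/2) ≤ (r + A) * (K * d ^ (1 - (1/2:ℝ)) / (1 - 1/2)) := by
          rw [mul_comm K, mul_assoc, mul_div_assoc]; gcongr
        have h3 := mul_le_mul_of_nonneg_left hd (add_nonneg hr hA0)
        nlinarith
      · intro s hs τ hτ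
        have hs0 : 0 < s := (le_max_right _ _).trans_lt hs.1
        have hsT := Ioo0_down ht hs0 hs.2.le
        have hsT' := Ioo0_sub hsT
        have hts : 0 < t - s := sub_pos.2 hs.2
        have hp := mul_pos hκ hts
        have hτp : 0 < τ := by linarith
        simp only [Fin.sum_univ_two, Matrix.cons_val_zero, Matrix.cons_val_one, one_mul, neg_one_mul, ← sub_eq_add_neg]
        rw [← Finset.sum_sub_distrib]
        refine (Finset.abs_sum_le_sum_abs _ _).trans ?_
        have hone : ∀ o, |cv (dG τ o) (fun y => bo V (u s) o y * u s y) (x + h) - cv (dG τ o) (fun y => bo V (u s) o y * u s y) x| ≤ cG m * (√κ)⁻¹ * C1 * (r + A) * (t - s) ^ (-(1/2:ℝ)) := fun o => by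
          have hdom := dom_dG (m := m) hτp o
          have hsh : PI fun y => bo V (u s) o (y + h) * u s (y + h) :=
            PI.of_cont (fun z k => by
              have := S.bu_per hsT o (z + h) k
              simpa only [add_right_comm] using this) ((S.bu_c hsT o).comp (by fun_prop : Continuous fun y : Spc m => y + h))
          rw [cv_shift, ← cv_sub hdom hsh (S.bu_PI hsT o)]
          have h1 := cv_sup hdom.ker.1 hdom.ker.2 (by positivity) (hC1 s hsT' r A hr (fun x h hh => hA ⟨(s, x, h), hsT', hh⟩) o · h hh) x
          refine h1.trans ?_
          have h3 := sq_bd hκ hs.2 hτ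
          calc cG m * (√τ)⁻¹ * (C1 * (r + A)) ≤ cG m * ((√κ)⁻¹ * (t - s) ^ (-(1/2:ℝ))) * (C1 * (r + A)) := by gcongr
            _ = _ := by ring
        refine (Finset.sum_le_sum fun o _ => hone o).trans (le_of_eq ?_)
        simp [hK]; ring
      · intro τ hτ0 hτ
        simp only [Fin.sum_univ_two, Matrix.cons_val_zero, Matrix.cons_val_one, one_mul, neg_one_mul, ← sub_eq_add_neg]
        have hdom := dom_G (m := m) hτ0
        rcases le_total (t - d) 0 with h' | h'
        · rw [max_eq_right h']
          have hsh : PI fun y => u 0 (y + h) :=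
            PI.of_cont (fun z k => by
              have := S.per0 (z + h) k
              simpa only [add_right_comm] using this) (S.c0.continuous.comp (by fun_prop : Continuous fun y : Spc m => y + h))
          rw [cv_shift, ← cv_sub hdom hsh (PI.of_cont S.per0 S.c0.continuous)]
          have h1 := cv_sup hdom.ker.1 hdom.ker.2 (show 0 ≤ L0 * r by positivity) (fun y => (hL0 y h).trans (mul_le_mul_of_nonneg_left hh hL00)) x
          have h2 : 0 ≤ (m + 1) * (cG m * (√(κ * d))⁻¹) * M * r := by positivity
          refine h1.trans ?_
          rw [hC]; nlinarith
        · rw [max_eq_left h'] at hτ ⊢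
          have haT := Ico0_down ht h' (by linarith)
          have hτd : κ * d ≤ τ := by rw [show κ * d = κ * (t - (t - d)) by ring]; exact hτ
          have hk := ker_diff (integrable_G hτ0) (fun o => dom_dG (m := m) hτ0 o) (hasF_G τ) h
          have hI : cv (G τ) (u (t - d)) (x + h) - cv (G τ) (u (t - d)) x = cv (fun z => G τ (z + h) - G τ z) (u (t - d)) x := by
            rw [cv_shift']
            simp only [cv, sub_mul]
            rw [integral_sub _ (hdom.int (S.pI haT) x)]
            have h1 := hdom.int (S.pI haT) (x + h)
            refine h1.congr (ae_of_all _ fun y => ?_)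
            simp only [show x + h - y = x - y + h by abel]
          rw [hI]
          have h1 := cv_sup hk.1 hk.2 hM0.le (hM _ haT) x
          refine h1.trans ?_
          have h3 : (√τ)⁻¹ ≤ (√(κ * d))⁻¹ := by have := mul_pos hκ hd0; gcongr
          calc (m + 1) * (cG m * (√τ)⁻¹) * ‖h‖ * M ≤ (m + 1) * (cG m * (√(κ * d))⁻¹) * r * M := by gcongr
            _ ≤ _ := by rw [hC]; nlinarith [mul_nonneg hL00 hr]
  refine ⟨2 * C, by linarith, fun t ht x h => (key ‖h‖ (norm_nonneg h) t ht x h le_rfl).trans (le_of_eq (by ring))⟩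

end Sys

lemma norm_clm_dir {m : ℕ} (L : Spc m →L[ℝ] ℝ) {A : ℝ} (h : ∀ o, |L (dir o)| ≤ A) : ‖L‖ ≤ (m + 1) * A := by
  have hA : 0 ≤ A := (abs_nonneg _).trans (h none)
  refine L.opNorm_le_bound (by positivity) fun z => ?_
  rw [clm_dir L z]
  refine (Finset.abs_sum_le_sum_abs _ _).trans ?_
  refine (Finset.sum_le_sum (g := fun _ => ‖z‖ * A) fun o _ => ?_).trans (le_of_eq ?_)
  · rw [abs_mul]; exact mul_le_mul (co_le o z) (h o) (abs_nonneg _) (norm_nonneg _)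
  · simp; ring

lemma PI.shift {m : ℕ} {f : Spc m → ℝ} (hf : Per f) (hc : Continuous f) (h : Spc m) : PI fun y => f (y + h) :=
  PI.of_cont (fun z k => by
    have := hf (z + h) k
    simpa only [add_right_comm] using this) (hc.comp (by fun_prop : Continuous fun y : Spc m => y + h))

lemma cv_kdiff {m : ℕ} {k f : Spc m → ℝ} {C τ : ℝ} (hk : Dom k C τ) (hf : PI f) (x h : Spc m) :
    cv k f (x + h) - cv k f x = cv (fun z => k (z + h) - k z) f x := by
  rw [cv_shift']
  simp only [cv, sub_mul]
  rw [integral_sub _ (hk.int hf x)]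
  refine (hk.int hf (x + h)).congr (ae_of_all _ fun y => ?_)
  simp only [show x + h - y = x - y + h by abel]

lemma cv_dd {m : ℕ} {k f : Spc m → ℝ} {C τ : ℝ} (hk : Dom k C τ) (hf : Per f) (hc : Continuous f) (x h e : Spc m) :
    cv k f (x + h + e) - cv k f (x + h) - (cv k f (x + e) - cv k f x) = cv (fun z => k (z + h) - k z) (fun y => f (y + e) - f y) x := by
  have h1 := PI.shift hf hc e
  have h0 := PI.of_cont hf hc
  rw [← cv_kdiff hk (h1.sub h0), cv_sub hk h1 h0, cv_sub hk h1 h0, cv_shift k f (x + h) e, cv_shift k f x e]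

lemma cv_dd2 {m : ℕ} {k f : Spc m → ℝ} {C τ : ℝ} (hk : Dom k C τ) (hf : Per f) (hc : Continuous f) (x h e : Spc m) :
    cv k f (x + h + e) - cv k f (x + h) - (cv k f (x + e) - cv k f x) = cv k (fun y => f (y + h + e) - f (y + h) - (f (y + e) - f y)) x := by
  have h0 := PI.of_cont hf hc
  have h1 := PI.shift hf hc e
  have h2 := PI.shift hf hc h
  have h3 := PI.shift hf hc (h + e)
  simp only [← add_assoc] at h3
  rw [cv_sub hk (h3.sub h2) (h1.sub h0), cv_sub hk h3 h2, cv_sub hk h1 h0, cv_shift k f x e, cv_shift k f x h, add_assoc, cv_shift k f x (h + e)]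
  simp only [add_assoc]

lemma interp {X P τ r α : ℝ} (hX : 0 ≤ X) (hτ : 0 < τ) (hr : 0 ≤ r) (hP : 0 < P) (h0 : 0 < α) (h1 : α < 1)
    (ha : X ≤ P * (√τ)⁻¹) (hb : X ≤ P * τ⁻¹ * r) : X ≤ P * r ^ α * τ ^ (-((1 + α) / 2)) := by
  have e : X = X ^ (1 - α) * X ^ α := by
    rcases hX.eq_or_lt with h | h
    · rw [← h, Real.zero_rpow h0.ne', mul_zero]
    · rw [← Real.rpow_add h]; simp
  have h2 : X ^ (1 - α) ≤ (P * (√τ)⁻¹) ^ (1 - α) := Real.rpow_le_rpow hX ha (by linarith)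
  have h3 : X ^ α ≤ (P * τ⁻¹ * r) ^ α := Real.rpow_le_rpow hX hb h0.le
  rw [e]
  refine (mul_le_mul h2 h3 (by positivity) (by positivity)).trans (le_of_eq ?_)
  rw [Sys.sqrt_rpow.resolve_right (by linarith), ← Real.rpow_neg_one τ, Real.mul_rpow hP.le (by positivity), Real.mul_rpow (by positivity) hr,
    Real.mul_rpow hP.le (by positivity), ← Real.rpow_mul hτ.le, ← Real.rpow_mul hτ.le]
  have e1 : P ^ (1 - α) * P ^ α = P := by rw [← Real.rpow_add hP]; simp
  have e2 : τ ^ (-(1/2) * (1 - α)) * τ ^ (-1 * α) = τ ^ (-((1 + α) / 2)) := by rw [← Real.rpow_add hτ]; congr 1; ring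
  rw [← e2]; nth_rw 3 [← e1]; ring

namespace Sys
variable {m : ℕ} {V : Spc m → ℝ} {κ : ℝ} {T : ℝ≥0∞} {u : ℝ → Spc m → ℝ}

lemma dd_bd (S : Sys V κ T u) {α : ℝ} (h0 : 0 < α) (h1 : α < 1) : ∃ K, 0 < K ∧ ∀ t ∈ Ico0 T, ∀ a, 0 ≤ a → a ≤ t → ∀ N x h o η, 0 < η →
    (∀ τ > 0, κ * (t - a) ≤ τ → |cv (G τ) (u a) (x + h + η • dir o) - cv (G τ) (u a) (x + h) - (cv (G τ) (u a) (x + η • dir o) - cv (G τ) (u a) x)| ≤ N * η) →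
    |u t (x + h + η • dir o) - u t (x + h) - (u t (x + η • dir o) - u t x)| ≤ (N + K * ‖h‖ ^ α * (t - a) ^ (1 - (1 + α) / 2)) * η := by
  obtain ⟨C1, hC10, hC1⟩ := S.bu_diff
  obtain ⟨L, hL0, hL⟩ := S.lip_bd
  have hκ := S.hκ
  have hcG := cG_pos m
  set P := 2 * (m + 1) * cG m with hP
  have hP0 : 0 < P := by positivity
  set γ := (1 + α) / 2 with hγ
  have hγ1 : γ < 1 := by linarith
  have hg : 0 < 1 - γ := by linarith
  set K := (m + 1) * (P * κ ^ (-γ) * (C1 * (1 + L))) with hK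
  have hK0 : 0 < K := by positivity
  refine ⟨K / (1 - γ), by positivity, fun t ht a ha0 hat N x h o η hη hN => ?_⟩
  have sm : ∀ f : Spc m → ℝ, ∑ j : Fin 4, (![1, -1, -1, 1] : Fin 4 → ℝ) j * f ((![x + h + η • dir o, x + h, x + η • dir o, x] : Fin 4 → Spc m) j)
      = f (x + h + η • dir o) - f (x + h) - (f (x + η • dir o) - f x) := fun f => by
    simp [Fin.sum_univ_four]; ring
  have hηd : ‖η • dir (m := m) o‖ ≤ η := by
    rw [norm_smul, Real.norm_eq_abs, abs_of_pos hη]; exact mul_le_of_le_one_right hη.le (norm_dir o)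
  have main := S.duh (ι := Fin 4) (c := ![1, -1, -1, 1]) (x := ![x + h + η • dir o, x + h, x + η • dir o, x]) (a := a) (K := K * ‖h‖ ^ α * η) (γ := γ) (N := N * η) ht ha0 hat hγ1 ?_ ?_
  · rw [sm] at main
    refine main.trans (le_of_eq ?_)
    field_simp
  · intro s hs τ hτ
    have hs0 : 0 < s := ha0.trans_lt hs.1
    have hsT := Ioo0_down ht hs0 hs.2.le
    have hsT' := Ioo0_sub hsT
    have hts : 0 < t - s := sub_pos.2 hs.2
    have hp := mul_pos hκ hts
    have hτp : 0 < τ := by linarith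
    rw [sm fun x => ∑ o, cv (dG τ o) (fun y => bo V (u s) o y * u s y) x]
    simp only [← Finset.sum_sub_distrib]
    refine (Finset.abs_sum_le_sum_abs _ _).trans ?_
    refine (Finset.sum_le_sum (g := fun _ => (P * κ ^ (-γ) * (C1 * (1 + L))) * ‖h‖ ^ α * η * (t - s) ^ (-γ)) fun o' _ => ?_).trans (le_of_eq ?_)
    · have hdom := dom_dG (m := m) hτp o'
      rw [cv_dd hdom (S.bu_per hsT o') (S.bu_c hsT o')]
      have hk := ker_diff hdom.ker.1 (fun o => dom_ddG (m := m) hτp o' o) (hasF_dG τ o') h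
      have hk2 : ∫ z, |dG τ o' (z + h) - dG τ o' z| ≤ P * ‖h‖ ^ α * τ ^ (-γ) := by
        refine interp (integral_nonneg fun _ => abs_nonneg _) hτp (norm_nonneg h) hP0 h0 h1 ?_ ?_
        · have i1 := hdom.ker.1.abs
          have i2 := i1.comp_add_right h
          have : ∫ z, |dG τ o' (z + h) - dG τ o' z| ≤ ∫ z, (|dG τ o' (z + h)| + |dG τ o' z|) :=
            integral_mono hk.1.abs (i2.add i1) fun z => abs_sub _ _
          rw [integral_add i2 i1, integral_add_right_eq_self (fun z => |dG τ o' z|) h] at this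
          have h3 := hdom.ker.2
          have h4 : 0 ≤ cG m * (√τ)⁻¹ := by positivity
          have h5 : P * (√τ)⁻¹ = 2 * (cG m * (√τ)⁻¹) + 2 * m * (cG m * (√τ)⁻¹) := by rw [hP]; ring
          have h6 : 0 ≤ 2 * m * (cG m * (√τ)⁻¹) := by positivity
          linarith
        · refine hk.2.trans ?_
          have : 0 ≤ (m + 1) * (cG m * τ⁻¹) * ‖h‖ := by positivity
          rw [hP]; nlinarith
      have hτγ : τ ^ (-γ) ≤ κ ^ (-γ) * (t - s) ^ (-γ) := by
        rw [← Real.mul_rpow hκ.le hts.le]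
        exact Real.rpow_le_rpow_of_nonpos hp hτ (by linarith)
      have h2 := cv_sup hk.1 hk2 (show 0 ≤ C1 * (η + L * η) by positivity) (fun y => hC1 s hsT' η (L * η) hη.le
        (fun x h hh => (hL s hsT' x h).trans (mul_le_mul_of_nonneg_left hh hL0.le)) o' y (η • dir o) hηd) x
      refine h2.trans ?_
      calc P * ‖h‖ ^ α * τ ^ (-γ) * (C1 * (η + L * η)) ≤ P * ‖h‖ ^ α * (κ ^ (-γ) * (t - s) ^ (-γ)) * (C1 * (η + L * η)) := by gcongr
        _ = _ := by ring
    · simp [hK]; ring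
  · intro τ hτ0 hτ
    rw [sm fun x => cv (G τ) (u a) x]
    exact hN τ hτ0 hτ

lemma pd_lim (S : Sys V κ T u) {t : ℝ} (ht : t ∈ Ico0 T) {x h : Spc m} {o : Option (Fin m)} {A : ℝ}
    (hb : ∀ η > 0, |u t (x + h + η • dir o) - u t (x + h) - (u t (x + η • dir o) - u t x)| ≤ A * η) :
    |(grd (u t) (x + h) - grd (u t) x) (dir o)| ≤ A := by
  have hd := fun z => ((S.c1 ht).differentiable (by norm_num) z).hasFDerivAt.hasLineDerivAt (dir o)
  have h1 := ((hd (x + h)).tendsto_slope_zero_right.sub (hd x).tendsto_slope_zero_right).abs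
  refine le_of_tendsto h1 (eventually_nhdsWithin_of_forall fun η hη => ?_)
  have hη : 0 < η := hη
  simp only [smul_eq_mul]
  rw [← mul_sub, abs_mul, abs_of_pos (inv_pos.2 hη), inv_mul_eq_div, div_le_iff₀ hη]
  exact hb η hη

lemma grad_hol (S : Sys V κ T u) {α δ : ℝ} (h0 : 0 < α) (h1 : α < 1) (hδ : 0 < δ) : ∃ C, 0 < C ∧ ∀ t ∈ Ico0 T, δ ≤ t → ∀ x h,
    ‖grd (u t) (x + h) - grd (u t) x‖ ≤ C * (‖h‖ + ‖h‖ ^ α) := by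
  obtain ⟨K, hK0, hK⟩ := S.dd_bd h0 h1
  obtain ⟨L, hL0, hL⟩ := S.lip_bd
  have hκ := S.hκ
  have hcG := cG_pos m
  set A := (m + 1) * (cG m * (√(κ * δ))⁻¹) * L with hA
  set E := K * δ ^ (1 - (1 + α) / 2) with hE
  have hA0 : 0 < A := by positivity
  have hE0 : 0 < E := by positivity
  refine ⟨(m + 1) * (A + E), by positivity, fun t ht hδt x h => ?_⟩
  have haT := Ico0_down ht (show 0 ≤ t - δ by linarith) (by linarith)
  rw [mul_assoc]
  refine norm_clm_dir _ fun o => S.pd_lim ht fun η hη => ?_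
  have hηd : ‖η • dir (m := m) o‖ ≤ η := by
    rw [norm_smul, Real.norm_eq_abs, abs_of_pos hη]; exact mul_le_of_le_one_right hη.le (norm_dir o)
  refine (hK t ht (t - δ) (by linarith) (by linarith) (A * ‖h‖) x h o η hη fun τ hτ0 hτ => ?_).trans ?_
  · have hdom := dom_G (m := m) hτ0
    rw [cv_dd hdom (S.per haT) (S.cont haT)]
    have hk := ker_diff (integrable_G hτ0) (fun o => dom_dG (m := m) hτ0 o) (hasF_G τ) h
    have h2 := cv_sup hk.1 hk.2 (show 0 ≤ L * η by positivity) (fun y => (hL _ haT y (η • dir o)).trans (mul_le_mul_of_nonneg_left hηd hL0.le)) x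
    refine h2.trans ?_
    have hτd : κ * δ ≤ τ := by rw [show κ * δ = κ * (t - (t - δ)) by ring]; exact hτ
    have h3 : (√τ)⁻¹ ≤ (√(κ * δ))⁻¹ := by have := mul_pos hκ hδ; gcongr
    calc (m + 1) * (cG m * (√τ)⁻¹) * ‖h‖ * (L * η) ≤ (m + 1) * (cG m * (√(κ * δ))⁻¹) * ‖h‖ * (L * η) := by gcongr
      _ = _ := by rw [hA]; ring
  · refine mul_le_mul_of_nonneg_right ?_ hη.le
    rw [show t - (t - δ) = δ by ring]
    have e : K * ‖h‖ ^ α * δ ^ (1 - (1 + α) / 2) = E * ‖h‖ ^ α := by rw [hE]; ring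
    have h3 : 0 ≤ ‖h‖ ^ α := by positivity
    rw [e]; nlinarith [norm_nonneg h]

lemma grad_small (S : Sys V κ T u) : ∃ C, 0 < C ∧ ∀ t ∈ Ico0 T, t ≤ 1 → ∀ h ω, 0 ≤ ω → (∀ y, ‖grd (u 0) (y + h) - grd (u 0) y‖ ≤ ω) → ∀ x,
    ‖grd (u t) (x + h) - grd (u t) x‖ ≤ (m + 1) * (ω + C * ‖h‖ ^ (1/2:ℝ)) := by
  obtain ⟨K, hK0, hK⟩ := S.dd_bd (α := 1/2) (by norm_num) (by norm_num)
  refine ⟨K, hK0, fun t ht ht1 h ω hω0 hω x => norm_clm_dir _ fun o => S.pd_lim ht fun η hη => ?_⟩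
  have hηd : ‖η • dir (m := m) o‖ ≤ η := by
    rw [norm_smul, Real.norm_eq_abs, abs_of_pos hη]; exact mul_le_of_le_one_right hη.le (norm_dir o)
  refine (hK t ht 0 le_rfl ht.1 ω x h o η hη fun τ hτ0 hτ => ?_).trans ?_
  · have hdom := dom_G (m := m) hτ0
    rw [cv_dd2 hdom S.per0 S.c0.continuous]
    have h2 : ∀ y, |u 0 (y + h + η • dir o) - u 0 (y + h) - (u 0 (y + η • dir o) - u 0 y)| ≤ ω * η := fun y => by
      have hdf := S.c0.differentiable (by norm_num)
      have hg : ∀ y, HasFDerivAt (fun y => u 0 (y + h) - u 0 y) (grd (u 0) (y + h) - grd (u 0) y) y := fun y =>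
        ((hasFDerivAt_comp_add_right h).2 (hdf (y + h)).hasFDerivAt).sub (hdf y).hasFDerivAt
      have := convex_univ.norm_image_sub_le_of_norm_hasFDerivWithin_le (f := fun y => u 0 (y + h) - u 0 y) (C := ω)
        (fun y _ => (hg y).hasFDerivWithinAt) (fun y _ => hω y) (mem_univ y) (mem_univ (y + η • dir o))
      rw [add_sub_cancel_left] at this
      refine le_trans (le_of_eq ?_) (this.trans (mul_le_mul_of_nonneg_left hηd hω0))
      rw [Real.norm_eq_abs, add_right_comm y h]; congr 1; ring
    have := cv_sup hdom.ker.1 hdom.ker.2 (show 0 ≤ ω * η by positivity) h2 x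
    rwa [one_mul] at this
  · refine mul_le_mul_of_nonneg_right ?_ hη.le
    have : (t - 0) ^ (1 - (1 + (1/2:ℝ)) / 2) ≤ 1 := Real.rpow_le_one (by linarith [ht.1]) (by linarith) (by norm_num)
    have h3 : 0 ≤ K * ‖h‖ ^ (1/2:ℝ) := by positivity
    nlinarith

end Sys

lemma mem_ccube {m : ℕ} {x : Spc m} : x ∈ ccube m ↔ ∀ o, co o x ∈ Icc (0:ℝ) 1 := by
  simp only [ccube, mem_prod, Set.mem_pi, mem_univ, true_imp_iff, Option.forall]; rfl
lemma mem_cube {m : ℕ} {x : Spc m} : x ∈ cube m ↔ ∀ o, co o x ∈ Ico (0:ℝ) 1 := by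
  simp only [cube, cube1, mem_prod, Set.mem_pi, mem_univ, true_imp_iff, Option.forall]; rfl
lemma norm_le_co {m : ℕ} {x : Spc m} {A : ℝ} (h : ∀ o, |co o x| ≤ A) : ‖x‖ ≤ A := by
  have hA : 0 ≤ A := (abs_nonneg _).trans (h none)
  rw [Prod.norm_def]
  exact max_le (h none) ((pi_norm_le_iff_of_nonneg hA).2 fun i => h (some i))
lemma ccube_diam {m : ℕ} {x y : Spc m} (hx : x ∈ ccube m) (hy : y ∈ ccube m) : ‖x - y‖ ≤ 1 := norm_le_co fun o => by
  have h1 := mem_ccube.1 hx o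
  have h2 := mem_ccube.1 hy o
  rw [map_sub, abs_le]; constructor <;> linarith [h1.1, h1.2, h2.1, h2.2]
lemma cmb {m : ℕ} {x z : Spc m} (hx : x ∈ ccube m) (hz : z ∈ cube m) {r : ℝ} (h0 : 0 < r) (h1 : r ≤ 1) :
    (1 - r) • x + r • z ∈ cube m := mem_cube.2 fun o => by
  have h1 := mem_ccube.1 hx o
  have h2 := mem_cube.1 hz o
  simp only [map_add, map_smul, smul_eq_mul]
  constructor
  · have := mul_nonneg (sub_nonneg.2 ‹r ≤ 1›) h1.1
    have := mul_nonneg h0.le h2.1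
    linarith
  · have := mul_le_mul_of_nonneg_left h1.2 (sub_nonneg.2 ‹r ≤ 1›)
    have := mul_lt_mul_of_pos_left h2.2 h0
    linarith

lemma cvar {m : ℕ} {F : Spc m → ℝ≥0∞} (hF : Measurable F) {c : Spc m} {r : ℝ} (hr : 0 < r)
    (hc : ∀ z ∈ cube m, c + r • z ∈ cube m) :
    ∫⁻ z in cube m, F (c + r • z) ≤ ENNReal.ofReal ((r ^ (m + 1))⁻¹) * ∫⁻ w in cube m, F w := by
  have hm : Measurable ((cube m).indicator F) := hF.indicator (meas_cube m)
  have h1 : ∫⁻ z in cube m, F (c + r • z) ≤ ∫⁻ z, (cube m).indicator F (c + r • z) := by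
    rw [← lintegral_indicator (meas_cube m)]
    refine lintegral_mono fun z => ?_
    by_cases hz : z ∈ cube m
    · simp [hz, hc z hz]
    · simp [hz]
  refine h1.trans (le_of_eq ?_)
  have h2 : ∫⁻ z, (cube m).indicator F (c + r • z) = ∫⁻ w, (cube m).indicator F (c + w) ∂(Measure.map (r • · : Spc m → Spc m) volume) := by
    have hm' : Measurable fun w => (cube m).indicator F (c + w) := hm.comp (measurable_const_add c)
    rw [lintegral_map hm' (measurable_const_smul r)]
  rw [h2, Measure.map_addHaar_smul _ hr.ne', lintegral_smul_measure, lintegral_add_left_eq_self (fun w => (cube m).indicator F w) c, lintegral_indicator (meas_cube m)]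
  have hfr : Module.finrank ℝ (Spc m) = m + 1 := by simp [add_comm]
  rw [hfr, abs_of_pos (by positivity), smul_eq_mul]

lemma young {a l p : ℝ} (ha : 0 ≤ a) (hl : 0 < l) (hp : 1 ≤ p) : a ≤ l + l ^ (1 - p) * a ^ p := by
  rcases le_or_gt a l with h | h
  · have : 0 ≤ l ^ (1 - p) * a ^ p := by positivity
    linarith
  · have h0 : 0 < a := hl.trans h
    have h1 : a ^ (1 - p) ≤ l ^ (1 - p) := Real.rpow_le_rpow_of_nonpos hl h.le (by linarith)
    have h2 : a ^ (1 - p) * a ^ p = a := by rw [← Real.rpow_add h0]; simp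
    have h3 := mul_le_mul_of_nonneg_right h1 (Real.rpow_nonneg ha p)
    linarith

lemma cvar2 {m : ℕ} {k : Spc m → Spc m → ℝ≥0∞} (hk : Measurable (Function.uncurry k)) {c c' : Spc m} {r ρ : ℝ} (hr : 0 < r) (hρ : 0 < ρ) (a A : ℝ≥0∞)
    (hc : ∀ z ∈ cube m, c + r • z ∈ cube m) (hc' : ∀ z ∈ cube m, c' + ρ • z ∈ cube m) :
    ∫⁻ z in cube m, ∫⁻ z' in cube m, (a + A * k (c + r • z) (c' + ρ • z')) ≤
      a + A * (ENNReal.ofReal ((r ^ (m + 1))⁻¹) * (ENNReal.ofReal ((ρ ^ (m + 1))⁻¹) * ∫⁻ x in cube m, ∫⁻ y in cube m, k x y)) := by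
  have hm2 : Measurable fun x => ∫⁻ y in cube m, k x y := hk.lintegral_prod_right'
  have hm3 : Measurable fun z : Spc m => ∫⁻ y in cube m, k (c + r • z) y := hm2.comp (by fun_prop : Measurable fun z : Spc m => c + r • z)
  calc _ ≤ ∫⁻ z in cube m, (a + A * (ENNReal.ofReal ((ρ ^ (m + 1))⁻¹) * ∫⁻ y in cube m, k (c + r • z) y)) := by
        refine lintegral_mono fun z => ?_
        have hm1 : Measurable fun y => k (c + r • z) y := hk.comp measurable_prodMk_left
        have hm4 : Measurable fun z' => k (c + r • z) (c' + ρ • z') := hm1.comp (by fun_prop : Measurable fun z' : Spc m => c' + ρ • z')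
        show ∫⁻ z' in cube m, (a + A * k (c + r • z) (c' + ρ • z')) ≤ _
        rw [lintegral_add_left measurable_const, lintegral_const_mul _ hm4, lintegral_const, measure_univ, mul_one]
        exact add_le_add le_rfl (mul_le_mul_right (cvar hm1 hρ hc') _)
    _ = a + A * (ENNReal.ofReal ((ρ ^ (m + 1))⁻¹) * ∫⁻ z in cube m, ∫⁻ y in cube m, k (c + r • z) y) := by
        rw [lintegral_add_left measurable_const, lintegral_const_mul _ (hm3.const_mul _), lintegral_const_mul _ hm3, lintegral_const, measure_univ, mul_one]
    _ ≤ a + A * (ENNReal.ofReal ((ρ ^ (m + 1))⁻¹) * (ENNReal.ofReal ((r ^ (m + 1))⁻¹) * ∫⁻ x in cube m, ∫⁻ y in cube m, k x y)) :=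
        add_le_add le_rfl (mul_le_mul_right (mul_le_mul_right (cvar hm2 hr hc) _) _)
    _ = _ := by rw [mul_left_comm (ENNReal.ofReal ((ρ ^ (m + 1))⁻¹))]

lemma int_aff {m : ℕ} {g : Spc m → ℝ} (hg : Measurable g) (hi : IntegrableOn g (cube m)) {c : Spc m} {r : ℝ} (hr : 0 < r) (hc : ∀ z ∈ cube m, c + r • z ∈ cube m) :
    IntegrableOn (fun z => g (c + r • z)) (cube m) :=
  ⟨(hg.comp (by fun_prop : Measurable fun z : Spc m => c + r • z)).aestronglyMeasurable,
    (cvar hg.enorm hr hc).trans_lt (ENNReal.mul_lt_top ENNReal.ofReal_lt_top hi.2)⟩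

lemma meas_ker {m : ℕ} {g : Spc m → ℝ} (hg : Measurable g) (p q : ℝ) :
    Measurable (Function.uncurry fun x y : Spc m => ENNReal.ofReal (|g x - g y| ^ p / ‖x - y‖ ^ q)) := by
  have h0 : Measurable fun z : Spc m × Spc m => g z.1 - g z.2 := (hg.comp measurable_fst).sub (hg.comp measurable_snd)
  have h1 : Measurable fun z : Spc m × Spc m => |g z.1 - g z.2| ^ p := h0.norm.pow_const p
  have h2 : Measurable fun z : Spc m × Spc m => ‖z.1 - z.2‖ ^ q := (by fun_prop : Measurable fun z : Spc m × Spc m => ‖z.1 - z.2‖).pow_const q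
  exact (h1.div h2).ennreal_ofReal

lemma ker_pt {m : ℕ} (g : Spc m → ℝ) {p q D l : ℝ} (hp : 1 ≤ p) (hq : 0 ≤ q) (hl : 0 < l) (hD : 0 < D) {w w' : Spc m} (hd : ‖w - w'‖ ≤ D) :
    ‖g w - g w'‖ₑ ≤ ENNReal.ofReal l + ENNReal.ofReal (l ^ (1 - p) * D ^ q) * ENNReal.ofReal (|g w - g w'| ^ p / ‖w - w'‖ ^ q) := by
  rw [← ENNReal.ofReal_mul (by positivity), ← ENNReal.ofReal_add hl.le (by positivity), ← ofReal_norm]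
  refine ENNReal.ofReal_le_ofReal ((young (norm_nonneg _) hl hp).trans ?_)
  rw [Real.norm_eq_abs, mul_assoc]
  have h2 : |g w - g w'| ^ p ≤ D ^ q * (|g w - g w'| ^ p / ‖w - w'‖ ^ q) := by
    by_cases hw : w = w'
    · rw [hw]; simp only [sub_self, abs_zero, Real.zero_rpow (by linarith : p ≠ 0), zero_div, mul_zero, le_refl]
    · have h3 : 0 < ‖w - w'‖ := norm_pos_iff.2 (sub_ne_zero.2 hw)
      rw [mul_div_assoc', le_div_iff₀ (by positivity), mul_comm]
      gcongr
  gcongr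

lemma int_dbl {m : ℕ} {f h : Spc m → ℝ} (i1 : IntegrableOn f (cube m)) (i2 : IntegrableOn h (cube m)) :
    (∫ z in cube m, f z) - ∫ z in cube m, h z = ∫ z in cube m, ∫ z' in cube m, (f z - h z') := by
  have e : ∀ z, ∫ z' in cube m, (f z - h z') = f z - ∫ z' in cube m, h z' := fun z => by
    rw [integral_sub (integrable_const _) i2, integral_const]; simp
  simp only [e]
  rw [integral_sub i1 (integrable_const _), integral_const]; simp

lemma av_diff {m : ℕ} {g : Spc m → ℝ} (hg : Measurable g) (hi : IntegrableOn g (cube m)) {p q Λ : ℝ} (hp : 1 ≤ p) (hq : 0 ≤ q) (hΛ : 0 ≤ Λ)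
    (hI : ∫⁻ x in cube m, ∫⁻ y in cube m, ENNReal.ofReal (|g x - g y| ^ p / ‖x - y‖ ^ q) ≤ ENNReal.ofReal Λ)
    {c c' : Spc m} {r ρ D l : ℝ} (hr : 0 < r) (hρ : 0 < ρ) (hl : 0 < l) (hD : 0 < D)
    (hc : ∀ z ∈ cube m, c + r • z ∈ cube m) (hc' : ∀ z ∈ cube m, c' + ρ • z ∈ cube m)
    (hd : ∀ z ∈ cube m, ∀ z' ∈ cube m, ‖c + r • z - (c' + ρ • z')‖ ≤ D) :
    |(∫ z in cube m, g (c + r • z)) - ∫ z in cube m, g (c' + ρ • z)| ≤ l + l ^ (1 - p) * D ^ q * ((r ^ (m + 1))⁻¹ * (ρ ^ (m + 1))⁻¹ * Λ) := by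
  have h1 : ENNReal.ofReal |(∫ z in cube m, g (c + r • z)) - ∫ z in cube m, g (c' + ρ • z)| ≤
      ENNReal.ofReal l + ENNReal.ofReal (l ^ (1 - p) * D ^ q) * (ENNReal.ofReal ((r ^ (m + 1))⁻¹) * (ENNReal.ofReal ((ρ ^ (m + 1))⁻¹) * ENNReal.ofReal Λ)) := by
    rw [int_dbl (int_aff hg hi hr hc) (int_aff hg hi hρ hc'), ← Real.norm_eq_abs, ofReal_norm]
    refine (enorm_integral_le_lintegral_enorm _).trans ((lintegral_mono fun z => enorm_integral_le_lintegral_enorm _).trans ?_)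
    refine (setLIntegral_mono' (meas_cube m) fun z hz => setLIntegral_mono' (meas_cube m) fun z' hz' => ker_pt g hp hq hl hD (hd z hz z' hz')).trans ?_
    refine (cvar2 (meas_ker hg p q) hr hρ _ _ hc hc').trans ?_
    exact add_le_add le_rfl (mul_le_mul_right (mul_le_mul_right (mul_le_mul_right hI _) _) _)
  rw [← ENNReal.ofReal_mul (by positivity), ← ENNReal.ofReal_mul (by positivity), ← ENNReal.ofReal_mul (by positivity),
    ← ENNReal.ofReal_add hl.le (by positivity)] at h1
  have h2 := (ENNReal.ofReal_le_ofReal_iff (by positivity)).1 h1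
  rw [mul_assoc ((r ^ (m + 1))⁻¹)]; exact h2

def av {m : ℕ} (g : Spc m → ℝ) (r : ℝ) (x : Spc m) : ℝ := ∫ z in cube m, g ((1 - r) • x + r • z)

lemma camp {m : ℕ} {g : Spc m → ℝ} (hg : Measurable g) (hi : IntegrableOn g (cube m)) {p s Λ : ℝ} (hp : 1 ≤ p) (hs : 0 ≤ s) (hΛ : 0 ≤ Λ)
    (hI : ∫⁻ x in cube m, ∫⁻ y in cube m, ENNReal.ofReal (|g x - g y| ^ p / ‖x - y‖ ^ ((m:ℝ) + 1 + s * p)) ≤ ENNReal.ofReal Λ)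
    {x x' : Spc m} (hx : x ∈ ccube m) (hx' : x' ∈ ccube m) {r ρ : ℝ} (hr : 0 < r) (hr1 : r ≤ 1) (hρ : r / 2 ≤ ρ) (hρr : ρ ≤ r) (hxx : ‖x - x'‖ ≤ r) :
    |av g r x - av g ρ x'| ≤ (1 + 2 ^ ((m:ℝ) + 1 + s * p) * 2 ^ (m + 1) * Λ) * r ^ (s - (m + 1) / p) := by
  have hp0 : 0 < p := by linarith
  have hρ0 : 0 < ρ := by linarith
  set q := (m:ℝ) + 1 + s * p with hq
  have hq0 : 0 ≤ q := by positivity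
  set θ := s - (m + 1) / p with hθ
  have h := av_diff hg hi hp hq0 hΛ hI (c := (1 - r) • x) (c' := (1 - ρ) • x') (r := r) (ρ := ρ) (D := 2 * r) (l := r ^ θ) hr hρ0 (by positivity) (by positivity)
    (fun z hz => cmb hx hz hr hr1) (fun z hz => cmb hx' hz hρ0 (by linarith)) (fun z hz z' hz' => ?_)
  · refine h.trans ?_
    have h1 : (ρ ^ (m + 1))⁻¹ ≤ 2 ^ (m + 1) * (r ^ (m + 1))⁻¹ := by
      calc (ρ ^ (m + 1))⁻¹ ≤ ((r / 2) ^ (m + 1))⁻¹ := by gcongr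
        _ = _ := by rw [div_pow, inv_div, div_eq_mul_inv]
    calc r ^ θ + (r ^ θ) ^ (1 - p) * (2 * r) ^ q * ((r ^ (m + 1))⁻¹ * (ρ ^ (m + 1))⁻¹ * Λ)
        ≤ r ^ θ + (r ^ θ) ^ (1 - p) * (2 * r) ^ q * ((r ^ (m + 1))⁻¹ * (2 ^ (m + 1) * (r ^ (m + 1))⁻¹) * Λ) := by gcongr
      _ = _ := by
        have e1 : (r ^ θ) ^ (1 - p) * r ^ q * ((r ^ (m + 1))⁻¹ * (r ^ (m + 1))⁻¹) = r ^ θ := by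
          rw [← Real.rpow_natCast r (m + 1), ← Real.rpow_neg hr.le, ← Real.rpow_mul hr.le, ← Real.rpow_add hr, ← Real.rpow_add hr, ← Real.rpow_add hr]
          congr 1
          push_cast
          rw [hq, hθ]; field_simp; ring
        rw [Real.mul_rpow (by norm_num) hr.le]
        calc _ = r ^ θ + (2:ℝ) ^ q * 2 ^ (m + 1) * Λ * ((r ^ θ) ^ (1 - p) * r ^ q * ((r ^ (m + 1))⁻¹ * (r ^ (m + 1))⁻¹)) := by ring
          _ = _ := by rw [e1]; ring
  · have hz1 := cube_sub m hz
    have hz2 := cube_sub m hz'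
    have e : (1 - r) • x + r • z - ((1 - ρ) • x' + ρ • z') = (1 - r) • (x - x') + ((r - ρ) • (z - x') + ρ • (z - z')) := by
      simp only [sub_smul, smul_sub, one_smul]; abel
    rw [e]
    refine (norm_add_le _ _).trans ?_
    have n1 : ‖(1 - r) • (x - x')‖ ≤ r := by
      rw [norm_smul, Real.norm_eq_abs, abs_of_nonneg (by linarith)]
      exact (mul_le_of_le_one_left (norm_nonneg _) (by linarith)).trans hxx
    have n2 : ‖(r - ρ) • (z - x')‖ ≤ r - ρ := by
      rw [norm_smul, Real.norm_eq_abs, abs_of_nonneg (by linarith)]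
      exact mul_le_of_le_one_right (by linarith) (ccube_diam hz1 hx')
    have n3 : ‖ρ • (z - z')‖ ≤ ρ := by
      rw [norm_smul, Real.norm_eq_abs, abs_of_nonneg (by linarith)]
      exact mul_le_of_le_one_right (by linarith) (ccube_diam hz1 hz2)
    linarith [norm_add_le ((r - ρ) • (z - x')) (ρ • (z - z'))]

lemma emb1 {m : ℕ} {g : Spc m → ℝ} (hg : Measurable g) (hi : IntegrableOn g (cube m)) {p s Λ : ℝ} (hp : 1 ≤ p) (hs : ((m:ℝ) + 1) / p < s) (hΛ : 0 ≤ Λ)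
    (hI : ∫⁻ x in cube m, ∫⁻ y in cube m, ENNReal.ofReal (|g x - g y| ^ p / ‖x - y‖ ^ ((m:ℝ) + 1 + s * p)) ≤ ENNReal.ofReal Λ) :
    ∃ (G : Spc m → ℝ) (C b : ℝ), 0 < C ∧ 0 < b ∧ b < 1 ∧ (∀ (k : ℕ), ∀ x ∈ ccube m, |av g ((1/2) ^ k) x - G x| ≤ C * b ^ k) ∧
      ∀ (k : ℕ), ∀ x ∈ ccube m, ∀ x' ∈ ccube m, ‖x - x'‖ ≤ (1/2) ^ k → |G x - G x'| ≤ C * b ^ k := by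
  have hs0 : 0 ≤ s := le_trans (by positivity) hs.le
  set A := 1 + 2 ^ ((m:ℝ) + 1 + s * p) * 2 ^ (m + 1) * Λ with hA
  have hA0 : 0 < A := by positivity
  set θ := s - (m + 1) / p with hθ
  have hθ0 : 0 < θ := by linarith
  set b := (1/2:ℝ) ^ θ with hb
  have hb0 : 0 < b := by positivity
  have hb1 : b < 1 := Real.rpow_lt_one (by norm_num) (by norm_num) hθ0
  have hpow : ∀ k : ℕ, ((1/2:ℝ) ^ k) ^ θ = b ^ k := fun k => by
    rw [hb, ← Real.rpow_natCast, ← Real.rpow_natCast, ← Real.rpow_mul (by norm_num), ← Real.rpow_mul (by norm_num), mul_comm]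
  have hr0 : ∀ k : ℕ, (0:ℝ) < (1/2) ^ k := fun k => by positivity
  have hr1 : ∀ k : ℕ, (1/2:ℝ) ^ k ≤ 1 := fun k => pow_le_one₀ (by norm_num) (by norm_num)
  have hc1 : ∀ x ∈ ccube m, ∀ k : ℕ, dist (av g ((1/2) ^ k) x) (av g ((1/2) ^ (k + 1)) x) ≤ A * b ^ k := fun x hx k => by
    rw [Real.dist_eq, ← hpow]
    refine camp hg hi hp hs0 hΛ hI hx hx (hr0 k) (hr1 k) ?_ ?_ (by simp)
    · rw [pow_succ]; linarith
    · rw [pow_succ]; linarith [hr0 k]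
  have hlim : ∀ x ∈ ccube m, ∃ l, Tendsto (fun k : ℕ => av g ((1/2) ^ k) x) atTop (nhds l) := fun x hx =>
    cauchySeq_tendsto_of_complete (cauchySeq_of_le_geometric b A hb1 (hc1 x hx))
  choose! L hL using hlim
  have h1b : 0 < 1 - b := by linarith
  have hd : ∀ (k : ℕ), ∀ x ∈ ccube m, |av g ((1/2) ^ k) x - L x| ≤ A / (1 - b) * b ^ k := fun k x hx => by
    have := dist_le_of_le_geometric_of_tendsto b A hb1 (hc1 x hx) (hL x hx) k
    rw [Real.dist_eq] at this
    refine this.trans (le_of_eq (by ring))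
  refine ⟨L, A / (1 - b) + A + A / (1 - b), b, by positivity, hb0, hb1, fun k x hx => (hd k x hx).trans ?_, fun k x hx x' hx' hxx => ?_⟩
  · have : 0 < A / (1 - b) := by positivity
    gcongr; linarith
  · have h1 := hd k x hx
    have h2 := hd k x' hx'
    have h3 := camp hg hi hp hs0 hΛ hI hx hx' (hr0 k) (hr1 k) (by linarith [hr0 k]) le_rfl hxx
    rw [← hθ, hpow] at h3
    rw [abs_le] at *
    constructor <;> nlinarith

lemma conv_cc {m : ℕ} {x e : Spc m} {η : ℝ} (hx : x ∈ ccube m) (hy : x + η • e ∈ ccube m) {θ : ℝ} (h0 : 0 ≤ θ) (h1 : θ ≤ 1) :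
    x + (θ * η) • e ∈ ccube m := mem_ccube.2 fun o => by
  have h2 := mem_ccube.1 hx o
  have h3 := mem_ccube.1 hy o
  have e1 : co o (x + (θ * η) • e) = (1 - θ) * co o x + θ * co o (x + η • e) := by
    simp only [map_add, map_smul, smul_eq_mul]; ring
  have h4 : 0 ≤ 1 - θ := by linarith
  rw [e1]
  constructor
  · have := mul_nonneg h4 h2.1
    have := mul_nonneg h0 h3.1
    linarith
  · have := mul_le_mul_of_nonneg_left h2.2 h4
    have := mul_le_mul_of_nonneg_left h3.2 h0
    linarith

lemma av_lim {m : ℕ} {f : Spc m → ℝ} (hf : Continuous f) {B : ℝ} (hB : ∀ x, ‖f x‖ ≤ B) (x : Spc m) :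
    Tendsto (fun k : ℕ => av f ((1/2) ^ k) x) atTop (nhds (f x)) := by
  have e : f x = ∫ z in cube m, f ((1 - (0:ℝ)) • x + (0:ℝ) • z) := by simp
  rw [e]
  have hk : Tendsto (fun k : ℕ => (1/2:ℝ) ^ k) atTop (nhds 0) := tendsto_pow_atTop_nhds_zero_of_lt_one (by norm_num) (by norm_num)
  refine tendsto_integral_of_dominated_convergence (fun _ => B) (fun k => ?_) (integrable_const _) (fun k => ae_of_all _ fun z => hB _) (ae_of_all _ fun z => ?_)
  · exact (hf.comp (by fun_prop : Continuous fun z : Spc m => (1 - (1/2:ℝ) ^ k) • x + ((1/2:ℝ) ^ k) • z)).aestronglyMeasurable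
  · have hc : Continuous fun r : ℝ => f ((1 - r) • x + r • z) := hf.comp (by fun_prop)
    exact (hc.tendsto 0).comp hk

lemma av_ftc {m : ℕ} {f : Spc m → ℝ} (hf : Differentiable ℝ f) {B : ℝ} (hB : ∀ x, ‖f x‖ ≤ B) {e : Spc m} (hm : Measurable (pd e f)) (hi : IntegrableOn (pd e f) (cube m))
    {x : Spc m} {η : ℝ} (hx : x ∈ ccube m) (hy : x + η • e ∈ ccube m) {r : ℝ} (hr : 0 < r) (hr1 : r ≤ 1) :
    IntegrableOn (fun θ : ℝ => av (pd e f) r (x + (θ * η) • e)) (Ioc 0 1) ∧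
    av f r (x + η • e) - av f r x = ∫ θ in Ioc (0:ℝ) 1, (1 - r) * η * av (pd e f) r (x + (θ * η) • e) := by
  have H : Integrable (fun w : ℝ × Spc m => pd e f ((1 - r) • (x + (w.1 * η) • e) + r • w.2)) ((volume.restrict (Ioc (0:ℝ) 1)).prod (volume.restrict (cube m))) := by
    have hmm : Measurable fun w : ℝ × Spc m => pd e f ((1 - r) • (x + (w.1 * η) • e) + r • w.2) := hm.comp (by fun_prop)
    refine ⟨hmm.aestronglyMeasurable, ?_⟩
    rw [HasFiniteIntegral, lintegral_prod _ hmm.enorm.aemeasurable]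
    calc _ ≤ ∫⁻ θ in Ioc (0:ℝ) 1, ENNReal.ofReal ((r ^ (m + 1))⁻¹) * ∫⁻ w in cube m, ‖pd e f w‖ₑ :=
          setLIntegral_mono' measurableSet_Ioc fun θ hθ => cvar hm.enorm hr fun z hz => cmb (conv_cc hx hy hθ.1.le hθ.2) hz hr hr1
      _ < ⊤ := by
          rw [lintegral_const]
          exact ENNReal.mul_lt_top (ENNReal.mul_lt_top ENNReal.ofReal_lt_top hi.2) (by simp)
  refine ⟨H.integral_prod_left, ?_⟩
  have hcf := hf.continuous
  have ib : ∀ c : Spc m, IntegrableOn (fun z => f (c + r • z)) (cube m) := fun c =>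
    Integrable.of_bound (hcf.comp (by fun_prop : Continuous fun z : Spc m => c + r • z)).aestronglyMeasurable B (ae_of_all _ fun z => hB _)
  have h1 : ∀ᵐ z ∂(volume.restrict (cube m)), f ((1 - r) • (x + η • e) + r • z) - f ((1 - r) • x + r • z) = (1 - r) * η * ∫ θ in Ioc (0:ℝ) 1, pd e f ((1 - r) • (x + (θ * η) • e) + r • z) := by
    filter_upwards [H.prod_left_ae] with z hz
    have hd : ∀ θ : ℝ, HasDerivAt (fun θ : ℝ => f ((1 - r) • (x + (θ * η) • e) + r • z)) ((1 - r) * η * pd e f ((1 - r) • (x + (θ * η) • e) + r • z)) θ := fun θ => by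
      have h2 : HasDerivAt (fun θ : ℝ => (1 - r) • (x + (θ * η) • e) + r • z) ((1 - r) • ((1 * η) • e)) θ :=
        ((((hasDerivAt_id θ).mul_const η).smul_const e).const_add x).const_smul (1 - r) |>.add_const _
      have h3 := (hf ((1 - r) • (x + (θ * η) • e) + r • z)).hasFDerivAt.comp_hasDerivAt θ h2
      refine h3.congr_deriv ?_
      rw [map_smul, map_smul, one_mul, smul_eq_mul, smul_eq_mul, ← mul_assoc]; rfl
    have h4 := intervalIntegral.integral_eq_sub_of_hasDerivAt (a := 0) (b := 1) (fun θ _ => hd θ)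
      ((intervalIntegrable_iff_integrableOn_Ioc_of_le zero_le_one).2 (hz.const_mul _))
    rw [intervalIntegral.integral_of_le zero_le_one, integral_const_mul] at h4
    simp only [one_mul, zero_mul, zero_smul, add_zero] at h4
    exact h4.symm
  have e1 : av f r (x + η • e) - av f r x = ∫ z in cube m, (f ((1 - r) • (x + η • e) + r • z) - f ((1 - r) • x + r • z)) :=
    (integral_sub (ib _) (ib _)).symm
  rw [e1, integral_congr_ae h1, integral_const_mul, integral_const_mul]
  congr 1
  exact (integral_integral_swap (f := fun (θ : ℝ) (z : Spc m) => pd e f ((1 - r) • (x + (θ * η) • e) + r • z)) H).symm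

lemma emb2 {m : ℕ} {f : Spc m → ℝ} (hf : Differentiable ℝ f) {B : ℝ} (hB : ∀ x, ‖f x‖ ≤ B) {e : Spc m} (he : ‖e‖ ≤ 1) (hm : Measurable (pd e f)) (hi : IntegrableOn (pd e f) (cube m))
    {G : Spc m → ℝ} {C b : ℝ} (hb : 0 < b) (hb1 : b < 1) (hG1 : ∀ (k : ℕ), ∀ x ∈ ccube m, |av (pd e f) ((1/2) ^ k) x - G x| ≤ C * b ^ k)
    (hG2 : ∀ (k : ℕ), ∀ x ∈ ccube m, ∀ x' ∈ ccube m, ‖x - x'‖ ≤ (1/2) ^ k → |G x - G x'| ≤ C * b ^ k)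
    {x : Spc m} {η : ℝ} {j : ℕ} (hx : x ∈ ccube m) (hy : x + η • e ∈ ccube m) (hη : |η| ≤ (1/2) ^ j) :
    |f (x + η • e) - f x - η * G x| ≤ |η| * (C * b ^ j) := by
  have hk : Tendsto (fun k : ℕ => (1/2:ℝ) ^ k) atTop (nhds 0) := tendsto_pow_atTop_nhds_zero_of_lt_one (by norm_num) (by norm_num)
  have hbk : Tendsto (fun k : ℕ => b ^ k) atTop (nhds 0) := tendsto_pow_atTop_nhds_zero_of_lt_one hb.le hb1
  have h1 : ∀ k : ℕ, |av f ((1/2) ^ k) (x + η • e) - av f ((1/2) ^ k) x - (1 - (1/2) ^ k) * η * G x| ≤ |η| * (C * b ^ k + C * b ^ j) := fun k => by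
    have r0 : (0:ℝ) < (1/2) ^ k := by positivity
    have r1 : (1/2:ℝ) ^ k ≤ 1 := pow_le_one₀ (by norm_num) (by norm_num)
    obtain ⟨i1, e1⟩ := av_ftc hf hB hm hi hx hy r0 r1
    rw [e1]
    have e2 : (1 - (1/2:ℝ) ^ k) * η * G x = ∫ θ in Ioc (0:ℝ) 1, (1 - (1/2:ℝ) ^ k) * η * G x := by simp
    rw [e2, ← integral_sub (i1.const_mul _) (integrable_const _)]
    have h2 := norm_setIntegral_le_of_norm_le_const (μ := volume) (s := Ioc (0:ℝ) 1) (C := |η| * (C * b ^ k + C * b ^ j)) (by simp)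
      (f := fun θ => (1 - (1/2:ℝ) ^ k) * η * av (pd e f) ((1/2) ^ k) (x + (θ * η) • e) - (1 - (1/2:ℝ) ^ k) * η * G x) (fun θ hθ => ?_)
    · simpa using h2
    · have hc := conv_cc hx hy hθ.1.le hθ.2
      have a1 := hG1 k _ hc
      have hd : ‖x + (θ * η) • e - x‖ ≤ (1/2) ^ j := by
        rw [add_sub_cancel_left, norm_smul, Real.norm_eq_abs, abs_mul, abs_of_pos hθ.1]
        calc θ * |η| * ‖e‖ ≤ 1 * |η| * 1 := by gcongr; exact hθ.2
          _ ≤ _ := by simpa using hη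
      have a2 := hG2 j _ hc x hx hd
      rw [← mul_sub, Real.norm_eq_abs, abs_mul, abs_mul, abs_of_nonneg (by linarith : (0:ℝ) ≤ 1 - (1/2) ^ k)]
      have a3 : |av (pd e f) ((1/2) ^ k) (x + (θ * η) • e) - G x| ≤ C * b ^ k + C * b ^ j :=
        (abs_sub_le _ _ _).trans (add_le_add a1 a2)
      calc (1 - (1/2:ℝ) ^ k) * |η| * _ ≤ 1 * |η| * (C * b ^ k + C * b ^ j) := by gcongr; linarith
        _ = _ := by ring
  have l1 := (((av_lim hf.continuous hB (x + η • e)).sub (av_lim hf.continuous hB x)).sub ((((tendsto_const_nhds (x := (1:ℝ))).sub hk).mul_const η).mul_const (G x))).abs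
  have l2 := (((hbk.const_mul C).add_const (C * b ^ j)).const_mul |η|)
  have h3 := le_of_tendsto_of_tendsto' l1 l2 h1
  simpa using h3

lemma emb3 {m : ℕ} {f : Spc m → ℝ} (hf : Differentiable ℝ f) {B : ℝ} (hB : ∀ x, ‖f x‖ ≤ B) (o : Option (Fin m)) (hm : Measurable (pd (dir o) f)) (hi : IntegrableOn (pd (dir o) f) (cube m))
    {p s Λ : ℝ} (hp : 1 ≤ p) (hs : ((m:ℝ) + 1) / p < s) (hΛ : 0 ≤ Λ)
    (hI : ∫⁻ x in cube m, ∫⁻ y in cube m, ENNReal.ofReal (|pd (dir o) f x - pd (dir o) f y| ^ p / ‖x - y‖ ^ ((m:ℝ) + 1 + s * p)) ≤ ENNReal.ofReal Λ) :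
    ContinuousOn (pd (dir o) f) (ccube m) := by
  obtain ⟨G, C, b, hC, hb, hb1, hG1, hG2⟩ := emb1 hm hi hp hs hΛ hI
  have hk : Tendsto (fun k : ℕ => (1/2:ℝ) ^ k) atTop (nhds 0) := tendsto_pow_atTop_nhds_zero_of_lt_one (by norm_num) (by norm_num)
  have hbk : Tendsto (fun k : ℕ => C * b ^ k) atTop (nhds 0) := by simpa using (tendsto_pow_atTop_nhds_zero_of_lt_one hb.le hb1).const_mul C
  have key : ∀ x ∈ ccube m, pd (dir o) f x = G x := fun x hx => by
    obtain ⟨ε, hε, hε2⟩ : ∃ ε : ℝ, |ε| = 1 ∧ ∀ j : ℕ, x + (ε * (1/2) ^ (j + 1)) • (dir o : Spc m) ∈ ccube m := by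
      have h1 := mem_ccube.1 hx
      have hj : ∀ j : ℕ, (0:ℝ) < (1/2) ^ (j + 1) ∧ (1/2:ℝ) ^ (j + 1) ≤ 1/2 := fun j => ⟨by positivity, by
        rw [pow_succ]; have := pow_le_one₀ (n := j) (by norm_num : (0:ℝ) ≤ 1/2) (by norm_num); linarith⟩
      rcases le_total (co o x) (1/2) with h | h
      · refine ⟨1, by simp, fun j => mem_ccube.2 fun o' => ?_⟩
        simp only [map_add, map_smul, smul_eq_mul, co_dir]
        have := h1 o'; have := hj j
        split_ifs with ho
        · subst ho; constructor <;> linarith [this.1, this.2, (h1 o').1]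
        · simpa using h1 o'
      · refine ⟨-1, by simp, fun j => mem_ccube.2 fun o' => ?_⟩
        simp only [map_add, map_smul, smul_eq_mul, co_dir]
        have := h1 o'; have := hj j
        split_ifs with ho
        · subst ho; constructor <;> linarith [this.1, this.2, (h1 o').2]
        · simpa using h1 o'
    have hd : HasDerivAt (fun t : ℝ => f (x + t • dir o)) (pd (dir o) f x) 0 := by
      have h2 : HasDerivAt (fun t : ℝ => x + t • (dir o : Spc m)) ((1:ℝ) • dir o) 0 := ((hasDerivAt_id (0:ℝ)).smul_const _).const_add x
      have h3 := (hf (x + (0:ℝ) • dir o)).hasFDerivAt.comp_hasDerivAt 0 h2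
      simpa [pd, Function.comp_def] using h3
    have hne : ∀ j : ℕ, ε * (1/2) ^ (j + 1) ≠ 0 := fun j => mul_ne_zero (by intro h; simp [h] at hε) (by positivity)
    have ht : Tendsto (fun j : ℕ => ε * (1/2) ^ (j + 1)) atTop (nhdsWithin 0 {0}ᶜ) := by
      refine tendsto_nhdsWithin_iff.2 ⟨?_, Eventually.of_forall fun j => hne j⟩
      simpa using ((tendsto_add_atTop_iff_nat 1).2 hk).const_mul ε
    have h4 := (hasDerivAt_iff_tendsto_slope_zero.1 hd).comp ht
    refine tendsto_nhds_unique h4 (tendsto_iff_norm_sub_tendsto_zero.2 (squeeze_zero (fun _ => norm_nonneg _) (fun j => ?_) ((tendsto_add_atTop_iff_nat 1).2 hbk)))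
    have h5 := emb2 hf hB (norm_dir o) hm hi hb hb1 hG1 hG2 hx (hε2 j) (j := j + 1) (by rw [abs_mul, hε, one_mul, abs_of_pos (by positivity)])
    set η := ε * (1/2) ^ (j + 1) with hη
    have e5 : f (x + η • dir o) - f x - η * G x = η * (η⁻¹ * (f (x + η • dir o) - f x) - G x) := by
      have : η ≠ 0 := hne j
      field_simp
    rw [e5, abs_mul] at h5
    have := le_of_mul_le_mul_left h5 (abs_pos.2 (hne j))
    simpa only [Function.comp_apply, zero_add, zero_smul, add_zero, smul_eq_mul, Real.norm_eq_abs] using this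
  refine ContinuousOn.congr (f := G) ?_ key
  intro x hx
  rw [Metric.continuousWithinAt_iff]
  intro ε hε
  obtain ⟨k, hk2⟩ := (hbk.eventually (gt_mem_nhds hε)).exists
  refine ⟨(1/2) ^ k, by positivity, fun {x'} hx' hxx => ?_⟩
  rw [Real.dist_eq]
  exact (hG2 k x' hx' x hx (by rw [← dist_eq_norm]; exact hxx.le)).trans_lt hk2

lemma Per.cont {m : ℕ} {g : Spc m → ℝ} (hp : Per g) (hc : ContinuousOn g (ccube m)) : Continuous g := by
  have hcl : IsClosed (ccube m) := (compact_ccube m).isClosed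
  have ha : ∀ k : ℤ × (Fin m → ℤ), Continuous fun y : Spc m => y + lat k := fun k => by fun_prop
  refine LocallyFinite.continuous (f := fun k : ℤ × (Fin m → ℤ) => {y : Spc m | y + lat k ∈ ccube m}) ?_ ?_ (fun k => hcl.preimage (ha k)) (fun k => ?_)
  · intro x
    refine ⟨Metric.ball x 1, Metric.ball_mem_nhds x one_pos, ((Set.finite_Icc ⌊-x.1 - 1⌋ ⌈2 - x.1⌉).prod (Set.Finite.pi' fun i => Set.finite_Icc ⌊-x.2 i - 1⌋ ⌈2 - x.2 i⌉)).subset ?_⟩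
    rintro k ⟨y, hy, hyx⟩
    have hb : ∀ a : ℝ, ∀ z : ℝ, |z| ≤ 1 → ∀ n : ℤ, a + z + n ∈ Icc (0:ℝ) 1 → ⌊-a - 1⌋ ≤ n ∧ n ≤ ⌈2 - a⌉ := fun a z hz n hn => by
      have h1 := abs_le.1 hz
      constructor
      · have := Int.floor_le (-a - 1)
        exact_mod_cast (by linarith [hn.1] : ((⌊-a - 1⌋:ℤ):ℝ) ≤ n)
      · have := Int.le_ceil (2 - a)
        exact_mod_cast (by linarith [hn.2] : ((n:ℤ):ℝ) ≤ ⌈2 - a⌉)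
    have hn : ‖y - x‖ ≤ 1 := by rw [← dist_eq_norm]; exact (Metric.mem_ball.1 hyx).le
    have h1 := hb x.1 (y.1 - x.1) ((norm_fst_le (y - x)).trans hn) k.1 (by simpa [lat] using hy.1)
    have h2 := fun i => hb (x.2 i) (y.2 i - x.2 i) ((norm_le_pi_norm (y - x).2 i).trans ((norm_snd_le (y - x)).trans hn)) (k.2 i) (by simpa [lat] using hy.2 i (mem_univ i))
    exact ⟨h1, h2⟩
  · refine eq_univ_of_forall fun x => ?_
    obtain ⟨k, hk⟩ := lat_cover x
    exact mem_iUnion.2 ⟨k, cube_sub m hk⟩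
  · have h1 : ContinuousOn (fun y => g (y + lat k)) {y : Spc m | y + lat k ∈ ccube m} := hc.comp (ha k).continuousOn fun y hy => hy
    simpa only [hp _ k] using h1

lemma WNorm_mid {m : ℕ} {σ p : ℝ} (h1 : 1 < σ) (h2 : σ < 2) (f : Spc m → ℝ) :
    WNorm σ p f = LpN p f + eLpNorm (fun x => ‖grd f x‖) (ENNReal.ofReal p) (μT m) + gagl (σ - 1) p (grd f) := by
  rw [WNorm, if_neg (by linarith), if_neg (by linarith), if_pos h2, if_neg h1.ne']

lemma emb {m : ℕ} {σ p : ℝ} {f : Spc m → ℝ} (hp : 1 ≤ p) (h1 : 1 + ((m:ℝ) + 1) / p < σ) (h2 : σ < 2) (hf : MemW σ p f) : ContDiff ℝ 1 f := by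
  obtain ⟨hper, hme, hd, -, hW⟩ := hf
  have hp0 : 0 < p := by linarith
  have hpos : 0 < ((m:ℝ) + 1) / p := by positivity
  have hσ : 1 < σ := by linarith
  have hd := hd hσ.le
  rw [isPeriodic_iff] at hper
  rw [WNorm_mid hσ h2] at hW
  have hW1 : eLpNorm (fun x => ‖grd f x‖) (ENNReal.ofReal p) (μT m) < ⊤ := lt_of_le_of_lt (le_trans le_add_self le_self_add) hW
  have hW2 : gagl (σ - 1) p (grd f) < ⊤ := lt_of_le_of_lt le_add_self hW
  obtain ⟨B, -, hB⟩ := hper.bdd hd.continuous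
  have hW3 : (∫⁻ x in cube m, ∫⁻ y in cube m, ENNReal.ofReal (‖grd f x - grd f y‖ ^ p / ‖x - y‖ ^ ((m : ℝ) + 1 + (σ - 1) * p))) ≠ ⊤ := fun h => by
    rw [gagl, h, ENNReal.top_rpow_of_pos (by positivity)] at hW2
    exact lt_irrefl _ hW2
  have hc : ∀ o, Continuous (pd (dir o) f) := fun o => by
    have hi : IntegrableOn (pd (dir o) f) (cube m) := by
      have : MemLp (pd (dir o) f) (ENNReal.ofReal p) (μT m) := ⟨(meas_pd f _).aestronglyMeasurable, lt_of_le_of_lt (eLpNorm_mono fun x => by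
        rw [norm_norm]; exact pd_le le_rfl o) hW1⟩
      have hq : (1:ℝ≥0∞) ≤ ENNReal.ofReal p := by rw [← ENNReal.ofReal_one]; exact ENNReal.ofReal_le_ofReal hp
      rw [μT] at this
      exact this.integrable hq
    refine (hper.pd _).cont (emb3 hd hB o (meas_pd f _) hi hp (s := σ - 1) (by linarith) ENNReal.toReal_nonneg ((?_ : _ ≤ _).trans (ENNReal.ofReal_toReal hW3).ge))
    refine lintegral_mono fun x => lintegral_mono fun y => ENNReal.ofReal_le_ofReal ?_
    have : |pd (dir o) f x - pd (dir o) f y| ≤ ‖grd f x - grd f y‖ :=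
      ((grd f x - grd f y).le_opNorm (dir o)).trans (mul_le_of_le_one_right (norm_nonneg _) (norm_dir o))
    gcongr
  rw [contDiff_one_iff_fderiv]
  refine ⟨hd, continuous_clm_apply.2 fun z => ?_⟩
  have : (fun x => fderiv ℝ f x z) = fun x => ∑ o, co o z * pd (dir o) f x := funext fun x => clm_dir _ _
  rw [this]
  exact continuous_finsetSum _ fun o _ => (hc o).const_mul _

lemma one_le_ofReal {p : ℝ} (hp : 1 ≤ p) : (1:ℝ≥0∞) ≤ ENNReal.ofReal p := by
  rw [← ENNReal.ofReal_one]; exact ENNReal.ofReal_le_ofReal hp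

lemma l1_le {m : ℕ} {g : Spc m → ℝ} (hg : Measurable g) {p ε : ℝ} (hp : 1 ≤ p) (hε : 0 ≤ ε) (h : LpN p g ≤ ENNReal.ofReal ε) : ∫ x in cube m, |g x| ≤ ε := by
  have h1 : ∫⁻ x in cube m, ‖g x‖ₑ ≤ ENNReal.ofReal ε := by
    rw [← eLpNorm_one_eq_lintegral_enorm]
    exact (eLpNorm_le_eLpNorm_of_exponent_le (one_le_ofReal hp) hg.aestronglyMeasurable).trans h
  have h2 := integral_norm_eq_lintegral_enorm (μ := volume.restrict (cube m)) hg.aestronglyMeasurable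
  calc ∫ x in cube m, |g x| = _ := h2
    _ ≤ ε := ENNReal.toReal_le_of_le_ofReal hε h1

lemma sys_of {m : ℕ} {V : Spc m → ℝ} {β σ p : ℝ} {ψ0 : Spc m → ℝ} {T : ℝ≥0∞} {ψ : ℝ → Spc m → ℝ}
    (hV : ContDiff ℝ 2 V) (hVper : IsPeriodic V) (hβ : 0 < β) (h1 : Hyp1 σ p ψ0) (h2 : Hyp2 m σ p)
    (hψ : IsLpSolution V β σ p ψ0 T ψ) : Sys V β⁻¹ T ψ := by
  obtain ⟨hm, hp, hσ, hσ2⟩ := h2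
  obtain ⟨⟨hW, hpos⟩, hnn, hmass⟩ := h1
  have hp1 : 1 ≤ p := by have : (0:ℝ) ≤ m := m.cast_nonneg; linarith
  have e0 : ψ 0 = ψ0 := funext hψ.init
  have hVp := isPeriodic_iff.1 hVper
  have c0 : ContDiff ℝ 1 ψ0 := emb hp1 hσ hσ2 hW
  have reg : ∀ t ∈ Ioo0 T, Reg (ψ t) := fun t ht => reg_of hp1 (hψ.regW2 t ht) (hψ.regD t ht)
  have hms : ∀ t ∈ Ico0 T, Measurable (ψ t) := fun t ht => by
    rcases Ico0_cases ht with rfl | h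
    · rw [e0]; exact c0.continuous.measurable
    · exact (reg t h).c1.continuous.measurable
  refine ⟨hV, hVp, inv_pos.2 hβ, reg, by rw [e0]; exact isPeriodic_iff.1 hW.1, by rwa [e0], by rwa [e0], by rwa [e0], by rwa [e0], fun t ht => ?_, fun s hs => ?_⟩
  · rw [Metric.tendsto_nhdsWithin_nhds]
    intro ε hε
    obtain ⟨δ, hδ, h⟩ := hψ.contLp t ht (ε / 2) (by positivity)
    refine ⟨δ, hδ, fun {s} hs hst => ?_⟩
    have h3 := h s hs hst
    rw [WNorm, if_pos le_rfl] at h3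
    have h4 := l1_le ((hms s hs).sub (hms t ht)) hp1 (by positivity) h3.le
    rw [dist_zero_right, Real.norm_eq_abs, abs_of_nonneg (integral_nonneg fun x => abs_nonneg _)]
    exact h4.trans_lt (by linarith)
  · rw [Asymptotics.isLittleO_iff]
    intro c hc
    have h3 := (hψ.eqn s hs).eventually (gt_mem_nhds (ENNReal.ofReal_pos.2 hc))
    rw [eventually_nhdsWithin_iff] at h3
    have ht : Tendsto (fun t : ℝ => t - s) (nhds s) (nhds 0) := by
      have : Continuous fun t : ℝ => t - s := by fun_prop
      simpa using this.tendsto s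
    filter_upwards [ht.eventually h3, Ioo0_nhds hs] with t h4 htT
    rw [Real.norm_eq_abs, abs_of_nonneg (integral_nonneg fun x => abs_nonneg _), Real.norm_eq_abs]
    by_cases hts : t - s = 0
    · have : t = s := by linarith
      subst this; simp
    · have h5 := h4 hts
      rw [add_sub_cancel] at h5
      have hmR : Measurable (Rop β⁻¹ V (ψ s)) := (Rop_PI hV hVp (reg s hs)).meas
      have h6 := l1_le (((((hms t (Ioo0_sub htT)).sub (hms s (Ioo0_sub hs))).div_const (t - s))).sub hmR) hp1 hc.le h5.le
      have e1 : ∀ x, |ψ t x - ψ s x - (t - s) * Rop β⁻¹ V (ψ s) x| = |t - s| * |(ψ t x - ψ s x) / (t - s) - Rop β⁻¹ V (ψ s) x| := fun x => by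
        rw [← abs_mul]; congr 1; field_simp
      simp only [e1]
      rw [integral_const_mul, mul_comm]
      exact mul_le_mul_of_nonneg_right h6 (abs_nonneg _)

lemma sing_fin {m : ℕ} {a : ℝ} (ha : -((m:ℝ) + 1) < a) :
    ∫⁻ z : Spc m, (Metric.closedBall (0 : Spc m) 1).indicator (fun z => ENNReal.ofReal (‖z‖ ^ a)) z < ⊤ := by
  have h := integrable_fun_norm_addHaar (E := Spc m) (F := ℝ) volume (f := (Iic 1).indicator fun y : ℝ => y ^ a)
  have hfr : Module.finrank ℝ (Spc m) = m + 1 := by simp [add_comm]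
  have h1 : Integrable (fun z : Spc m => (Iic 1).indicator (fun y : ℝ => y ^ a) ‖z‖) volume := by
    rw [h, hfr, Nat.add_sub_cancel]
    have h2 : IntegrableOn (fun y : ℝ => y ^ (m + a)) (Ioc 0 1) := by
      rw [← intervalIntegrable_iff_integrableOn_Ioc_of_le zero_le_one]
      exact intervalIntegral.intervalIntegrable_rpow' (by linarith)
    have h3 : IntegrableOn ((Iic 1).indicator fun y : ℝ => y ^ (m + a)) (Ioi 0) := by
      rw [IntegrableOn, integrable_indicator_iff measurableSet_Iic, IntegrableOn, Measure.restrict_restrict measurableSet_Iic, inter_comm, Ioi_inter_Iic]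
      exact h2
    refine h3.congr_fun (fun y hy => ?_) measurableSet_Ioi
    by_cases hy1 : y ∈ Iic (1:ℝ)
    · simp only [indicator_of_mem hy1, smul_eq_mul]
      rw [Real.rpow_add hy, Real.rpow_natCast]
    · simp [indicator_of_notMem hy1]
  refine lt_of_le_of_lt (lintegral_mono fun z => ?_) h1.2
  by_cases hz : ‖z‖ ≤ 1
  · rw [indicator_of_mem (by simpa using hz)]
    show _ ≤ ‖(Iic 1).indicator (fun y : ℝ => y ^ a) ‖z‖‖ₑ
    rw [indicator_of_mem (mem_Iic.2 hz), ← ofReal_norm, Real.norm_of_nonneg (by positivity)]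
  · rw [indicator_of_notMem (by simpa using hz)]; simp

lemma gagl_le {m : ℕ} {F : Type*} [NormedAddCommGroup F] {f : Spc m → F} {C α s p : ℝ} (hC : 0 ≤ C) (hp : 0 < p)
    (hf : ∀ x ∈ cube m, ∀ y ∈ cube m, ‖f x - f y‖ ≤ C * ‖x - y‖ ^ α) :
    gagl s p f ≤ (ENNReal.ofReal (C ^ p) * ∫⁻ z : Spc m, (Metric.closedBall (0 : Spc m) 1).indicator (fun z => ENNReal.ofReal (‖z‖ ^ (α * p - (m + 1 + s * p)))) z) ^ (1 / p) := by
  unfold gagl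
  refine ENNReal.rpow_le_rpow ?_ (by positivity)
  set a := α * p - (m + 1 + s * p) with ha
  set k : Spc m → ℝ≥0∞ := (Metric.closedBall (0 : Spc m) 1).indicator (fun z => ENNReal.ofReal (‖z‖ ^ a)) with hk
  have hkm : Measurable k := (measurable_norm.pow_const a).ennreal_ofReal.indicator measurableSet_closedBall
  have h1 : ∀ x ∈ cube m, ∫⁻ y in cube m, ENNReal.ofReal (‖f x - f y‖ ^ p / ‖x - y‖ ^ ((m : ℝ) + 1 + s * p)) ≤ ENNReal.ofReal (C ^ p) * ∫⁻ z, k z := fun x hx => by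
    calc _ ≤ ∫⁻ y in cube m, ENNReal.ofReal (C ^ p) * k (x - y) := by
          refine setLIntegral_mono' (meas_cube m) fun y hy => ?_
          have hxy : x - y ∈ Metric.closedBall (0 : Spc m) 1 := by
            rw [mem_closedBall_zero_iff]; exact ccube_diam (cube_sub m hx) (cube_sub m hy)
          rw [hk, indicator_of_mem hxy, ← ENNReal.ofReal_mul (by positivity)]
          refine ENNReal.ofReal_le_ofReal ?_
          by_cases h : x = y
          · subst h
            rw [sub_self (f x), norm_zero, Real.zero_rpow hp.ne', zero_div]; positivity
          · have h3 : 0 < ‖x - y‖ := norm_pos_iff.2 (sub_ne_zero.2 h)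
            rw [ha, Real.rpow_sub h3, ← mul_div_assoc, Real.rpow_mul h3.le, ← Real.mul_rpow hC (by positivity)]
            have := hf x hx y hy
            gcongr
      _ ≤ ∫⁻ y, ENNReal.ofReal (C ^ p) * k (x - y) := setLIntegral_le_lintegral _ _
      _ = _ := by
          have hm2 : Measurable fun y => k (x - y) := hkm.comp (by fun_prop : Measurable fun y : Spc m => x - y)
          rw [lintegral_const_mul _ hm2, lintegral_sub_left_eq_self k x]
  refine (setLIntegral_mono' (meas_cube m) h1).trans ?_
  rw [lintegral_const, measure_univ, mul_one]

namespace Sys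
variable {m : ℕ} {V : Spc m → ℝ} {κ : ℝ} {T : ℝ≥0∞} {u : ℝ → Spc m → ℝ}

lemma grd_bd (S : Sys V κ T u) : ∃ L, 0 < L ∧ ∀ t ∈ Ico0 T, ∀ x, ‖grd (u t) x‖ ≤ L := by
  obtain ⟨L, hL0, hL⟩ := S.lip_bd
  refine ⟨L, hL0, fun t ht x => ?_⟩
  have h := norm_fderiv_le_of_lipschitz ℝ (x₀ := x) (f := u t) (C := ⟨L, hL0.le⟩) (LipschitzWith.of_dist_le_mul fun a b => by
    have := hL t ht b (a - b)
    rw [add_sub_cancel] at this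
    rw [Real.dist_eq, dist_eq_norm]; exact this)
  exact h

lemma W_bd (S : Sys V κ T u) {δ ρ p : ℝ} (hδ : 0 < δ) (h1 : 1 < ρ) (h2 : ρ < 2) (hp : 1 ≤ p) :
    ∃ M : ℝ, ∀ t : ℝ, δ ≤ t → ENNReal.ofReal t < T → WNorm ρ p (u t) ≤ ENNReal.ofReal M := by
  obtain ⟨M, hM0, hM⟩ := S.sup_bd
  obtain ⟨L, hL0, hL⟩ := S.grd_bd
  obtain ⟨C, hC0, hC⟩ := S.grad_hol (α := ρ / 2) (by linarith) (by linarith) hδ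
  set I := ∫⁻ z : Spc m, (Metric.closedBall (0 : Spc m) 1).indicator (fun z => ENNReal.ofReal (‖z‖ ^ (ρ / 2 * p - (m + 1 + (ρ - 1) * p)))) z with hI
  have hIf : I < ⊤ := sing_fin (by nlinarith)
  set A : ℝ≥0∞ := ENNReal.ofReal M + ENNReal.ofReal L + (ENNReal.ofReal ((2 * C) ^ p) * I) ^ (1 / p) with hA
  have hAf : A ≠ ⊤ := ENNReal.add_ne_top.2 ⟨ENNReal.add_ne_top.2 ⟨ENNReal.ofReal_ne_top, ENNReal.ofReal_ne_top⟩,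
    ENNReal.rpow_ne_top_of_nonneg (by positivity) (ENNReal.mul_ne_top ENNReal.ofReal_ne_top hIf.ne)⟩
  have hpr : ∀ (g : Spc m → ℝ) (B : ℝ), (∀ x, ‖g x‖ ≤ B) → eLpNorm g (ENNReal.ofReal p) (μT m) ≤ ENNReal.ofReal B := fun g B hB => by
    have := eLpNorm_le_of_ae_bound (μ := volume.restrict (cube m)) (p := ENNReal.ofReal p) (ae_of_all _ hB)
    rw [μT]; simpa [vol_cube] using this
  refine ⟨A.toReal, fun t ht htT => ?_⟩
  have htI : t ∈ Ico0 T := ⟨hδ.le.trans ht, htT⟩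
  rw [ENNReal.ofReal_toReal hAf, WNorm_mid h1 h2]
  refine add_le_add (add_le_add (hpr _ _ (hM t htI)) (hpr _ _ fun x => by rw [norm_norm]; exact hL t htI x)) ?_
  refine gagl_le (by positivity) (by linarith) fun x hx y hy => ?_
  have h3 := hC t htI ht y (x - y)
  rw [add_sub_cancel] at h3
  have h4 := ccube_diam (cube_sub m hx) (cube_sub m hy)
  have h5 : ‖x - y‖ ≤ ‖x - y‖ ^ (ρ / 2) := by
    conv_lhs => rw [← Real.rpow_one ‖x - y‖]
    exact Real.rpow_le_rpow_of_exponent_ge_of_imp (norm_nonneg _) h4 (by linarith) (by intros; linarith)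
  refine h3.trans ?_
  nlinarith
end Sys

lemma Per.uc {m : ℕ} {F : Type*} [NormedAddCommGroup F] {f : Spc m → F} (hp : Per f) (hc : Continuous f) {ε : ℝ} (hε : 0 < ε) :
    ∃ δ, 0 < δ ∧ ∀ x h, ‖h‖ < δ → ‖f (x + h) - f x‖ ≤ ε := by
  have h1 := (isCompact_closedBall (0 : Spc m) 2).uniformContinuousOn_of_continuous hc.continuousOn
  obtain ⟨δ, hδ, h2⟩ := Metric.uniformContinuousOn_iff.1 h1 ε hε
  refine ⟨min δ 1, by positivity, fun x h hh => ?_⟩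
  obtain ⟨k, hk⟩ := lat_cover x
  have h3 : ‖x + lat k‖ ≤ 1 := by
    have h0 : (0 : Spc m) ∈ ccube m := mem_ccube.2 fun o => by simp
    simpa using ccube_diam (cube_sub m hk) h0
  have e : x + lat k + h = x + h + lat k := by abel
  have h4 : ‖x + lat k + h‖ ≤ 2 := (norm_add_le _ _).trans (by linarith [hh.trans_le (min_le_right _ _)])
  have h5 := h2 (x + lat k + h) (by simpa using h4) (x + lat k) (by simpa using h3.trans one_le_two) (by
    rw [dist_eq_norm, add_sub_cancel_left]; exact hh.trans_le (min_le_left _ _))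
  rw [e, hp, hp, dist_eq_norm] at h5
  exact h5.le

namespace Sys
variable {m : ℕ} {V : Spc m → ℝ} {κ : ℝ} {T : ℝ≥0∞} {u : ℝ → Spc m → ℝ}

lemma equi (S : Sys V κ T u) {ε : ℝ} (hε : 0 < ε) : ∃ δ, 0 < δ ∧ ∀ t ∈ Ico0 T, ∀ x h, ‖h‖ < δ →
    |u t (x + h) - u t x| ≤ ε ∧ ‖grd (u t) (x + h) - grd (u t) x‖ ≤ ε := by
  obtain ⟨L, hL0, hL⟩ := S.lip_bd
  obtain ⟨C, hC0, hC⟩ := S.grad_hol (α := 1/2) (by norm_num) (by norm_num) one_pos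
  obtain ⟨C', hC0', hC'⟩ := S.grad_small
  set ω := ε / (2 * ((m:ℝ) + 1)) with hω
  have hω0 : 0 < ω := by positivity
  obtain ⟨δ1, hδ1, h1⟩ := S.per0.fderiv.uc (S.c0.continuous_fderiv (by norm_num)) hω0
  have hr : Continuous fun r : ℝ => r ^ (1/2:ℝ) := continuous_id.rpow_const fun _ => Or.inr (by norm_num)
  have hΦ : Continuous fun r : ℝ => L * r + C * (r + r ^ (1/2:ℝ)) + (m + 1) * (C' * r ^ (1/2:ℝ)) := by fun_prop
  have ht := hΦ.tendsto 0
  simp only [Real.zero_rpow (by norm_num : (1/2:ℝ) ≠ 0), mul_zero, add_zero] at ht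
  obtain ⟨δ2, hδ2, h2⟩ := Metric.eventually_nhds_iff.1 (ht.eventually (gt_mem_nhds (half_pos hε)))
  refine ⟨min δ1 δ2, by positivity, fun t htT x h hh => ?_⟩
  have h3 := h2 (y := ‖h‖) (by rw [dist_zero_right, norm_norm]; exact hh.trans_le (min_le_right _ _))
  have p1 : 0 ≤ L * ‖h‖ := by positivity
  have p2 : 0 ≤ C * (‖h‖ + ‖h‖ ^ (1/2:ℝ)) := by positivity
  have p3 : 0 ≤ (m + 1) * (C' * ‖h‖ ^ (1/2:ℝ)) := by positivity
  refine ⟨(hL t htT x h).trans (by linarith), ?_⟩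
  rcases le_total t 1 with h4 | h4
  · refine (hC' t htT h4 h ω hω0.le (fun y => h1 y h (hh.trans_le (min_le_left _ _))) x).trans ?_
    have e : ((m:ℝ) + 1) * ω = ε / 2 := by rw [hω]; field_simp
    rw [mul_add, e]; linarith
  · exact (hC t htT h4 x h).trans (by linarith)

lemma cpt (S : Sys V κ T u) {τ : ℕ → ℝ} (hτ : ∀ k, τ k ∈ Ico0 T) :
    ∃ (g : Spc m → ℝ) (φ : ℕ → ℕ), StrictMono φ ∧ Tendsto (fun k => C1dist (u (τ (φ k))) g) atTop (nhds 0) := by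
  obtain ⟨M, hM0, hM⟩ := S.sup_bd
  obtain ⟨L, hL0, hL⟩ := S.grd_bd
  haveI : CompactSpace (ccube m) := isCompact_iff_compactSpace.1 (compact_ccube m)
  have hgc : ∀ k, Continuous (grd (u (τ k))) := fun k => (S.c1 (hτ k)).continuous_fderiv (by norm_num)
  let f : ℕ → BoundedContinuousFunction (ccube m) (ℝ × (Spc m →L[ℝ] ℝ)) := fun k =>
    BoundedContinuousFunction.mkOfCompact ⟨fun x => (u (τ k) x.1, grd (u (τ k)) x.1), ((S.cont (hτ k)).comp continuous_subtype_val).prodMk ((hgc k).comp continuous_subtype_val)⟩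
  have hcpt : IsCompact (closure (range f)) := by
    refine BoundedContinuousFunction.arzela_ascoli (Metric.closedBall 0 (max M L)) (isCompact_closedBall _ _) (range f) ?_ ?_
    · rintro _ x ⟨k, rfl⟩
      rw [mem_closedBall_zero_iff]
      exact max_le_max (hM _ (hτ k) x.1) (hL _ (hτ k) x.1)
    · intro x
      rw [Metric.equicontinuousAt_iff]
      intro ε hε
      obtain ⟨δ, hδ, h1⟩ := S.equi (half_pos hε)
      refine ⟨δ, hδ, fun y hy => ?_⟩
      rintro ⟨_, ⟨k, rfl⟩⟩
      have h2 := h1 _ (hτ k) x.1 (y.1 - x.1) (by rw [← dist_eq_norm]; exact hy)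
      rw [add_sub_cancel] at h2
      rw [dist_comm, dist_eq_norm]
      refine lt_of_le_of_lt (?_ : _ ≤ ε / 2) (by linarith)
      exact max_le h2.1 h2.2
  obtain ⟨F, -, φ, hφ, hF⟩ := hcpt.tendsto_subseq fun k => subset_closure (mem_range_self k)
  have hcau : ∀ ε > 0, ∃ N, ∀ j ≥ N, ∀ k ≥ N, ∀ x, dist (u (τ (φ j)) x) (u (τ (φ k)) x) < ε ∧ dist (grd (u (τ (φ j))) x) (grd (u (τ (φ k))) x) < ε := fun ε hε => by
    obtain ⟨N, hN⟩ := Metric.cauchySeq_iff.1 hF.cauchySeq ε hε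
    refine ⟨N, fun j hj k hk x => ?_⟩
    obtain ⟨l, hl⟩ := lat_cover x
    have h1 := (BoundedContinuousFunction.dist_coe_le_dist ⟨x + lat l, cube_sub m hl⟩).trans_lt (hN j hj k hk)
    have h2 : dist (u (τ (φ j)) (x + lat l)) (u (τ (φ k)) (x + lat l)) < ε := (le_max_left _ _).trans_lt h1
    have h3 : dist (grd (u (τ (φ j))) (x + lat l)) (grd (u (τ (φ k))) (x + lat l)) < ε := (le_max_right _ _).trans_lt h1
    have p1 : ∀ k, Per (grd (u (τ k))) := fun k => (S.per (hτ k)).fderiv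
    rw [S.per (hτ _), S.per (hτ _)] at h2
    rw [p1, p1] at h3
    exact ⟨h2, h3⟩
  have c1 : ∀ x, ∃ l, Tendsto (fun k => u (τ (φ k)) x) atTop (nhds l) := fun x => cauchySeq_tendsto_of_complete (Metric.cauchySeq_iff.2 fun ε hε => by
    obtain ⟨N, hN⟩ := hcau ε hε
    exact ⟨N, fun j hj k hk => (hN j hj k hk x).1⟩)
  have c2 : ∀ x, ∃ l, Tendsto (fun k => grd (u (τ (φ k))) x) atTop (nhds l) := fun x => cauchySeq_tendsto_of_complete (Metric.cauchySeq_iff.2 fun ε hε => by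
    obtain ⟨N, hN⟩ := hcau ε hε
    exact ⟨N, fun j hj k hk => (hN j hj k hk x).2⟩)
  choose g hg using c1
  choose D hD using c2
  have hun : ∀ ε > 0, ∃ N, ∀ j ≥ N, ∀ x, dist (u (τ (φ j)) x) (g x) ≤ ε ∧ dist (grd (u (τ (φ j))) x) (D x) ≤ ε := fun ε hε => by
    obtain ⟨N, hN⟩ := hcau ε hε
    refine ⟨N, fun j hj x => ⟨le_of_tendsto (tendsto_const_nhds.dist (hg x)) ?_, le_of_tendsto (tendsto_const_nhds.dist (hD x)) ?_⟩⟩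
    · filter_upwards [eventually_ge_atTop N] with k hk using (hN j hj k hk x).1.le
    · filter_upwards [eventually_ge_atTop N] with k hk using (hN j hj k hk x).2.le
  have hgrd : grd g = D := by
    funext x
    refine (hasFDerivAt_of_tendstoUniformly (l := atTop) (f := fun k => u (τ (φ k))) (f' := fun k => grd (u (τ (φ k)))) ?_ (fun k x => ((S.c1 (hτ (φ k))).differentiable (by norm_num) x).hasFDerivAt) hg x).fderiv
    rw [Metric.tendstoUniformly_iff]
    intro ε hε
    obtain ⟨N, hN⟩ := hun (ε / 2) (half_pos hε)
    filter_upwards [eventually_ge_atTop N] with k hk x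
    rw [dist_comm]
    exact ((hN k hk x).2).trans_lt (by linarith)
  refine ⟨g, φ, hφ, ENNReal.tendsto_nhds_zero.2 fun ε hε => ?_⟩
  obtain ⟨η, hη, hηε⟩ : ∃ η : ℝ, 0 < η ∧ ENNReal.ofReal η + ENNReal.ofReal η ≤ ε := by
    by_cases h : ε = ⊤
    · exact ⟨1, one_pos, by simp [h]⟩
    · have h0 : 0 < ε.toReal := ENNReal.toReal_pos hε.ne' h
      refine ⟨ε.toReal / 2, by positivity, ?_⟩
      rw [← ENNReal.ofReal_add (by positivity) (by positivity), add_halves, ENNReal.ofReal_toReal h]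
  obtain ⟨N, hN⟩ := hun η hη
  filter_upwards [eventually_ge_atTop N] with k hk
  refine le_trans (add_le_add (iSup_le fun x => ENNReal.ofReal_le_ofReal ?_) (iSup_le fun x => ENNReal.ofReal_le_ofReal ?_)) hηε
  · exact (hN k hk x).1
  · rw [hgrd, ← dist_eq_norm]; exact (hN k hk x).2
end Sys

theorem fokkerPlanck_orbit_bounds_and_compactness
    (m : ℕ) (V : Spc m → ℝ) (β σ p : ℝ) (ψ0 : Spc m → ℝ)
    (Tmax : ℝ≥0∞) (ψ : ℝ → Spc m → ℝ)
    (hV : ContDiff ℝ 2 V) (hVper : IsPeriodic V) (hβ : 0 < β)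
    (h1 : Hyp1 σ p ψ0) (h2 : Hyp2 m σ p)
    (hψ : IsMaximalLpSolution V β σ p ψ0 Tmax ψ) :
    (∀ δ : ℝ, 0 < δ → ∀ ρ : ℝ, σ ≤ ρ → ρ < 2 →
      ∃ M : ℝ, ∀ t : ℝ, δ ≤ t → ENNReal.ofReal t < Tmax →
        WNorm ρ p (ψ t) ≤ ENNReal.ofReal M) ∧
    (∀ u : ℕ → ℝ, (∀ k, u k ∈ Ico0 Tmax) →
      ∃ (g : Spc m → ℝ) (φ : ℕ → ℕ), StrictMono φ ∧
        Tendsto (fun k => C1dist (ψ (u (φ k))) g) atTop (nhds 0)) := by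
  have S := sys_of hV hVper hβ h1 h2 hψ.1
  obtain ⟨-, hp, hσ, -⟩ := h2
  have hm0 : (0:ℝ) ≤ m := m.cast_nonneg
  have hpos : 0 < ((m:ℝ) + 1) / p := div_pos (by linarith) (by linarith)
  exact ⟨fun δ hδ ρ h3 h4 => S.W_bd hδ (by linarith) h4 (by linarith), fun u hu => S.cpt hu⟩
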